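/- arXiv:2603.18253 — 12 statements merged into one kernel-verified Lean document; each statement's English description precedes it below -/
import Mathlib

section
/- Let n1, k1, n2, k2 be positive integers with n1·k2 = n2·k1. Let M1 be an (n1 × k1)-matrix with nonnegative real entries in which every row sums to k2 and every column sums to n2, and let M2 be an (n2 × k2)-matrix with nonnegative real entries in which every row sums to k1 and every column sums to n1. Then there exists a bijection σ : Fin n1 × Fin k2 ≃ Fin k1 × Fin n2 such that for every (i, l) : Fin n1 × Fin k2, writing (j, m) = σ (i, l), one has M1 i j ≠ 0 and M2 m l ≠ 0. -/
/-- A nonnegative real matrix whose rows and columns all have the same positive sum has a perfect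
matching in its support. -/
theorem Matrix.exists_equiv_apply_ne_zero {ι κ : Type*} [Fintype ι] [Fintype κ]
    (A : Matrix ι κ ℝ) {s : ℝ} (hs : 0 < s) (hA : ∀ i j, 0 ≤ A i j)
    (hrow : ∀ i, ∑ j, A i j = s) (hcol : ∀ j, ∑ i, A i j = s) :
    ∃ σ : ι ≃ κ, ∀ i, A i (σ i) ≠ 0 := by
  classical
  have hall : ∀ S : Finset ι,
      S.card ≤ (Finset.univ.filter fun j => ∃ i ∈ S, A i j ≠ 0).card := by
    intro S
    set T := Finset.univ.filter fun j => ∃ i ∈ S, A i j ≠ 0 with hT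
    have hle : (S.card : ℝ) * s ≤ T.card * s := calc
      (S.card : ℝ) * s = ∑ i ∈ S, ∑ j, A i j := by simp [hrow]
      _ = ∑ i ∈ S, ∑ j ∈ T, A i j := by
        refine Finset.sum_congr rfl fun i hi => ?_
        refine (Finset.sum_subset (Finset.subset_univ T) fun j _ hj => ?_).symm
        by_contra h
        exact hj (Finset.mem_filter.mpr ⟨Finset.mem_univ j, i, hi, h⟩)
      _ = ∑ j ∈ T, ∑ i ∈ S, A i j := Finset.sum_comm
      _ ≤ ∑ j ∈ T, ∑ i, A i j := Finset.sum_le_sum fun j _ =>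
        Finset.sum_le_sum_of_subset_of_nonneg (Finset.subset_univ S) fun i _ _ => hA i j
      _ = T.card * s := by simp [hcol]
    exact_mod_cast le_of_mul_le_mul_right hle hs
  obtain ⟨f, hf, hfA⟩ :=
    (Fintype.all_card_le_filter_rel_iff_exists_injective fun i j => A i j ≠ 0).mp hall
  have hcard : Fintype.card ι = Fintype.card κ := by
    have h : (Fintype.card ι : ℝ) * s = Fintype.card κ * s := calc
      (Fintype.card ι : ℝ) * s = ∑ i, ∑ j, A i j := by simp [hrow]
      _ = ∑ j, ∑ i, A i j := Finset.sum_comm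
      _ = Fintype.card κ * s := by simp [hcol]
    exact_mod_cast mul_right_cancel₀ hs.ne' h
  exact ⟨Equiv.ofBijective f ((Fintype.bijective_iff_injective_and_card f).mpr ⟨hf, hcard⟩), hfA⟩

/-- If `M1` is an `n1 × k1` nonnegative real matrix with all row sums `k2`
and all column sums `n2`, and `M2` is an `n2 × k2` nonnegative real matrix with all row
sums `k1` and all column sums `n1` (with `n1 * k2 = n2 * k1`), then the bipartite support
graph of `M1 ⊗ M2ᵀ` has a perfect matching. -/
theorem stmt0 (n1 k1 n2 k2 : ℕ) (hn1 : 0 < n1) (hk1 : 0 < k1) (hn2 : 0 < n2) (hk2 : 0 < k2)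
    (hprod : n1 * k2 = n2 * k1)
    (M1 : Matrix (Fin n1) (Fin k1) ℝ) (M2 : Matrix (Fin n2) (Fin k2) ℝ)
    (hM1nn : ∀ i j, 0 ≤ M1 i j) (hM2nn : ∀ i j, 0 ≤ M2 i j)
    (hM1row : ∀ i, ∑ j, M1 i j = (k2 : ℝ)) (hM1col : ∀ j, ∑ i, M1 i j = (n2 : ℝ))
    (hM2row : ∀ i, ∑ j, M2 i j = (k1 : ℝ)) (hM2col : ∀ j, ∑ i, M2 i j = (n1 : ℝ)) :
    ∃ σ : Fin n1 × Fin k2 ≃ Fin k1 × Fin n2,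
      ∀ p : Fin n1 × Fin k2, M1 p.1 (σ p).1 ≠ 0 ∧ M2 (σ p).2 p.2 ≠ 0 := by
  obtain ⟨σ, hσ⟩ := Matrix.exists_equiv_apply_ne_zero
    (Matrix.of fun (p : Fin n1 × Fin k2) (q : Fin k1 × Fin n2) => M1 p.1 q.1 * M2 q.2 p.2)
    (s := (k2 : ℝ) * n1) (by positivity)
    (fun p q => mul_nonneg (hM1nn _ _) (hM2nn _ _))
    (fun p => by
      simp only [Matrix.of_apply, Fintype.sum_prod_type, ← Finset.mul_sum, ← Finset.sum_mul,
        hM1row, hM2col])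
    (fun q => by
      simp only [Matrix.of_apply, Fintype.sum_prod_type, ← Finset.mul_sum, ← Finset.sum_mul,
        hM1col, hM2row]
      rw [mul_comm (k2 : ℝ)]
      exact_mod_cast hprod.symm)
  exact ⟨σ, fun p => mul_ne_zero_iff.mp (hσ p)⟩
end

section
/- Let n ≥ 1 and m ≥ 1 be integers, let ε ∈ {-2, -1, 0, 1, 2}, and let k be a positive integer with (k : ℤ) = m·n + ε. Then for every biregular pair (u, v) on parameters (n, k) there exists an involution ι : Fin n × Fin k → Fin n × Fin k (ι ∘ ι = id) such that for every (x, y) : Fin n × Fin k there is exactly one e : Fin n × Fin k with u (ι e) = x and v e = y. -/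
open Finset in
/-- A bipartite multigraph with edge set `S` in which all vertices have degree `d` has a proper
edge colouring with `d` colours. -/
theorem exists_properColoring_finset {E A B : Type*} [DecidableEq E] [Fintype A] [Fintype B]
    [DecidableEq A] [DecidableEq B] (a : E → A) (b : E → B) (d : ℕ) :
    ∀ S : Finset E, (∀ x, #{e ∈ S | a e = x} = d) → (∀ y, #{e ∈ S | b e = y} = d) →
      ∃ c : E → ℕ, (∀ e ∈ S, c e < d) ∧
        (∀ e ∈ S, ∀ e' ∈ S, a e = a e' → c e = c e' → e = e') ∧
        (∀ e ∈ S, ∀ e' ∈ S, b e = b e' → c e = c e' → e = e') := by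
  induction d with
  | zero =>
    intro S ha _
    have hS : ∀ e, e ∉ S := fun e he => by
      have := ha (a e)
      rw [card_eq_zero, filter_eq_empty_iff] at this
      exact this he rfl
    exact ⟨fun _ => 0, fun e he => absurd he (hS e), fun e he => absurd he (hS e),
      fun e he => absurd he (hS e)⟩
  | succ d ih =>
    intro S ha hb
    have hcA : ∀ X : Finset A, #{e ∈ S | a e ∈ X} = #X * (d + 1) := fun X => by
      rw [card_eq_sum_card_fiberwise (f := a) (t := X) (fun e he => by simp at he; exact he.2),
        sum_const_nat]
      intro x hx
      rw [← ha x, filter_filter]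
      congr 1
      ext e
      simp only [mem_filter]
      constructor
      · rintro ⟨h, -, h'⟩
        exact ⟨h, h'⟩
      · rintro ⟨h, rfl⟩
        exact ⟨h, hx, rfl⟩
    have hcB : ∀ X : Finset B, #{e ∈ S | b e ∈ X} = #X * (d + 1) := fun X => by
      rw [card_eq_sum_card_fiberwise (f := b) (t := X) (fun e he => by simp at he; exact he.2),
        sum_const_nat]
      intro x hx
      rw [← hb x, filter_filter]
      congr 1
      ext e
      simp only [mem_filter]
      constructor
      · rintro ⟨h, -, h'⟩
        exact ⟨h, h'⟩
      · rintro ⟨h, rfl⟩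
        exact ⟨h, hx, rfl⟩
    have hall : ∀ X : Finset A,
        #X ≤ #(X.biUnion fun x => ({e ∈ S | a e = x} : Finset E).image b) := fun X => by
      refine Nat.le_of_mul_le_mul_right (?_ : _ * (d + 1) ≤ _ * (d + 1)) d.succ_pos
      rw [← hcA, ← hcB]
      refine card_le_card fun e he => ?_
      simp only [mem_filter, mem_biUnion, mem_image] at he ⊢
      exact ⟨he.1, a e, he.2, e, ⟨he.1, rfl⟩, rfl⟩
    obtain ⟨f, hf, hft⟩ := (all_card_le_biUnion_card_iff_exists_injective _).1 hall
    simp only [mem_image, mem_filter] at hft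
    choose g hg hgf using hft
    have hAB : Fintype.card A = Fintype.card B := by
      have h1 := hcA univ
      have h2 := hcB univ
      simp only [mem_univ, filter_true, card_univ] at h1 h2
      exact Nat.eq_of_mul_eq_mul_right d.succ_pos (h1.symm.trans h2)
    have hfb : Function.Bijective f := (Fintype.bijective_iff_injective_and_card f).2 ⟨hf, hAB⟩
    have hag : ∀ x, a (g x) = x := fun x => (hg x).2
    obtain ⟨c, hc, hca, hcb⟩ := ih (S \ univ.image g)
      (fun x => by
        have : ({e ∈ S \ univ.image g | a e = x} : Finset E) =
            ({e ∈ S | a e = x} : Finset E).erase (g x) := by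
          ext e
          simp only [mem_filter, mem_sdiff, mem_image, mem_univ, true_and, mem_erase, not_exists]
          constructor
          · rintro ⟨⟨h, h'⟩, h''⟩
            exact ⟨fun h3 => h' x h3.symm, h, h''⟩
          · rintro ⟨h, h', rfl⟩
            refine ⟨⟨h', fun y hy => h ?_⟩, rfl⟩
            rw [← hy, hag]
        rw [this, card_erase_of_mem (by simp [hg]), ha]
        rfl)
      (fun y => by
        obtain ⟨x, rfl⟩ := hfb.2 y
        have : ({e ∈ S \ univ.image g | b e = f x} : Finset E) =
            ({e ∈ S | b e = f x} : Finset E).erase (g x) := by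
          ext e
          simp only [mem_filter, mem_sdiff, mem_image, mem_univ, true_and, mem_erase, not_exists]
          constructor
          · rintro ⟨⟨h, h'⟩, h''⟩
            exact ⟨fun h3 => h' x h3.symm, h, h''⟩
          · rintro ⟨h, h', h''⟩
            refine ⟨⟨h', fun y hy => h ?_⟩, h''⟩
            rw [← hy, hgf] at h''
            rw [← hy, hf h'']
        rw [this, card_erase_of_mem (by simp [hg, hgf]), hb]
        rfl)
    have hmem : ∀ e ∈ S, (¬ ∃ x, g x = e) → e ∈ S \ univ.image g := fun e he h => by
      simpa using ⟨he, fun x hx => h ⟨x, hx⟩⟩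
    classical
    refine ⟨fun e => if ∃ x, g x = e then d else c e, ?_, ?_, ?_⟩
    · intro e he
      dsimp only
      split_ifs with h
      · exact d.lt_succ_self
      · exact (hc e (hmem e he h)).trans d.lt_succ_self
    all_goals
      intro e he e' he' hee
      dsimp only
      split_ifs with h h' h'
      · intro _
        obtain ⟨x, rfl⟩ := h
        obtain ⟨y, rfl⟩ := h'
        simp only [hag, hgf] at hee
        first
          | rw [hee]
          | rw [hf hee]
      · intro h3
        exact absurd (hc e' (hmem e' he' h')) (by omega)
      · intro h3
        exact absurd (hc e (hmem e he h)) (by omega)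
      · intro h3
        first
          | exact hca e (hmem e he h) e' (hmem e' he' h') hee h3
          | exact hcb e (hmem e he h) e' (hmem e' he' h') hee h3

/-- König's edge colouring theorem for `d`-regular bipartite multigraphs. -/
theorem exists_properColoring {E A B : Type*} [Fintype E] [Fintype A] [Fintype B]
    (a : E → A) (b : E → B) (d : ℕ) (ha : ∀ x, Nat.card {e // a e = x} = d)
    (hb : ∀ y, Nat.card {e // b e = y} = d) :
    ∃ c : E → Fin d, Function.Bijective (fun e => (a e, c e)) ∧
      Function.Bijective (fun e => (b e, c e)) := by
  classical
  obtain ⟨c, hc, hca, hcb⟩ := exists_properColoring_finset a b d Finset.univ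
    (fun x => by rw [← ha x, Nat.card_eq_fintype_card, Fintype.card_subtype])
    (fun x => by rw [← hb x, Nat.card_eq_fintype_card, Fintype.card_subtype])
  have hA : Fintype.card E = Fintype.card (A × Fin d) := by
    rw [← Nat.card_eq_fintype_card, Nat.card_congr (Equiv.sigmaFiberEquiv a).symm,
      Nat.card_sigma]
    simp only [ha]
    simp
  have hB : Fintype.card E = Fintype.card (B × Fin d) := by
    rw [← Nat.card_eq_fintype_card, Nat.card_congr (Equiv.sigmaFiberEquiv b).symm,
      Nat.card_sigma]
    simp only [hb]
    simp
  refine ⟨fun e => ⟨c e, hc e (Finset.mem_univ e)⟩,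
    (Fintype.bijective_iff_injective_and_card _).2 ⟨fun e e' h => ?_, hA⟩,
    (Fintype.bijective_iff_injective_and_card _).2 ⟨fun e e' h => ?_, hB⟩⟩
  · simp only [Prod.mk.injEq, Fin.mk.injEq] at h
    exact hca e (Finset.mem_univ _) e' (Finset.mem_univ _) h.1 h.2
  · simp only [Prod.mk.injEq, Fin.mk.injEq] at h
    exact hcb e (Finset.mem_univ _) e' (Finset.mem_univ _) h.1 h.2

/-- Every permutation is inverted by an involution. -/
theorem Equiv.Perm.exists_involution_conj_eq_inv {α : Type*} (R : Equiv.Perm α) :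
    ∃ τ : Equiv.Perm α, τ * τ = 1 ∧ τ * R * (τ * R) = 1 := by
  let s := Equiv.Perm.SameCycle.setoid R
  let r : α → α := fun x => (Quotient.mk s x).out
  have hr : ∀ x, ∃ i : ℤ, (R ^ i) (r x) = x := fun x => Quotient.mk_out (s := s) x
  choose i hi using hr
  have hrz : ∀ x (j : ℤ), r ((R ^ j) x) = r x := fun x j =>
    congrArg Quotient.out (Quotient.sound (s := s)
      (Equiv.Perm.SameCycle.symm ⟨j, rfl⟩ : R.SameCycle ((R ^ j) x) x))
  let f : α → α := fun x => (R ^ (-i x)) (r x)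
  have hneg : ∀ x (j l : ℤ), (R ^ j) x = (R ^ l) x → (R ^ (-j)) x = (R ^ (-l)) x := by
    intro x j l h
    have h' := congrArg (R ^ (-j - l)) h
    rw [← Equiv.Perm.mul_apply, ← Equiv.Perm.mul_apply, ← zpow_add, ← zpow_add] at h'
    rw [show -j - l + j = -l by ring, show -j - l + l = -j by ring] at h'
    exact h'.symm
  have hf : ∀ x (j : ℤ), f ((R ^ j) (r x)) = (R ^ (-j)) (r x) := by
    intro x j
    have hrr : r (r x) = r x := by
      conv_rhs => rw [← hi x, hrz]
    have h := hi ((R ^ j) (r x))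
    simp only [f]
    rw [hrz, hrr] at h ⊢
    exact hneg _ _ _ h
  have hff : Function.Involutive f := fun x => by
    have h := hf x (i x)
    rw [hi] at h
    rw [h, hf, neg_neg, hi]
  refine ⟨hff.toPerm, Equiv.ext hff, Equiv.ext fun x => ?_⟩
  change f (R (f (R x))) = x
  have h1 : R x = (R ^ (1 + i x)) (r x) := by
    rw [zpow_one_add, Equiv.Perm.mul_apply, hi]
  have h2 : R ((R ^ (-(1 + i x))) (r x)) = (R ^ (-i x)) (r x) := by
    rw [← Equiv.Perm.mul_apply, ← zpow_one_add]
    congr 2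
    ring
  rw [h1, hf, h2, hf, neg_neg, hi]

/-- Two permutations can be turned into involutions by one left multiplication. -/
theorem Equiv.Perm.exists_mul_involutive {α : Type*} (P Q : Equiv.Perm α) :
    ∃ C : Equiv.Perm α, Function.Involutive (C * P) ∧ Function.Involutive (C * Q) := by
  obtain ⟨τ, h1, h2⟩ := Equiv.Perm.exists_involution_conj_eq_inv (P⁻¹ * Q)
  refine ⟨τ * P⁻¹, fun x => ?_, fun x => ?_⟩
  · rw [inv_mul_cancel_right, ← Equiv.Perm.mul_apply, h1, Equiv.Perm.one_apply]
  · rw [mul_assoc, ← Equiv.Perm.mul_apply, h2, Equiv.Perm.one_apply]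

/-- At most two permutations can be turned into involutions by one left multiplication. -/
theorem Equiv.Perm.exists_mul_involutive_of_card_le_two {α ι : Type*} [Fintype ι]
    (hι : Fintype.card ι ≤ 2) (r : ι → Equiv.Perm α) :
    ∃ C : Equiv.Perm α, ∀ j, Function.Involutive (C * r j) := by
  have key : ∃ P Q : Equiv.Perm α, ∀ j, r j = P ∨ r j = Q := by
    let φ := Fintype.equivFin ι
    have hlt : ∀ j, (φ j : ℕ) < 2 := fun j => (φ j).2.trans_le hι
    rcases Nat.lt_or_ge 0 (Fintype.card ι) with h0 | h0
    · refine ⟨r (φ.symm ⟨0, h0⟩), r (φ.symm ⟨Fintype.card ι - 1, by omega⟩), fun j => ?_⟩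
      have h1 := hlt j
      have h2 := (φ j).2
      rcases Nat.eq_zero_or_pos (φ j : ℕ) with h | h
      · left
        congr 1
        rw [Equiv.eq_symm_apply]
        exact Fin.ext h
      · right
        congr 1
        rw [Equiv.eq_symm_apply]
        exact Fin.ext (by dsimp only; omega)
    · exact ⟨1, 1, fun j => absurd (φ j).2 (by omega)⟩
  obtain ⟨P, Q, h⟩ := key
  obtain ⟨C, hP, hQ⟩ := Equiv.Perm.exists_mul_involutive P Q
  exact ⟨C, fun j => (h j).elim (fun e => e ▸ hP) (fun e => e ▸ hQ)⟩

/-- If the fibres of `w` over `p` and `p.swap` have the same size, then some involution of the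
domain induces the swap. -/
theorem exists_involution_swap {E α : Type*} [Finite E] (w : E → α × α)
    (h : ∀ x y, Nat.card {e // w e = (x, y)} = Nat.card {e // w e = (y, x)}) :
    ∃ ι : E → E, ι ∘ ι = id ∧ ∀ e, w (ι e) = (w e).swap := by
  have h' : ∀ p : α × α, Nat.card {e // w e = p} = Nat.card {e // w e = p.swap} :=
    fun p => h p.1 p.2
  let Φ : E ≃ Σ p, Fin (Nat.card {e // w e = p}) :=
    (Equiv.sigmaFiberEquiv w).symm.trans (Equiv.sigmaCongrRight fun _ => Finite.equivFin _)
  have hΦ : ∀ e, (Φ e).1 = w e := fun e => rfl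
  let σ : (Σ p, Fin (Nat.card {e // w e = p})) → Σ p, Fin (Nat.card {e // w e = p}) :=
    fun s => ⟨s.1.swap, Fin.cast (h' s.1) s.2⟩
  have hσ : ∀ s, σ (σ s) = s := fun s => rfl
  refine ⟨fun e => Φ.symm (σ (Φ e)), funext fun e => ?_, fun e => ?_⟩
  · simp [hσ]
  · rw [← hΦ, Equiv.apply_symm_apply, ← hΦ]

/-- A bipartite multigraph with all left degrees `k`, all right degrees `n` and `n` left vertices,
where `k + s = m * n + t`, has an edge colouring proper at the right vertices in which
the numbers of edges of each colour at each left vertex are `m` up to `s + t` permutations. -/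
theorem exists_coloring_count {E B : Type*} [Fintype E] [Fintype B] (n k m s t : ℕ)
    (hk : k + s = m * n + t) (u : E → Fin n) (v : E → B)
    (hu : ∀ x, Nat.card {e // u e = x} = k) (hv : ∀ y, Nat.card {e // v e = y} = n) :
    ∃ (c : E → Fin n) (p : Fin s → Equiv.Perm (Fin n)) (q : Fin t → Equiv.Perm (Fin n)),
      Function.Bijective (fun e => (v e, c e)) ∧
      ∀ x z, (∑ e, if u e = x ∧ c e = z then 1 else 0) + (∑ j, if p j x = z then 1 else 0) =
        m + ∑ j, if q j x = z then 1 else 0 := by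
  let u' : E ⊕ Fin n × Fin s → Fin n := Sum.elim u Prod.fst
  let v' : E ⊕ Fin n × Fin s → B ⊕ Fin s := Sum.map v Prod.snd
  have hu' : ∀ x, Nat.card {e // u' e = x} = Nat.card (Fin m × Fin n ⊕ Fin t) := fun x => by
    rw [Nat.card_congr (Equiv.subtypeSum), Nat.card_sum]
    have h1 : Nat.card {e : Fin n × Fin s // u' (Sum.inr e) = x} = s := by
      rw [Nat.card_congr (β := Fin s) ⟨fun e => e.1.2, fun j => ⟨(x, j), rfl⟩, ?_, fun j => rfl⟩]
      · simp
      · rintro ⟨⟨y, j⟩, rfl⟩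
        rfl
    rw [h1]
    simp only [u', Sum.elim_inl, hu]
    simp [hk]
  let φ : E ⊕ Fin n × Fin s ≃ Fin n × (Fin m × Fin n ⊕ Fin t) :=
    (Equiv.sigmaFiberEquiv u').symm.trans ((Equiv.sigmaCongrRight fun x =>
      (Finite.equivFin _).trans ((finCongr (hu' x)).trans (Finite.equivFin _).symm)).trans
      (Equiv.sigmaEquivProd _ _))
  have hφ : ∀ e, (φ e).1 = u' e := fun e => rfl
  let a₀ : Fin n × (Fin m × Fin n ⊕ Fin t) → Fin n × Fin m ⊕ Fin t := fun z =>
    Sum.elim (fun w => Sum.inl (z.1, w.1)) Sum.inr z.2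
  have ha₀ : ∀ w, Nat.card {e // a₀ (φ e) = w} = n := fun w => by
    rw [Nat.card_congr (φ.subtypeEquiv (q := fun z => a₀ z = w) fun _ => Iff.rfl)]
    rcases w with ⟨x, i⟩ | j
    · rw [Nat.card_congr (β := Fin n) (Equiv.ofBijective
        (fun l => (⟨(x, Sum.inl (i, l)), rfl⟩ :
          {z // a₀ z = Sum.inl (x, i)})) ⟨?_, ?_⟩).symm]
      · simp
      · intro l l' h
        simpa using congrArg Subtype.val h
      · rintro ⟨⟨y, ⟨i', l⟩ | j⟩, h⟩
        · obtain ⟨rfl, rfl⟩ : y = x ∧ i' = i := by simpa [a₀] using h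
          exact ⟨l, rfl⟩
        · simp [a₀] at h
    · rw [Nat.card_congr (β := Fin n) (Equiv.ofBijective
        (fun x => (⟨(x, Sum.inr j), rfl⟩ : {z // a₀ z = Sum.inr j})) ⟨?_, ?_⟩).symm]
      · simp
      · intro l l' h
        simpa using congrArg Subtype.val h
      · rintro ⟨⟨y, ⟨i', l⟩ | j'⟩, h⟩
        · simp [a₀] at h
        · obtain rfl : j' = j := by simpa [a₀] using h
          exact ⟨y, rfl⟩
  have hv' : ∀ y, Nat.card {e // v' e = y} = n := fun y => by
    rw [Nat.card_congr (Equiv.subtypeSum), Nat.card_sum]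
    rcases y with y | j
    · simp [v', hv]
    · have : Nat.card {e : Fin n × Fin s // e.2 = j} = n := by
        rw [Nat.card_congr (β := Fin n) ⟨fun e => e.1.1, fun x => ⟨(x, j), rfl⟩, ?_, fun j => rfl⟩]
        · simp
        · rintro ⟨⟨y, j⟩, rfl⟩
          rfl
      simpa [v'] using this
  obtain ⟨c, hca, hcb⟩ := exists_properColoring (fun e => a₀ (φ e)) v' n ha₀ hv'
  have hp : ∀ j, Function.Bijective fun x => c (Sum.inr (x, j)) := fun j =>
    Finite.injective_iff_bijective.1 fun x x' h => by
      have := @hcb.1 (Sum.inr (x, j)) (Sum.inr (x', j)) (Prod.ext rfl h)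
      simpa using this
  have hq : ∀ j, Function.Bijective fun x => c (φ.symm (x, Sum.inr j)) := fun j =>
    Finite.injective_iff_bijective.1 fun x x' h => by
      have := @hca.1 (φ.symm (x, Sum.inr j)) (φ.symm (x', Sum.inr j))
        (Prod.ext (by simp [a₀]) h)
      simpa using this
  have hr : ∀ x i, Function.Bijective fun l => c (φ.symm (x, Sum.inl (i, l))) := fun x i =>
    Finite.injective_iff_bijective.1 fun l l' h => by
      have := @hca.1 (φ.symm (x, Sum.inl (i, l))) (φ.symm (x, Sum.inl (i, l')))
        (Prod.ext (by simp [a₀]) h)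
      simpa using this
  refine ⟨fun e => c (Sum.inl e), fun j => Equiv.ofBijective _ (hp j),
    fun j => Equiv.ofBijective _ (hq j), ⟨fun e e' h => ?_, fun ⟨y, z⟩ => ?_⟩, fun x z => ?_⟩
  · simp only [Prod.mk.injEq] at h
    have := @hcb.1 (Sum.inl e) (Sum.inl e') (Prod.ext (congrArg Sum.inl h.1) h.2)
    simpa using this
  · obtain ⟨e | ⟨x, j⟩, h⟩ := hcb.2 (Sum.inl y, z)
    · refine ⟨e, ?_⟩
      simpa [v'] using h
    · simp [v'] at h
  · have h1 : (∑ e, if u' e = x ∧ c e = z then 1 else 0) =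
        (∑ e, if u e = x ∧ c (Sum.inl e) = z then 1 else 0) +
          ∑ j, if c (Sum.inr (x, j)) = z then 1 else 0 := by
      rw [Fintype.sum_sum_type, Fintype.sum_prod_type]
      congr 1
      rw [Finset.sum_eq_single x (by intro y _ hy; simp [u', hy]) (by simp)]
      simp [u']
    have h2 : (∑ e, if u' e = x ∧ c e = z then 1 else 0) =
        m + ∑ j, if c (φ.symm (x, Sum.inr j)) = z then 1 else 0 := by
      have h3 : ∀ i, (∑ l, if c (φ.symm (x, Sum.inl (i, l))) = z then 1 else 0) = 1 := fun i => by
        rw [(hr x i).sum_comp (fun l => if l = z then 1 else 0)]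
        simp
      rw [← φ.symm.sum_comp]
      simp only [← hφ, Equiv.apply_symm_apply, Fintype.sum_prod_type, ite_and]
      rw [Finset.sum_eq_single x (by intro y _ hy; simp [hy]) (by simp)]
      simp only [if_true, Fintype.sum_sum_type, Fintype.sum_prod_type, h3]
      simp
    exact h1.symm.trans h2

/-- The balls conjecture when `k + s = m * n + t` with `s + t ≤ 2`. -/
theorem exists_involution_of_add_le_two {E B : Type*} [Fintype E] [Fintype B] (n k m s t : ℕ)
    (hk : k + s = m * n + t) (hst : s + t ≤ 2) (u : E → Fin n) (v : E → B)
    (hu : ∀ x, Nat.card {e // u e = x} = k) (hv : ∀ y, Nat.card {e // v e = y} = n) :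
    ∃ ι : E → E, ι ∘ ι = id ∧ ∀ x y, ∃! e, u (ι e) = x ∧ v e = y := by
  obtain ⟨c, p, q, hvc, hcount⟩ := exists_coloring_count n k m s t hk u v hu hv
  obtain ⟨C, hC⟩ := Equiv.Perm.exists_mul_involutive_of_card_le_two (by simpa using hst)
    (Sum.elim p q)
  have hcard : ∀ x z, Nat.card {e // (u e, C (c e)) = (x, z)} =
      ∑ e, if u e = x ∧ c e = C.symm z then 1 else 0 := fun x z => by
    rw [Nat.card_eq_fintype_card, Fintype.card_subtype, Finset.card_filter]
    simp [Equiv.eq_symm_apply]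
  have hsymm : ∀ r : Equiv.Perm (Fin n), Function.Involutive (C * r) →
      ∀ x z, r x = C.symm z ↔ r z = C.symm x := fun r hr x z => by
    rw [Equiv.eq_symm_apply, Equiv.eq_symm_apply]
    exact hr.eq_iff.trans eq_comm
  obtain ⟨ι, hι, hw⟩ := exists_involution_swap (fun e => (u e, C (c e))) (fun x z => by
    rw [hcard, hcard]
    have h1 := hcount x (C.symm z)
    have h2 := hcount z (C.symm x)
    simp only [hsymm (p _) (hC (Sum.inl _)) x z] at h1
    simp only [hsymm (q _) (hC (Sum.inr _)) x z] at h1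
    omega)
  refine ⟨ι, hι, fun x y => ?_⟩
  have huι : ∀ e, u (ι e) = C (c e) := fun e => congrArg Prod.fst (hw e)
  obtain ⟨e, he, huniq⟩ := hvc.existsUnique (y, C.symm x)
  simp only [Prod.mk.injEq, Equiv.eq_symm_apply] at he huniq
  simp only [huι]
  exact ⟨e, he.symm, fun e' he' => huniq e' he'.symm⟩

/-- Conjecture 3 (the balls conjecture) holds when `k = m*n + ε` with
`ε ∈ {-2,-1,0,1,2}`. -/
theorem stmt1 (n m : ℕ) (hn : 1 ≤ n) (hm : 1 ≤ m) (ε : ℤ)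
    (hε : ε ∈ ({-2, -1, 0, 1, 2} : Set ℤ)) (k : ℕ) (hk : 0 < k)
    (hkval : (k : ℤ) = m * n + ε)
    (u : Fin n × Fin k → Fin n) (v : Fin n × Fin k → Fin k)
    (hu : ∀ x : Fin n, Nat.card {e : Fin n × Fin k | u e = x} = k)
    (hv : ∀ y : Fin k, Nat.card {e : Fin n × Fin k | v e = y} = n) :
    ∃ ι : Fin n × Fin k → Fin n × Fin k, ι ∘ ι = id ∧
      ∀ x : Fin n, ∀ y : Fin k, ∃! e : Fin n × Fin k, u (ι e) = x ∧ v e = y := by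
  have key : ∃ s t : ℕ, k + s = m * n + t ∧ s + t ≤ 2 := by
    refine ⟨(-ε).toNat, ε.toNat, ?_, ?_⟩
    · zify
      rw [hkval]
      omega
    · simp only [Set.mem_insert_iff, Set.mem_singleton_iff] at hε
      omega
  obtain ⟨s, t, hst, hle⟩ := key
  exact exists_involution_of_add_le_two n k m s t hst hle u v hu hv
end

section
/- Let n ≥ 1 and m ≥ 1 be integers, let ε ∈ {-2, -1, 0, 1, 2}, and let k be a positive integer with (k : ℤ) = m·n + ε. Let E1 and E2 be finite types, each of cardinality n·k, and let u1 : E1 → Fin n, v1 : E1 → Fin k, u2 : E2 → Fin n, v2 : E2 → Fin k be functions such that every fiber of u1 and of u2 has exactly k elements and every fiber of v1 and of v2 has exactly n elements. Then there exists a bijection ψ : E1 ≃ E2 such that: (a) for every (x, y) : Fin n × Fin k there is exactly one e : E1 with u2 (ψ e) = x and v1 e = y; and (b) for every (x, y) : Fin n × Fin k there is exactly one e : E2 with u1 (ψ⁻¹ e) = x and v2 e = y. -/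
open Finset in
/-- A directed multigraph with arcs `p y → q y` contains, from every vertex of positive excess, a
trail to a vertex of negative excess. -/
theorem exists_trail {K V : Type*} [Fintype K] [DecidableEq K] [DecidableEq V] (p q : K → V) (r : V)
    (h : #{y | q y = r} < #{y | p y = r}) :
    ∃ (Y : Finset K) (t : V), #{y | p y = t} < #{y | q y = t} ∧
      ∀ x, (#{y ∈ Y | p y = x} : ℤ) - #{y ∈ Y | q y = x} =
        (if x = r then 1 else 0) - (if x = t then 1 else 0) := by
  obtain ⟨Y, ⟨t, ht⟩, hmax⟩ := Set.Finite.exists_maximal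
    (s := {Y : Finset K | ∃ t : V, ∀ x, (#{y ∈ Y | p y = x} : ℤ) - #{y ∈ Y | q y = x} =
        (if x = r then 1 else 0) - (if x = t then 1 else 0)}) (Set.toFinite _)
    ⟨∅, r, by simp⟩
  refine ⟨Y, t, ?_, ht⟩
  by_contra! hle
  have hlt : #{y ∈ Y | p y = t} < #{y | p y = t} := by
    have hq : #{y ∈ Y | q y = t} ≤ #{y | q y = t} := by gcongr; exact Y.subset_univ
    have h1 := ht t
    by_cases htr : t = r
    · subst htr; simp at h1; omega
    · simp [htr] at h1; omega
  obtain ⟨y, hy, hyY⟩ : ∃ y, p y = t ∧ y ∉ Y := by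
    by_contra! hc
    refine hlt.ne (congrArg card ?_)
    ext y
    simpa using hc y
  have hmem := hmax (y := insert y Y) ⟨q y, fun x => by
    rw [filter_insert, filter_insert]
    have h1 := ht x
    have hp : #(if p y = x then insert y {y ∈ Y | p y = x} else {y ∈ Y | p y = x}) =
        #{y ∈ Y | p y = x} + if x = t then 1 else 0 := by
      by_cases hx : x = t
      · rw [if_pos (hy.trans hx.symm), card_insert_of_notMem (by simp [hyY]), if_pos hx]
      · rw [if_neg (by rw [hy]; exact fun h => hx h.symm), if_neg hx, add_zero]
    have hq : #(if q y = x then insert y {y ∈ Y | q y = x} else {y ∈ Y | q y = x}) =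
        #{y ∈ Y | q y = x} + if x = q y then 1 else 0 := by
      by_cases hx : x = q y
      · rw [if_pos hx.symm, card_insert_of_notMem (by simp [hyY]), if_pos hx]
      · rw [if_neg (fun h => hx h.symm), if_neg hx, add_zero]
    rw [hp, hq]
    push_cast
    linarith⟩ (subset_insert y Y)
  exact hyY (hmem (mem_insert_self y Y))

/-- The indicator, with integer values, of equality. -/
def kdelta {α : Type*} [DecidableEq α] (x y : α) : ℤ := if x = y then 1 else 0

@[simp]
theorem kdelta_self {α : Type*} [DecidableEq α] (x : α) : kdelta x x = 1 := if_pos rfl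

theorem kdelta_of_ne {α : Type*} [DecidableEq α] {x y : α} (h : x ≠ y) : kdelta x y = 0 := if_neg h

theorem kdelta_nonneg {α : Type*} [DecidableEq α] (x y : α) : 0 ≤ kdelta x y := by
  unfold kdelta; split_ifs <;> simp

@[simp]
theorem sum_kdelta_left {α : Type*} [Fintype α] [DecidableEq α] (y : α) :
    ∑ x, kdelta x y = 1 := by
  simp [kdelta]

theorem kdelta_sub_sq {α : Type*} [DecidableEq α] (x : α) {a b : α} (hab : a ≠ b) :
    (kdelta x a - kdelta x b) ^ 2 = kdelta x a + kdelta x b := by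
  unfold kdelta
  split_ifs with h1 h2
  · exact absurd (h1.symm.trans h2) hab
  all_goals simp

/-- The result of moving a unit from `(r, i)` to `(t, i)` and one from `(t, j)` to `(r, j)`. -/
def switch {V C : Type*} [DecidableEq V] [DecidableEq C] (M : V → C → ℤ) (i j : C) (r t : V) :
    V → C → ℤ :=
  fun x b => M x b + (kdelta x t - kdelta x r) * (kdelta b i - kdelta b j)

/-- A set of integer matrices is switchable if every excess of an entry over another one in the
same row can be reduced by a switch with a row where the excess is reversed. -/
def Switchable {V C : Type*} [DecidableEq V] [DecidableEq C] (S : Set (V → C → ℤ)) : Prop :=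
  ∀ M ∈ S, ∀ i j r, M r j < M r i → ∃ t, M t i < M t j ∧ switch M i j r t ∈ S

theorem sum_switch_sq {V C : Type*} [Fintype V] [Fintype C] [DecidableEq V] [DecidableEq C]
    (M : V → C → ℤ) {i j : C} {r t : V} (hij : i ≠ j) (hrt : t ≠ r) :
    ∑ x, ∑ b, switch M i j r t x b ^ 2 =
      ∑ x, ∑ b, M x b ^ 2 + 2 * (M t i - M t j - M r i + M r j) + 4 := by
  have hexp (x : V) (b : C) : switch M i j r t x b ^ 2 = M x b ^ 2 +
      2 * ((kdelta x t - kdelta x r) * (kdelta b i * M x b - kdelta b j * M x b)) +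
      (kdelta x t + kdelta x r) * (kdelta b i + kdelta b j) := by
    rw [← kdelta_sub_sq x hrt, ← kdelta_sub_sq b hij, switch]; ring
  simp only [hexp, Finset.sum_add_distrib, ← Finset.mul_sum, Finset.sum_sub_distrib,
    sum_kdelta_left, ← Finset.sum_mul]
  have hC (x : V) (i : C) : ∑ b, kdelta b i * M x b = M x i := by simp [kdelta]
  have hV (r : V) (i : C) : ∑ x, kdelta x r * M x i = M r i := by simp [kdelta]
  simp only [hC, sub_mul, mul_sub, Finset.sum_sub_distrib, hV]
  ring

/-- A nonempty switchable set contains a matrix whose rows are balanced. -/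
theorem Switchable.exists_balanced {V C : Type*} [Fintype V] [Fintype C] [DecidableEq V]
    [DecidableEq C] {S : Set (V → C → ℤ)} (hS : Switchable S) (hne : S.Nonempty) :
    ∃ M ∈ S, ∀ x i j, M x i ≤ M x j + 1 := by
  obtain ⟨M, hM, hmin⟩ := WellFounded.has_min
    (measure fun M : V → C → ℤ => (∑ x, ∑ b, M x b ^ 2).toNat).wf S hne
  refine ⟨M, hM, fun r i j => ?_⟩
  by_contra! hlt
  obtain ⟨t, ht, hmem⟩ := hS M hM i j r (by omega)
  refine hmin _ hmem ?_
  have hij : i ≠ j := by rintro rfl; omega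
  have hrt : t ≠ r := by rintro rfl; omega
  have hsum := sum_switch_sq M hij hrt
  have hnn : 0 ≤ ∑ x, ∑ b, switch M i j r t x b ^ 2 := by positivity
  change (∑ x, ∑ b, switch M i j r t x b ^ 2).toNat < (∑ x, ∑ b, M x b ^ 2).toNat
  omega

open Finset in
/-- The number of occurrences of each symbol in each column of an array. -/
def countMatrix {K V C : Type*} [Fintype K] [DecidableEq V] (w : K → C → V) (x : V) (b : C) : ℤ :=
  #{y | w y b = x}

/-- The count matrices of the arrays obtained by permuting the entries of each row of `w`. -/
def rearrangements {K V C : Type*} [Fintype K] [DecidableEq V] (w : K → C → V) :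
    Set (V → C → ℤ) :=
  {M | ∃ π : K → Equiv.Perm C, M = countMatrix fun y b => w y (π y b)}

open Finset in
theorem switchable_rearrangements {K V C : Type*} [Fintype K] [DecidableEq V] [DecidableEq C]
    (w : K → C → V) : Switchable (rearrangements w) := by
  classical
  rintro _ ⟨π, rfl⟩ i j r h
  have hij : i ≠ j := by rintro rfl; exact lt_irrefl _ h
  obtain ⟨Y, t, ht, hY⟩ := exists_trail (fun y => w y (π y i)) (fun y => w y (π y j)) r
    (by simpa [countMatrix] using h)
  refine ⟨t, by simpa [countMatrix] using ht,
    fun y => if y ∈ Y then (Equiv.swap i j).trans (π y) else π y, ?_⟩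
  have hsplit (f : K → V) (x : V) : (#{y | f y = x} : ℤ) =
      #{y ∈ Y | f y = x} + #{y ∈ Yᶜ | f y = x} := by
    rw [← Nat.cast_add, ← card_union_of_disjoint, ← filter_union, union_compl]
    exact disjoint_filter_filter disjoint_compl_right
  have hin (x : V) (b : C) : #{y ∈ Y | w y ((if y ∈ Y then (Equiv.swap i j).trans (π y) else π y) b)
      = x} = #{y ∈ Y | w y (π y (Equiv.swap i j b)) = x} := by
    congr 1; refine filter_congr fun y hy => ?_; simp [hy]
  have hout (x : V) (b : C) : #{y ∈ Yᶜ | w y ((if y ∈ Y then (Equiv.swap i j).trans (π y) else π y)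
      b) = x} = #{y ∈ Yᶜ | w y (π y b) = x} := by
    congr 1; refine filter_congr fun y hy => ?_; simp [mem_compl.mp hy]
  funext x b
  have hx := hY x
  simp only [switch, countMatrix]
  rw [hsplit, hsplit, hin, hout]
  rcases eq_or_ne b i with rfl | hbi
  · simp only [Equiv.swap_apply_left, kdelta, if_true, if_neg hij]
    linarith
  rcases eq_or_ne b j with rfl | hbj
  · simp only [Equiv.swap_apply_right, kdelta, if_true, if_neg hij.symm]
    linarith
  · simp [Equiv.swap_apply_of_ne_of_ne hbi hbj, kdelta_of_ne hbi, kdelta_of_ne hbj]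

theorem rearrangements_nonempty {K V C : Type*} [Fintype K] [DecidableEq V] (w : K → C → V) :
    (rearrangements w).Nonempty :=
  ⟨_, 1, rfl⟩

theorem rearrangements_permute {K V C : Type*} [Fintype K] [DecidableEq V] {w : K → C → V}
    {M : V → C → ℤ} (hM : M ∈ rearrangements w) (τ : Equiv.Perm C) :
    (fun x b => M x (τ b)) ∈ rearrangements w := by
  obtain ⟨π, rfl⟩ := hM
  exact ⟨fun y => τ.trans (π y), rfl⟩

theorem sum_rearrangement_col {K V C : Type*} [Fintype K] [Fintype V] [DecidableEq V]
    {w : K → C → V} {M : V → C → ℤ} (hM : M ∈ rearrangements w) (b : C) :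
    ∑ x, M x b = Fintype.card K := by
  obtain ⟨π, rfl⟩ := hM
  simp only [countMatrix, ← Nat.cast_sum]
  rw [← Finset.card_eq_sum_card_fiberwise fun _ _ => Finset.mem_coe.mpr (Finset.mem_univ _)]
  simp

theorem sum_rearrangement_row {K V C : Type*} [Fintype K] [Fintype C] [DecidableEq V]
    {w : K → C → V} {M : V → C → ℤ} (hM : M ∈ rearrangements w) (x : V) :
    ∑ b, M x b = ∑ b, countMatrix w x b := by
  obtain ⟨π, rfl⟩ := hM
  simp only [countMatrix, Finset.card_filter, Nat.cast_sum]
  rw [Finset.sum_comm, Finset.sum_comm (s := Finset.univ (α := C))]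
  refine Finset.sum_congr rfl fun y _ => ?_
  exact Equiv.sum_comp (π y) fun b => ((if w y b = x then 1 else 0 : ℕ) : ℤ)

theorem exists_eq_kdelta {V : Type*} [Fintype V] [DecidableEq V] {f : V → ℤ} (hf : ∀ x, 0 ≤ f x)
    (hsum : ∑ x, f x = 1) : ∃ r, ∀ x, f x = kdelta x r := by
  obtain ⟨r, hr⟩ : ∃ r, 1 ≤ f r := by
    by_contra! h
    have := Finset.sum_nonpos fun x (_ : x ∈ Finset.univ) => Int.le_of_lt_add_one (h x)
    omega
  have hnn (x : V) : 0 ≤ f x - kdelta x r := by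
    rcases eq_or_ne x r with rfl | hx
    · simpa using hr
    · simpa [kdelta_of_ne hx] using hf x
  have h0 : ∑ x, (f x - kdelta x r) = 0 := by simp [hsum]
  rw [Finset.sum_eq_zero_iff_of_nonneg fun x _ => hnn x] at h0
  exact ⟨r, fun x => sub_eq_zero.mp (h0 x (Finset.mem_univ x))⟩

theorem exists_eq_kdelta_add_kdelta {V : Type*} [Fintype V] [DecidableEq V] {f : V → ℤ}
    (hf : ∀ x, 0 ≤ f x) (hsum : ∑ x, f x = 2) {p : V} (hp : 1 ≤ f p) :
    ∃ r, ∀ x, f x = kdelta x p + kdelta x r := by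
  obtain ⟨r, hr⟩ := exists_eq_kdelta (f := fun x => f x - kdelta x p) (fun x => by
    rcases eq_or_ne x p with rfl | hx
    · simpa using hp
    · simpa [kdelta_of_ne hx] using hf x) (by simp [hsum])
  exact ⟨r, fun x => by linarith [hr x]⟩

/-- The first `l` columns of `A` are the consecutive edges of a path through the `l + 1` distinct
rows `a 0, …, a l`. -/
structure IsPathPrefix {N : ℕ} (A : Fin (N + 1) → Fin (N + 1) → ℤ) (a : ℕ → Fin (N + 1)) (l : ℕ) :
    Prop where
  inj : Set.InjOn a (Set.Iic l)
  col (c : Fin (N + 1)) (hc : (c : ℕ) < l) (x : Fin (N + 1)) :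
    A x c = kdelta x (a c) + kdelta x (a (c + 1))

/-- The sum of the entries of a row on the path that lie outside the path's columns. -/
theorem IsPathPrefix.sum_rest {N l : ℕ} {A : Fin (N + 1) → Fin (N + 1) → ℤ} {a : ℕ → Fin (N + 1)}
    (h : IsPathPrefix A a l) (hl : l ≤ N) (hrow : ∀ x, ∑ c, A x c = 2) {d : ℕ} (hd : d ≤ l) :
    ∑ c : Fin (N + 1), (if (c : ℕ) < l then 0 else A (a d) c) =
      2 - (if d < l then 1 else 0) - (if 1 ≤ d then 1 else 0) := by
  have hdelta {d e : ℕ} (hd : d ≤ l) (he : e ≤ l) :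
      kdelta (a d) (a e) = if d = e then 1 else 0 := by
    simp [kdelta, h.inj.eq_iff (Set.mem_Iic.mpr hd) (Set.mem_Iic.mpr he)]
  have hsplit (c : Fin (N + 1)) : A (a d) c =
      (if (c : ℕ) < l then 0 else A (a d) c) +
        ((if (c : ℕ) = d then if d < l then 1 else 0 else 0) +
          (if (c : ℕ) + 1 = d then 1 else 0)) := by
    by_cases hc : (c : ℕ) < l
    · rw [h.col c hc, hdelta hd hc.le, hdelta hd hc]
      grind
    · grind
  have hs := hrow (a d)
  rw [Finset.sum_congr rfl fun c _ => hsplit c, Finset.sum_add_distrib, Finset.sum_add_distrib,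
    Fin.sum_univ_eq_sum_range (fun c => if c = d then if d < l then (1 : ℤ) else 0 else 0),
    Fin.sum_univ_eq_sum_range (fun c => if c + 1 = d then (1 : ℤ) else 0)] at hs
  have h1 : ∑ c ∈ Finset.range (N + 1), (if c = d then if d < l then (1 : ℤ) else 0 else 0) =
      if d < l then 1 else 0 := by
    rw [Finset.sum_ite_eq', if_pos (Finset.mem_range.mpr (by omega))]
  have h2 : ∑ c ∈ Finset.range (N + 1), (if c + 1 = d then (1 : ℤ) else 0) =
      if 1 ≤ d then 1 else 0 := by
    cases d with
    | zero => simp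
    | succ d =>
      simp only [Nat.add_right_cancel_iff]
      rw [Finset.sum_ite_eq', if_pos (Finset.mem_range.mpr (by omega))]
      simp
  rw [h1, h2] at hs
  linarith

/-- Appending a fresh row to the path. -/
theorem IsPathPrefix.extend {N l : ℕ} {A : Fin (N + 1) → Fin (N + 1) → ℤ} {a : ℕ → Fin (N + 1)}
    (h : IsPathPrefix A a l) {r : Fin (N + 1)} (hr : ∀ d ≤ l, a d ≠ r)
    (hcol : ∀ c : Fin (N + 1), (c : ℕ) = l → ∀ x, A x c = kdelta x (a l) + kdelta x r) :
    IsPathPrefix A (Function.update a (l + 1) r) (l + 1) where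
  inj d hd e he hde := by
    simp only [Set.mem_Iic] at hd he
    have := @h.inj d
    simp only [Function.update_apply] at hde
    grind [Set.InjOn]
  col c hc x := by
    rcases Nat.lt_succ_iff_lt_or_eq.mp hc with hc | hc
    · rw [h.col c hc, Function.update_of_ne (by omega), Function.update_of_ne (by omega)]
    · rw [hcol c hc, hc, Function.update_of_ne (by omega), Function.update_self]

/-- A switchable family of nonnegative matrices with line sums `2` contains one whose columns,
apart from the last one, form a Hamiltonian path. -/
theorem Switchable.exists_isPathPrefix {N : ℕ} {S : Set (Fin (N + 1) → Fin (N + 1) → ℤ)}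
    (hS : Switchable S) (hne : S.Nonempty) (hnn : ∀ A ∈ S, ∀ x c, 0 ≤ A x c)
    (hrow : ∀ A ∈ S, ∀ x, ∑ c, A x c = 2) (hcol : ∀ A ∈ S, ∀ c, ∑ x, A x c = 2)
    (hperm : ∀ A ∈ S, ∀ τ : Equiv.Perm (Fin (N + 1)), (fun x c => A x (τ c)) ∈ S)
    (l : ℕ) (hl : l ≤ N) : ∃ A ∈ S, ∃ a, IsPathPrefix A a l := by
  induction l with
  | zero =>
    obtain ⟨A, hA⟩ := hne
    exact ⟨A, hA, fun _ => 0, by simp [Set.InjOn], by simp⟩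
  | succ l ih =>
    obtain ⟨A, hA, a, ha⟩ := ih (by omega)
    let L : Fin (N + 1) := ⟨l, by omega⟩
    wlog hAL : 1 ≤ A (a l) L generalizing A
    · obtain ⟨j, hj, hAj⟩ : ∃ j : Fin (N + 1), l ≤ j ∧ 1 ≤ A (a l) j := by
        by_contra! hlt
        have hsum := ha.sum_rest (by omega) (hrow A hA) le_rfl
        have hle : ∑ c : Fin (N + 1), (if (c : ℕ) < l then 0 else A (a l) c) ≤ 0 :=
          Finset.sum_nonpos fun c _ => by
            split_ifs with hc
            · exact le_rfl
            · have := hlt c (by omega); omega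
        rw [hsum] at hle
        split_ifs at hle <;> omega
      refine this _ (hperm A hA (Equiv.swap L j)) ⟨ha.inj, fun c hc x => ?_⟩ (by simpa using hAj)
      rw [← ha.col c hc, Equiv.swap_apply_of_ne_of_ne] <;>
      · rintro rfl
        have hLl : (L : ℕ) = l := rfl
        omega
    have hrest {d : ℕ} (hd : d ≤ l) := ha.sum_rest (by omega) (hrow A hA) hd
    have hrest_nn (d : ℕ) (c : Fin (N + 1)) : 0 ≤ if (c : ℕ) < l then 0 else A (a d) c := by
      split_ifs
      exacts [le_rfl, hnn A hA _ _]
    have hL_le {d : ℕ} (hd : d ≤ l) :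
        A (a d) L ≤ 2 - (if d < l then 1 else 0) - (if 1 ≤ d then 1 else 0) := by
      rw [← hrest hd]
      refine le_trans ?_ (Finset.single_le_sum (fun c _ => hrest_nn d c) (Finset.mem_univ L))
      simp [L]
    obtain ⟨r, hr⟩ := exists_eq_kdelta_add_kdelta (hnn A hA · L) (hcol A hA L) hAL
    have hLc {c : Fin (N + 1)} (hc : (c : ℕ) = l) : c = L := Fin.ext hc
    by_cases hfresh : ∀ d ≤ l, a d ≠ r
    · exact ⟨A, hA, _, ha.extend hfresh fun c hc x => hLc hc ▸ hr x⟩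
    push Not at hfresh
    obtain ⟨d, hd, rfl⟩ := hfresh
    obtain rfl : d = 0 := by
      by_contra hd0
      have h1 := hL_le hd
      rw [hr] at h1
      rcases hd.lt_or_eq with hdl | rfl
      · have := kdelta_nonneg (a d) (a l)
        simp only [kdelta_self] at h1
        split_ifs at h1 <;> omega
      · simp only [kdelta_self] at h1
        split_ifs at h1 <;> omega
    let L' : Fin (N + 1) := ⟨l + 1, by omega⟩
    have hLL' : L ≠ L' := by simp [L, L']
    have hL' {d : ℕ} (hd : d ≤ l) : A (a d) L' ≤ 0 := by
      have hpair := Finset.sum_le_univ_sum_of_nonneg (s := {L, L'}) (hrest_nn d)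
      rw [hrest hd, Finset.sum_pair hLL', hr] at hpair
      simp only [L, L', lt_irrefl, if_false, if_neg (show ¬ l + 1 < l by omega)] at hpair
      have h1 := kdelta_nonneg (a d) (a l)
      have h2 := kdelta_nonneg (a d) (a 0)
      change A (a d) ⟨l + 1, _⟩ ≤ 0
      rcases Nat.eq_zero_or_pos d with rfl | hd0
      · rcases Nat.eq_zero_or_pos l with rfl | hl0
        · simp at hpair ⊢; omega
        · simp [hl0] at hpair; omega
      · rcases hd.lt_or_eq with hdl | rfl
        · simp [hdl, Nat.one_le_iff_ne_zero, hd0.ne'] at hpair; omega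
        · simp [Nat.one_le_iff_ne_zero, hd0.ne'] at hpair; omega
    have h0 : 1 ≤ A (a 0) L := by
      rw [hr, kdelta_self]; have := kdelta_nonneg (a 0) (a l); omega
    obtain ⟨t, ht, hmem⟩ := hS A hA L L' (a 0) (by have := hL' (Nat.zero_le l); omega)
    have htL := hnn A hA t L
    have htfresh : ∀ d ≤ l, a d ≠ t := by
      rintro d hd rfl
      have := hL' hd
      omega
    refine ⟨_, hmem, _, IsPathPrefix.extend ⟨ha.inj, fun c hc x => ?_⟩ htfresh fun c hc x => ?_⟩
    · have hcL : c ≠ L := by rintro rfl; simp [L] at hc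
      have hcL' : c ≠ L' := by rintro rfl; simp only [L'] at hc; omega
      simp [switch, kdelta_of_ne hcL, kdelta_of_ne hcL', ha.col c hc]
    · rw [hLc hc]
      simp only [switch, kdelta_self, kdelta_of_ne hLL', hr]
      ring

/-- A switchable family of nonnegative matrices with line sums `2` that is closed under column
permutations contains, up to a permutation of the rows, a symmetric Hamiltonian cycle. -/
theorem Switchable.exists_hamiltonian {N : ℕ} {S : Set (Fin (N + 1) → Fin (N + 1) → ℤ)}
    (hS : Switchable S) (hne : S.Nonempty) (hnn : ∀ A ∈ S, ∀ x c, 0 ≤ A x c)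
    (hrow : ∀ A ∈ S, ∀ x, ∑ c, A x c = 2) (hcol : ∀ A ∈ S, ∀ c, ∑ x, A x c = 2)
    (hperm : ∀ A ∈ S, ∀ τ : Equiv.Perm (Fin (N + 1)), (fun x c => A x (τ c)) ∈ S) :
    ∃ A ∈ S, ∃ σ : Equiv.Perm (Fin (N + 1)),
      ∀ d c, A (σ d) c = kdelta (d + c) 0 + kdelta (d + c) 1 := by
  obtain ⟨A, hA, a, ha⟩ := hS.exists_isPathPrefix hne hnn hrow hcol hperm N le_rfl
  have hinj : Function.Injective fun d : Fin (N + 1) => a d := fun d e hde =>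
    Fin.ext (ha.inj (Set.mem_Iic.mpr d.is_le) (Set.mem_Iic.mpr e.is_le) hde)
  let σ : Equiv.Perm (Fin (N + 1)) := Equiv.ofBijective _ (Finite.injective_iff_bijective.mp hinj)
  have hσ (d : Fin (N + 1)) : σ d = a d := rfl
  have key (d c : Fin (N + 1)) : A (σ d) c = kdelta d c + kdelta d (c + 1) := by
    by_cases hc : (c : ℕ) < N
    · have hc1 : ((c + 1 : Fin (N + 1)) : ℕ) = c + 1 := Fin.val_add_one_of_lt (by simpa [Fin.lt_def])
      rw [ha.col c hc, ← hσ, ← hc1, ← hσ]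
      simp [kdelta]
    · obtain rfl : c = Fin.last N := Fin.ext (by have := c.is_le; simp; omega)
      have hs := ha.sum_rest le_rfl (hrow A hA) d.is_le
      rw [Finset.sum_eq_single (Fin.last N) (fun c _ hc => if_pos (Fin.val_lt_last hc))
        (by simp)] at hs
      simp only [Fin.val_last, lt_irrefl, if_false] at hs
      rw [hσ, hs, Fin.last_add_one]
      simp only [kdelta, Fin.ext_iff, Fin.val_last, Fin.val_zero]
      have := d.is_le
      split_ifs <;> omega
  refine ⟨_, hperm A hA (Equiv.neg _), σ, fun d c => ?_⟩
  simp only [key, Equiv.neg_apply, kdelta]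
  congr 2
  · rw [eq_neg_iff_add_eq_zero]
  · rw [← sub_eq_iff_eq_add', sub_neg_eq_add]

/-- A permutation matrix can be made equal to a symmetric one. -/
theorem exists_permutation {N : ℕ} {A : Fin (N + 1) → Fin (N + 1) → ℤ}
    (hnn : ∀ x c, 0 ≤ A x c) (hrow : ∀ x, ∑ c, A x c = 1) (hcol : ∀ c, ∑ x, A x c = 1) :
    ∃ σ : Equiv.Perm (Fin (N + 1)), ∀ d c, A (σ d) c = kdelta d c := by
  choose a ha using fun c => exists_eq_kdelta (hnn · c) (hcol c)
  have hinj : Function.Injective a := fun c c' hcc => by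
    by_contra hne
    have hle := Finset.sum_le_univ_sum_of_nonneg (s := {c, c'}) (hnn (a c))
    rw [hrow, Finset.sum_pair hne, ha, ha, ← hcc, kdelta_self] at hle
    omega
  refine ⟨Equiv.ofBijective _ (Finite.injective_iff_bijective.mp hinj), fun d c => ?_⟩
  simp [ha, kdelta, hinj.eq_iff]

/-- The nonnegative matrices `A` such that `m + s * A` counts the symbols of some rearrangement. -/
def deviations {K V C : Type*} [Fintype K] [DecidableEq V] (w : K → C → V) (m s : ℤ) :
    Set (V → C → ℤ) :=
  {A | (∀ x c, 0 ≤ A x c) ∧ (fun x c => m + s * A x c) ∈ rearrangements w}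

theorem switchable_deviations {K V C : Type*} [Fintype K] [DecidableEq V] [DecidableEq C]
    (w : K → C → V) (m : ℤ) {s : ℤ} (hs : s = 1 ∨ s = -1) : Switchable (deviations w m s) := by
  rintro A ⟨hnn, hA⟩ i j r hlt
  obtain ⟨t, ht, hmem⟩ : ∃ t, A t i < A t j ∧
      (fun x c => m + s * switch A i j r t x c) ∈ rearrangements w := by
    rcases hs with rfl | rfl
    · obtain ⟨t, ht, hmem⟩ := switchable_rearrangements w _ hA i j r (by simpa using hlt)
      refine ⟨t, by simpa using ht, ?_⟩
      convert hmem using 3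
      simp only [switch]; ring
    · obtain ⟨t, ht, hmem⟩ := switchable_rearrangements w _ hA j i r
        (by simpa only [neg_one_mul, add_lt_add_iff_left, neg_lt_neg_iff] using hlt)
      refine ⟨t, by simpa only [neg_one_mul, add_lt_add_iff_left, neg_lt_neg_iff] using ht, ?_⟩
      convert hmem using 3
      simp only [switch]; ring
  refine ⟨t, ht, fun x c => ?_, hmem⟩
  have hr := hnn r j
  have ht' := hnn t i
  have hxc := hnn x c
  simp only [switch, kdelta]
  split_ifs <;> subst_vars <;> simp <;> omega

theorem sum_deviation_col {K V C : Type*} [Fintype K] [Fintype V] [DecidableEq V] {w : K → C → V}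
    {m s r : ℤ} (hs : s = 1 ∨ s = -1) (hK : (Fintype.card K : ℤ) = m * Fintype.card V + s * r)
    {A : V → C → ℤ} (hA : A ∈ deviations w m s) (c : C) : ∑ x, A x c = r := by
  have h := sum_rearrangement_col hA.2 c
  simp only [Finset.sum_add_distrib, ← Finset.mul_sum, Finset.sum_const, Finset.card_univ,
    nsmul_eq_mul] at h
  rcases hs with rfl | rfl <;> linarith

theorem sum_deviation_row {K V C : Type*} [Fintype K] [Fintype C] [DecidableEq V] {w : K → C → V}
    {m s r k : ℤ} (hs : s = 1 ∨ s = -1) (hk : k = m * Fintype.card C + s * r)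
    (hw : ∀ x, ∑ c, countMatrix w x c = k)
    {A : V → C → ℤ} (hA : A ∈ deviations w m s) (x : V) : ∑ c, A x c = r := by
  have h := sum_rearrangement_row hA.2 x
  simp only [Finset.sum_add_distrib, ← Finset.mul_sum, Finset.sum_const, Finset.card_univ,
    nsmul_eq_mul] at h
  rw [hw] at h
  rcases hs with rfl | rfl <;> linarith

theorem deviations_nonempty {K V C : Type*} [Fintype K] [Fintype V] [Fintype C] [DecidableEq V]
    [DecidableEq C] {w : K → C → V} {m s r k : ℤ} (hs : s = 1 ∨ s = -1) (hr : 0 ≤ r)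
    (hk : k = m * Fintype.card C + s * r) (hw : ∀ x, ∑ c, countMatrix w x c = k) :
    (deviations w m s).Nonempty := by
  obtain ⟨M, hM, hbal⟩ := (switchable_rearrangements w).exists_balanced (rearrangements_nonempty w)
  refine ⟨fun x c => s * (M x c - m), fun x c => ?_, ?_⟩
  · have hsum : ∑ i, s * (M x i - m) = r := by
      rw [← Finset.mul_sum, Finset.sum_sub_distrib, sum_rearrangement_row hM, hw, hk]
      simp only [Finset.sum_const, Finset.card_univ, nsmul_eq_mul]
      rcases hs with rfl | rfl <;> ring
    by_contra! hlt
    have hle (i : C) : s * (M x i - m) ≤ 0 := by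
      have h1 := hbal x i c
      have h2 := hbal x c i
      rcases hs with rfl | rfl <;> omega
    have : ∑ i, s * (M x i - m) < ∑ _i : C, 0 :=
      Finset.sum_lt_sum (fun i _ => hle i) ⟨c, Finset.mem_univ c, hlt⟩
    simp only [Finset.sum_const_zero] at this
    omega
  · convert hM using 3
    rcases hs with rfl | rfl <;> ring

/-- If `k = m * n + s * r` with `s = ± 1` and `r ≤ 2`, then the rearrangements of all `k × n` arrays
in which each of the `n` symbols occurs `k` times have a common symmetric count matrix, up to
permutations of the rows. -/
theorem exists_common_countMatrix {N k : ℕ} {m s r : ℤ} (hs : s = 1 ∨ s = -1)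
    (hr : r = 0 ∨ r = 1 ∨ r = 2) (hk : (k : ℤ) = m * (N + 1 : ℕ) + s * r) :
    ∃ T : Fin (N + 1) → Fin (N + 1) → ℤ, (∀ x y, T x y = T y x) ∧
      ∀ w : Fin k → Fin (N + 1) → Fin (N + 1), (∀ x, ∑ b, countMatrix w x b = k) →
        ∃ M ∈ rearrangements w, ∃ σ : Equiv.Perm (Fin (N + 1)), ∀ d c, M (σ d) c = T d c := by
  suffices H : ∃ T : Fin (N + 1) → Fin (N + 1) → ℤ, (∀ x y, T x y = T y x) ∧
      ∀ w : Fin k → Fin (N + 1) → Fin (N + 1), (∀ x, ∑ b, countMatrix w x b = k) →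
        ∃ A ∈ deviations w m s, ∃ σ : Equiv.Perm (Fin (N + 1)), ∀ d c, A (σ d) c = T d c by
    obtain ⟨T, hT, H⟩ := H
    refine ⟨fun x y => m + s * T x y, fun x y => by simp only [hT x y], fun w hw => ?_⟩
    obtain ⟨A, hA, σ, hσ⟩ := H w hw
    exact ⟨_, hA.2, σ, fun d c => by rw [hσ]⟩
  have hkC : (k : ℤ) = m * Fintype.card (Fin (N + 1)) + s * r := by simpa using hk
  have hkK : (Fintype.card (Fin k) : ℤ) = m * Fintype.card (Fin (N + 1)) + s * r := by
    simpa using hk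
  have hne (w : Fin k → Fin (N + 1) → Fin (N + 1)) (hw : ∀ x, ∑ b, countMatrix w x b = k) :=
    deviations_nonempty hs (by omega) hkC hw
  rcases hr with rfl | rfl | rfl
  · refine ⟨fun _ _ => 0, fun _ _ => rfl, fun w hw => ?_⟩
    obtain ⟨A, hA⟩ := hne w hw
    refine ⟨A, hA, 1, fun d c => ?_⟩
    have h := sum_deviation_row hs hkC hw hA d
    rw [Finset.sum_eq_zero_iff_of_nonneg fun c _ => hA.1 d c] at h
    exact h c (Finset.mem_univ c)
  · refine ⟨kdelta, fun x y => by simp [kdelta, eq_comm], fun w hw => ?_⟩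
    obtain ⟨A, hA⟩ := hne w hw
    exact ⟨A, hA, exists_permutation hA.1 (sum_deviation_row hs hkC hw hA)
      (sum_deviation_col hs hkK hA)⟩
  · refine ⟨fun d c => kdelta (d + c) 0 + kdelta (d + c) 1, fun x y => by simp only [add_comm x y],
      fun w hw => ?_⟩
    exact (switchable_deviations w m hs).exists_hamiltonian (hne w hw) (fun A hA => hA.1)
      (fun A hA => sum_deviation_row hs hkC hw hA) (fun A hA => sum_deviation_col hs hkK hA)
      fun A hA τ => ⟨fun x c => hA.1 x (τ c), rearrangements_permute hA.2 τ⟩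

/-- Numbering the elements of each fiber of a map all of whose fibers have `n` elements. -/
theorem exists_equiv_prod_of_card_fiber {E K : Type*} [Finite E] {n : ℕ} (v : E → K)
    (hv : ∀ y, Nat.card {e : E | v e = y} = n) : ∃ Φ : E ≃ K × Fin n, ∀ e, (Φ e).1 = v e := by
  have f (y : K) : {e : E // v e = y} ≃ Fin n := Finite.equivFinOfCardEq (hv y)
  exact ⟨(Equiv.sigmaFiberEquiv v).symm.trans
    ((Equiv.sigmaCongrRight f).trans (Equiv.sigmaEquivProd K (Fin n))), fun e => rfl⟩

/-- Two maps with equinumerous fibers differ by a bijection of their domains. -/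
theorem exists_equiv_of_card_fiber_eq {α β γ : Type*} [Finite α] [Finite β] (f : α → γ) (g : β → γ)
    (h : ∀ c, Nat.card {a // f a = c} = Nat.card {b // g b = c}) :
    ∃ ψ : α ≃ β, ∀ a, g (ψ a) = f a := by
  have e (c : γ) : {a // f a = c} ≃ {b // g b = c} :=
    (Finite.equivFin _).trans ((finCongr (h c)).trans (Finite.equivFin _).symm)
  exact ⟨(Equiv.sigmaFiberEquiv f).symm.trans
    ((Equiv.sigmaCongrRight e).trans (Equiv.sigmaFiberEquiv g)), fun a => (e (f a) ⟨a, rfl⟩).2⟩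

/-- A rearranged array of the left endpoints, as a numbering of the edges at each right vertex. -/
theorem exists_equiv_prod_of_mem_rearrangements {E K V C : Type*} [Fintype K]
    [DecidableEq V] (u : E → V) (Φ : E ≃ K × C) {M : V → C → ℤ}
    (hM : M ∈ rearrangements fun y b => u (Φ.symm (y, b))) :
    ∃ Ψ : E ≃ K × C, (∀ e, (Ψ e).1 = (Φ e).1) ∧
      ∀ x b, M x b = (Nat.card {e // u e = x ∧ (Ψ e).2 = b} : ℤ) := by
  obtain ⟨π, rfl⟩ := hM
  let Ψ := Φ.trans (Equiv.prodShear (Equiv.refl K) fun y => (π y).symm)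
  have hΨ (y : K) (b : C) : Ψ.symm (y, b) = Φ.symm (y, π y b) := by
    simp [Ψ, Equiv.prodShear]
  refine ⟨Ψ, fun e => rfl, fun x b => ?_⟩
  rw [countMatrix, Nat.cast_inj, ← Fintype.card_subtype, ← Nat.card_eq_fintype_card]
  refine Nat.card_congr ⟨fun y => ⟨Ψ.symm (y.1, b), ?_⟩, fun e => ⟨(Ψ e.1).1, ?_⟩, fun y => ?_,
    fun e => ?_⟩
  · rw [hΨ]; simpa [← hΨ] using y.2
  · obtain ⟨e, he, rfl⟩ := e
    change u (Φ.symm _) = x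
    rw [← hΨ]
    simpa using he
  · simp
  · obtain ⟨e, he, rfl⟩ := e
    simp

theorem sum_countMatrix_fiber {E K V C : Type*} [Finite E] [Fintype K] [Fintype C]
    [DecidableEq V] (u : E → V) (Φ : E ≃ K × C) (x : V) :
    ∑ b, countMatrix (fun y b => u (Φ.symm (y, b))) x b = Nat.card {e : E | u e = x} := by
  classical
  have := Fintype.ofFinite E
  simp only [countMatrix, Finset.card_filter, ← Nat.cast_sum]
  rw [Finset.sum_comm,
    ← Fintype.sum_prod_type' (f := fun y b => if u (Φ.symm (y, b)) = x then 1 else 0),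
    Φ.symm.sum_comp fun e => if u e = x then 1 else 0, ← Finset.card_filter,
    ← Fintype.card_subtype, ← Nat.card_eq_fintype_card]
  rfl

/-- Conjecture 5 (four parts) holds in the case `n1 = n2 = n`,
`k1 = k2 = k` with `k = m*n + ε`, `ε ∈ {-2,-1,0,1,2}`. -/
theorem stmt2 (n m : ℕ) (hn : 1 ≤ n) (hm : 1 ≤ m) (ε : ℤ)
    (hε : ε ∈ ({-2, -1, 0, 1, 2} : Set ℤ)) (k : ℕ) (hk : 0 < k)
    (hkval : (k : ℤ) = m * n + ε)
    (E1 E2 : Type) [Fintype E1] [Fintype E2]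
    (hE1 : Fintype.card E1 = n * k) (hE2 : Fintype.card E2 = n * k)
    (u1 : E1 → Fin n) (v1 : E1 → Fin k) (u2 : E2 → Fin n) (v2 : E2 → Fin k)
    (hu1 : ∀ x : Fin n, Nat.card {e : E1 | u1 e = x} = k)
    (hv1 : ∀ y : Fin k, Nat.card {e : E1 | v1 e = y} = n)
    (hu2 : ∀ x : Fin n, Nat.card {e : E2 | u2 e = x} = k)
    (hv2 : ∀ y : Fin k, Nat.card {e : E2 | v2 e = y} = n) :
    ∃ ψ : E1 ≃ E2,
      (∀ x : Fin n, ∀ y : Fin k, ∃! e : E1, u2 (ψ e) = x ∧ v1 e = y) ∧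
      (∀ x : Fin n, ∀ y : Fin k, ∃! e : E2, u1 (ψ.symm e) = x ∧ v2 e = y) := by
  obtain ⟨N, rfl⟩ : ∃ N, n = N + 1 := ⟨n - 1, by omega⟩
  obtain ⟨s, r, hs, hr, hsr⟩ : ∃ s r : ℤ, (s = 1 ∨ s = -1) ∧ (r = 0 ∨ r = 1 ∨ r = 2) ∧
      ε = s * r := by
    rcases hε with rfl | rfl | rfl | rfl | rfl
    exacts [⟨-1, 2, by simp⟩, ⟨-1, 1, by simp⟩, ⟨1, 0, by simp⟩, ⟨1, 1, by simp⟩, ⟨1, 2, by simp⟩]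
  obtain ⟨T, hT, H⟩ := exists_common_countMatrix hs hr (hsr ▸ hkval)
  obtain ⟨Φ1, hΦ1⟩ := exists_equiv_prod_of_card_fiber v1 hv1
  obtain ⟨Φ2, hΦ2⟩ := exists_equiv_prod_of_card_fiber v2 hv2
  obtain ⟨M1, hM1, σ1, hσ1⟩ := H _ fun x => by rw [sum_countMatrix_fiber u1 Φ1, hu1]
  obtain ⟨M2, hM2, σ2, hσ2⟩ := H _ fun x => by rw [sum_countMatrix_fiber u2 Φ2, hu2]
  obtain ⟨Ψ1, hΨ1, hc1⟩ := exists_equiv_prod_of_mem_rearrangements u1 Φ1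
    (rearrangements_permute hM1 σ2.symm)
  obtain ⟨Ψ2, hΨ2, hc2⟩ := exists_equiv_prod_of_mem_rearrangements u2 Φ2
    (rearrangements_permute hM2 σ1.symm)
  obtain ⟨ψ, hψ⟩ := exists_equiv_of_card_fiber_eq (fun e => (u1 e, (Ψ1 e).2))
    (fun e => ((Ψ2 e).2, u2 e)) fun ⟨a, b⟩ => by
      simp only [Prod.mk.injEq]
      simp only [and_comm (b := u2 _ = b)]
      rw [← Nat.cast_inj (R := ℤ), ← hc1, ← hc2]
      have h1 := hσ1 (σ1.symm a) (σ2.symm b)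
      have h2 := hσ2 (σ2.symm b) (σ1.symm a)
      rw [Equiv.apply_symm_apply] at h1 h2
      rw [h1, h2, hT]
  have hu2ψ (e : E1) : u2 (ψ e) = (Ψ1 e).2 := congrArg Prod.snd (hψ e)
  have hu1ψ (e : E2) : u1 (ψ.symm e) = (Ψ2 e).2 := by
    have := congrArg Prod.fst (hψ (ψ.symm e))
    simpa using this.symm
  have huniq {E : Type} (Ψ : E ≃ Fin k × Fin (N + 1)) (x : Fin (N + 1)) (y : Fin k) :
      ∃! e, (Ψ e).2 = x ∧ (Ψ e).1 = y := by
    refine ⟨Ψ.symm (y, x), by simp, ?_⟩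
    rintro e ⟨rfl, rfl⟩
    simp
  refine ⟨ψ, fun x y => ?_, fun x y => ?_⟩
  · simpa only [hu2ψ, ← hΦ1, ← hΨ1] using huniq Ψ1 x y
  · simpa only [hu1ψ, ← hΦ2, ← hΨ2] using huniq Ψ2 x y
end

section
/- Suppose the following matrix inequality holds: for all positive integers n and k, every matrix M : Matrix (Fin n) (Fin k) ℝ with nonnegative entries, every odd positive integer t, and every injective function p : Fin t → Fin n × Fin k with M (p i).1 (p i).2 = 0 for all i, one has ∑_{i} ∑_{j} M (p i).1 (p j).2 · M (p j).1 (p i).2 ≤ (t - 1) · R(M) · C(M), where R(M) is the maximum over rows of the sum of the entries in that row and C(M) is the maximum over columns of the sum of the entries in that column. Then for all positive integers n and k and every matrix M : Matrix (Fin n) (Fin k) ℕ in which every row sums to k and every column sums to n, there exists an involution θ : Fin n × Fin k → Fin n × Fin k (θ ∘ θ = id) such that for every p : Fin n × Fin k, M p.1 (θ p).2 · M (θ p).1 p.2 ≠ 0. -/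
/-- The maximum ℓ¹-norm of a row of `M` (i.e. `‖M‖_∞`). -/
noncomputable def rowMax {n k : ℕ} (hn : 0 < n) (M : Matrix (Fin n) (Fin k) ℝ) : ℝ :=
  Finset.univ.sup' ⟨⟨0, hn⟩, Finset.mem_univ _⟩ fun i => ∑ j, M i j

/-- The maximum ℓ¹-norm of a column of `M` (i.e. `‖M‖₁`). -/
noncomputable def colMax {n k : ℕ} (hk : 0 < k) (M : Matrix (Fin n) (Fin k) ℝ) : ℝ :=
  Finset.univ.sup' ⟨⟨0, hk⟩, Finset.mem_univ _⟩ fun j => ∑ i, M i j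

open Finset in
/-- A weighted sufficient condition for a perfect matching: the weight `A`, supported on the edges
of `G` and the diagonal, has column sums at most `d`, while at least `d` leaves every odd set of
vertices that avoids a fixed clique. -/
theorem SimpleGraph.exists_isPerfectMatching_of_weight {V : Type*} [Fintype V] [DecidableEq V]
    (G : SimpleGraph V) (hV : Even (Nat.card V)) {K : Set V} (hK : G.IsClique K)
    {A : V → V → ℝ} {d : ℝ} (hd : 0 < d) (hA : ∀ v w, 0 ≤ A v w)
    (hG : ∀ v w, v ≠ w → A v w ≠ 0 → G.Adj v w) (hcol : ∀ w, ∑ v, A v w ≤ d)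
    (hS : ∀ S : Finset V, Odd #S → (∀ v ∈ S, v ∉ K) → d ≤ ∑ v ∈ S, ∑ w ∈ Sᶜ, A v w) :
    ∃ N : G.Subgraph, N.IsPerfectMatching := by
  classical
  refine SimpleGraph.tutte.2 fun u hu ↦ ?_
  unfold SimpleGraph.IsTutteViolator at hu
  set H := ((⊤ : G.Subgraph).deleteVerts u).coe with hH
  have hadjH : ∀ a b, H.Adj a b ↔ G.Adj a.1 b.1 := fun a b ↦ by
    have ha := a.2
    have hb := b.2
    simp only [Subgraph.deleteVerts_verts, Subgraph.verts_top, Set.mem_sdiff, Set.mem_univ,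
      true_and] at ha hb
    simp [hH, ha, hb]
  have hmem : ∀ v, v ∉ u → v ∈ ((⊤ : G.Subgraph).deleteVerts u).verts := fun v hv ↦ by simp [hv]
  have hverts : Nat.card ((⊤ : G.Subgraph).deleteVerts u).verts + u.ncard = Nat.card V := by
    have := Set.ncard_add_ncard_compl u
    rw [Nat.card_coe_set_eq, add_comm, ← this]
    congr 2
    ext; simp
  have hparity := SimpleGraph.odd_ncard_oddComponents (G := H)
  have hgap : u.ncard + 2 ≤ H.oddComponents.ncard := by
    by_contra hlt
    have heq : H.oddComponents.ncard = u.ncard + 1 := by lia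
    rw [heq] at hparity
    rw [← hverts] at hV
    grind
  let S : H.ConnectedComponent → Finset V := fun c ↦
    c.supp.toFinset.map (Function.Embedding.subtype _)
  have hSmem : ∀ c v, v ∈ S c ↔ ∃ h, H.connectedComponentMk ⟨v, h⟩ = c := fun c v ↦ by
    simp [S]
  let odds := H.oddComponents.toFinset
  have hodds : #odds = H.oddComponents.ncard := (Set.ncard_eq_toFinset_card' _).symm
  let avoid := odds.filter fun c ↦ ∀ v ∈ S c, v ∉ K
  let meet := odds.filter fun c ↦ ¬ ∀ v ∈ S c, v ∉ K
  have hsplit : #avoid + #meet = #odds := Finset.card_filter_add_card_filter_not _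
  have hmeet : #meet ≤ 1 := by
    refine Finset.card_le_one.2 fun c hc c' hc' ↦ ?_
    simp only [meet, Finset.mem_filter, not_forall, not_not] at hc hc'
    obtain ⟨-, v, hv, hvK⟩ := hc
    obtain ⟨-, w, hw, hwK⟩ := hc'
    obtain ⟨hv, rfl⟩ := (hSmem _ _).1 hv
    obtain ⟨hw, rfl⟩ := (hSmem _ _).1 hw
    by_cases hvw : v = w
    · subst hvw; rfl
    · exact ConnectedComponent.connectedComponentMk_eq_of_adj ((hadjH _ _).2 (hK hvK hwK hvw))
  have havoid : ∀ c ∈ avoid, d ≤ ∑ v ∈ S c, ∑ w ∈ u.toFinset, A v w := fun c hc ↦ by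
    obtain ⟨hc, hcK⟩ := Finset.mem_filter.1 hc
    have hcard : Odd #(S c) := by
      simp only [odds, Set.mem_toFinset, SimpleGraph.oddComponents, Set.mem_ofPred_eq] at hc
      rwa [Set.ncard_eq_toFinset_card', ← Finset.card_map (Function.Embedding.subtype _)] at hc
    refine (hS _ hcard hcK).trans (Finset.sum_le_sum fun v hv ↦ ?_)
    rw [← Finset.sum_filter_ne_zero]
    refine Finset.sum_le_sum_of_subset_of_nonneg (fun w hw ↦ ?_) fun w _ _ ↦ hA v w
    rw [Finset.mem_filter, Finset.mem_compl] at hw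
    obtain ⟨hw, hvw⟩ := hw
    by_contra hwu
    rw [Set.mem_toFinset] at hwu
    refine hw ((hSmem _ _).2 ⟨hmem w hwu, ?_⟩)
    obtain ⟨hv', rfl⟩ := (hSmem _ _).1 hv
    have hne : v ≠ w := by rintro rfl; exact hw hv
    exact ConnectedComponent.connectedComponentMk_eq_of_adj ((hadjH _ _).2 (hG v w hne hvw).symm)
  have hdisj : (avoid : Set H.ConnectedComponent).PairwiseDisjoint S := fun c _ c' _ hne ↦ by
    refine Finset.disjoint_left.2 fun v hv hv' ↦ hne ?_
    obtain ⟨_, rfl⟩ := (hSmem _ _).1 hv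
    obtain ⟨_, rfl⟩ := (hSmem _ _).1 hv'
    rfl
  have hbound : #avoid * d ≤ u.ncard * d := calc
    (#avoid : ℝ) * d = ∑ _c ∈ avoid, d := by simp
    _ ≤ ∑ c ∈ avoid, ∑ v ∈ S c, ∑ w ∈ u.toFinset, A v w := Finset.sum_le_sum havoid
    _ = ∑ v ∈ avoid.biUnion S, ∑ w ∈ u.toFinset, A v w := (Finset.sum_biUnion hdisj).symm
    _ ≤ ∑ v, ∑ w ∈ u.toFinset, A v w :=
      Finset.sum_le_sum_of_subset_of_nonneg (Finset.subset_univ _)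
        fun v _ _ ↦ Finset.sum_nonneg fun w _ ↦ hA v w
    _ = ∑ w ∈ u.toFinset, ∑ v, A v w := Finset.sum_comm
    _ ≤ ∑ _w ∈ u.toFinset, d := Finset.sum_le_sum fun w _ ↦ hcol w
    _ = u.ncard * d := by simp [Set.ncard_eq_toFinset_card']
  have hle : #avoid ≤ u.ncard := by exact_mod_cast le_of_mul_le_mul_right hbound hd
  lia

/-- Two copies of the vertex set `V`: the first carries the edges `A v w ≠ 0`, and the loops
`A v v ≠ 0` are replaced by a clique on the looped vertices and the whole second copy. -/
def loopCliqueGraph {V : Type*} (A : V → V → ℝ) (hA : ∀ v w, A v w = A w v) :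
    SimpleGraph (V ⊕ V) where
  Adj a b := a ≠ b ∧ (((∀ v, a = .inl v → A v v ≠ 0) ∧ ∀ v, b = .inl v → A v v ≠ 0) ∨
    ∃ v w, a = .inl v ∧ b = .inl w ∧ A v w ≠ 0)
  symm := ⟨by
    rintro a b ⟨hne, ⟨ha, hb⟩ | ⟨v, w, ha, hb, h⟩⟩
    · exact ⟨hne.symm, .inl ⟨hb, ha⟩⟩
    · exact ⟨hne.symm, .inr ⟨w, v, hb, ha, hA v w ▸ h⟩⟩⟩
  loopless := ⟨fun _ h ↦ h.1 rfl⟩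

open Finset in
/-- A symmetric nonnegative weight with constant row sums `d` has a perfect matching (loops
allowed) in its support as soon as every odd loopless set `S` spans weight at most
`(#S - 1) * d`. -/
theorem exists_involution_of_weight {V : Type*} [Fintype V] [DecidableEq V] {A : V → V → ℝ}
    (hsymm : ∀ v w, A v w = A w v) {d : ℝ} (hd : 0 < d) (hA : ∀ v w, 0 ≤ A v w)
    (hrow : ∀ v, ∑ w, A v w = d)
    (hS : ∀ S : Finset V, Odd #S → (∀ v ∈ S, A v v = 0) →
      ∑ v ∈ S, ∑ w ∈ S, A v w ≤ (#S - 1) * d) :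
    ∃ θ : V → V, θ ∘ θ = id ∧ ∀ v, A v (θ v) ≠ 0 := by
  classical
  let B : V ⊕ V → V ⊕ V → ℝ := fun a b ↦
    Sum.elim (fun v ↦ Sum.elim (fun w ↦ A v w) (fun _ ↦ 0) b) (fun _ ↦ 0) a
  obtain ⟨N, hN⟩ := (loopCliqueGraph A hsymm).exists_isPerfectMatching_of_weight
    (K := {a | ∀ v, a = .inl v → A v v ≠ 0}) (A := B) (d := d) (by simp)
    (fun a ha b hb hne ↦ ⟨hne, .inl ⟨ha, hb⟩⟩) hd
    (by rintro (v | v) (w | w) <;> simp [B, hA])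
    (by
      rintro (v | v) (w | w) hne h <;> simp only [B, Sum.elim_inl, Sum.elim_inr, ne_eq,
        not_true_eq_false] at h
      exact ⟨hne, .inr ⟨v, w, rfl, rfl, h⟩⟩)
    (by
      rintro (w | w)
      · simp [B, hsymm _ w, hrow]
      · simp [B, hd.le])
    (by
      intro S hodd hSK
      have hleft : ∀ a ∈ S, ∃ v, a = .inl v ∧ A v v = 0 := fun a ha ↦ by
        simpa using hSK a ha
      obtain ⟨T, rfl⟩ : ∃ T : Finset V, T.map Function.Embedding.inl = S :=
        ⟨Finset.univ.filter fun v ↦ .inl v ∈ S, by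
          ext a
          simp only [Finset.mem_map, Finset.mem_filter, Finset.mem_univ, true_and,
            Function.Embedding.inl_apply]
          constructor
          · rintro ⟨v, hv, rfl⟩; exact hv
          · intro ha
            obtain ⟨v, rfl, -⟩ := hleft a ha
            exact ⟨v, ha, rfl⟩⟩
      rw [Finset.card_map] at hodd
      have hin := hS T hodd fun v hv ↦ by
        simpa using hleft (.inl v) (by simpa using hv)
      have htotal : ∑ a ∈ T.map Function.Embedding.inl, ∑ b, B a b = #T * d := by
        simp [B, hrow]
      have hinner : ∑ a ∈ T.map Function.Embedding.inl,
          ∑ b ∈ T.map Function.Embedding.inl, B a b = ∑ v ∈ T, ∑ w ∈ T, A v w := by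
        simp [B]
      simp only [← Finset.sum_add_sum_compl (T.map Function.Embedding.inl) (B _),
        Finset.sum_add_distrib] at htotal
      linarith)
  let P : V → V → Prop := fun v w ↦ N.Adj (.inl v) (.inl w) ∧ A v w ≠ 0
  have hPsymm : ∀ {v w}, P v w → P w v := fun h ↦ ⟨h.1.symm, hsymm _ _ ▸ h.2⟩
  have hPuniq : ∀ {v w w'}, P v w → P v w' → w = w' := fun h h' ↦
    Sum.inl_injective (hN.1.eq_of_adj_left h.1 h'.1)
  have hloop : ∀ v, (¬ ∃ w, P v w) → A v v ≠ 0 := fun v hv ↦ by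
    obtain ⟨b, hb, -⟩ := SimpleGraph.Subgraph.isPerfectMatching_iff.1 hN (.inl v)
    obtain ⟨-, ⟨ha, -⟩ | ⟨v', w, hv', rfl, h⟩⟩ := hb.adj_sub
    · exact ha v rfl
    · obtain rfl := Sum.inl_injective hv'
      exact absurd ⟨w, hb, h⟩ hv
  let θ : V → V := fun v ↦ if h : ∃ w, P v w then h.choose else v
  have hθ : ∀ {v w}, P v w → θ v = w := fun {v w} h ↦ by
    have hex : ∃ w, P v w := ⟨w, h⟩
    simp only [θ, dif_pos hex]
    exact hPuniq hex.choose_spec h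
  have hθ' : ∀ {v}, (¬ ∃ w, P v w) → θ v = v := fun h ↦ dif_neg h
  refine ⟨θ, funext fun v ↦ ?_, fun v ↦ ?_⟩ <;> by_cases h : ∃ w, P v w
  · obtain ⟨w, hw⟩ := h
    simp [hθ hw, hθ (hPsymm hw)]
  · simp [hθ' h]
  · obtain ⟨w, hw⟩ := h
    rw [hθ hw]
    exact hw.2
  · rw [hθ' h]
    exact hloop v h

/-- the matrix inequality (Conjecture 6) implies Conjecture 2:
every matrix with row sums `k` and column sums `n` yields a multigraph `M ⊗ Mᵀ`
with a perfect matching (loops allowed). -/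
theorem stmt4
    (hIneq : ∀ (n k : ℕ) (hn : 0 < n) (hk : 0 < k) (M : Matrix (Fin n) (Fin k) ℝ),
      (∀ i j, 0 ≤ M i j) → ∀ t : ℕ, 0 < t → Odd t →
      ∀ p : Fin t → Fin n × Fin k, Function.Injective p →
      (∀ i, M (p i).1 (p i).2 = 0) →
      ∑ i, ∑ j, M (p i).1 (p j).2 * M (p j).1 (p i).2 ≤
        ((t : ℝ) - 1) * rowMax hn M * colMax hk M) :
    ∀ (n k : ℕ), 0 < n → 0 < k → ∀ M : Matrix (Fin n) (Fin k) ℕ,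
      (∀ i, ∑ j, M i j = k) → (∀ j, ∑ i, M i j = n) →
      ∃ θ : Fin n × Fin k → Fin n × Fin k, θ ∘ θ = id ∧
        ∀ p : Fin n × Fin k, M p.1 (θ p).2 * M (θ p).1 p.2 ≠ 0 := by
  intro n k hn hk M hrow hcol
  let R : Matrix (Fin n) (Fin k) ℝ := fun i j ↦ M i j
  have hR : ∀ i j, 0 ≤ R i j := fun i j ↦ Nat.cast_nonneg _
  have hRrow : ∀ i, ∑ j, R i j = k := fun i ↦ by
    simp only [R]
    exact_mod_cast hrow i
  have hRcol : ∀ j, ∑ i, R i j = n := fun j ↦ by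
    simp only [R]
    exact_mod_cast hcol j
  have hrowMax : rowMax hn R = k := by
    simp only [rowMax, hRrow]
    exact Finset.sup'_const _ _
  have hcolMax : colMax hk R = n := by
    simp only [colMax, hRcol]
    exact Finset.sup'_const _ _
  obtain ⟨θ, hθ, hne⟩ := exists_involution_of_weight
    (A := fun v w : Fin n × Fin k ↦ R v.1 w.2 * R w.1 v.2) (d := (k : ℝ) * n)
    (fun v w ↦ mul_comm _ _) (by positivity) (fun v w ↦ mul_nonneg (hR _ _) (hR _ _))
    (fun v ↦ by
      rw [Fintype.sum_prod_type_right, ← hRrow v.1, ← hRcol v.2, Finset.sum_mul_sum])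
    (fun S hodd hloop ↦ by
      let e := S.equivFin
      have h := hIneq n k hn hk R hR S.card hodd.pos hodd (fun i ↦ (e.symm i).1)
        (Subtype.val_injective.comp e.symm.injective)
        (fun i ↦ mul_self_eq_zero.1 (hloop _ (e.symm i).2))
      rw [hrowMax, hcolMax, mul_assoc] at h
      refine le_of_eq_of_le ?_ h
      rw [← Finset.sum_coe_sort, ← Equiv.sum_comp e.symm]
      refine Finset.sum_congr rfl fun i _ ↦ ?_
      rw [← Finset.sum_coe_sort, ← Equiv.sum_comp e.symm])
  exact ⟨θ, hθ, fun p ↦ by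
    have := hne p
    simp only [R] at this
    exact_mod_cast this⟩
end

section
/- Let n, k be positive integers and M : Matrix (Fin n) (Fin k) ℝ a matrix with nonnegative entries. Let t be an odd positive integer, and let x : Fin t → Fin n and y : Fin t → Fin k both be injective, with M (x i) (y i) = 0 for all i. Then ∑_{i} ∑_{j} M (x i) (y j) · M (x j) (y i) ≤ (t - 1) · R(M) · C(M), where R(M) is the maximum over all rows of the sum of the entries in that row, and C(M) is the maximum over all columns of the sum of the entries in that column. -/
/-- If a symmetric matrix with vanishing diagonal and of odd size has nonnegative entries and row
sums at most `S`, then some row has all of its entries at most `S / 2`. -/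
theorem exists_row_le_half {ι : Type*} [Fintype ι] (hodd : Odd (Fintype.card ι))
    (b : ι → ι → ℝ) (S : ℝ) (hb : ∀ i j, 0 ≤ b i j) (hsymm : ∀ i j, b i j = b j i)
    (hdiag : ∀ i, b i i = 0) (hrow : ∀ i, ∑ j, b i j ≤ S) :
    ∃ v, ∀ j, b v j ≤ S / 2 := by
  classical
  by_contra! h
  choose f hf using h
  have hS : ∀ i : ι, 0 ≤ S := fun i => (Finset.sum_nonneg fun j _ => hb i j).trans (hrow i)
  have hne : ∀ i, f i ≠ i := fun i hi => by
    have h1 := hf i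
    rw [hi, hdiag] at h1
    linarith [hS i]
  have hinv : ∀ i, f (f i) = i := fun i => by
    by_contra hi
    have h1 : ∑ j ∈ {f (f i), i}, b (f i) j ≤ ∑ j, b (f i) j :=
      Finset.sum_le_sum_of_subset_of_nonneg (Finset.subset_univ _) fun j _ _ => hb _ j
    rw [Finset.sum_pair hi] at h1
    linarith [hrow (f i), hf i, hf (f i), hsymm i (f i)]
  have hsum : ∑ _i : ι, (1 : ZMod 2) = 0 :=
    Finset.sum_involution (fun i _ => f i) (fun _ _ => by decide) (fun i _ _ => hne i)
      (fun _ _ => Finset.mem_univ _) (fun i _ => hinv i)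
  rw [Finset.sum_const, Finset.card_univ, nsmul_one, ZMod.natCast_eq_zero_iff_even] at hsum
  exact Nat.not_even_iff_odd.mpr hodd hsum

/-- A symmetric matrix with vanishing diagonal, of odd size `t`, with nonnegative entries and row
sums at most `S` has squared Frobenius norm at most `(t - 1) * S ^ 2`. -/
theorem sum_sq_le_of_symm_of_odd {ι : Type*} [Fintype ι] (hodd : Odd (Fintype.card ι))
    (b : ι → ι → ℝ) (S : ℝ) (hb : ∀ i j, 0 ≤ b i j) (hsymm : ∀ i j, b i j = b j i)
    (hdiag : ∀ i, b i i = 0) (hrow : ∀ i, ∑ j, b i j ≤ S) :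
    ∑ i, ∑ j, b i j ^ 2 ≤ ((Fintype.card ι : ℝ) - 1) * S ^ 2 := by
  classical
  obtain ⟨v, hv⟩ := exists_row_le_half hodd b S hb hsymm hdiag hrow
  have hle : ∀ i j, b i j ≤ S := fun i j =>
    (Finset.single_le_sum (fun k _ => hb i k) (Finset.mem_univ j)).trans (hrow i)
  have hother : ∀ i, ∑ j, b i j ^ 2 ≤ S ^ 2 - S * b v i := fun i => by
    have h1 := Finset.add_sum_erase Finset.univ (fun j => b i j) (Finset.mem_univ v)
    have h2 := Finset.add_sum_erase Finset.univ (fun j => b i j ^ 2) (Finset.mem_univ v)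
    have h3 := Finset.sum_sq_le_sq_sum_of_nonneg (s := Finset.univ.erase v) (f := fun j => b i j)
      fun j _ => hb i j
    have h4 : 0 ≤ ∑ j ∈ Finset.univ.erase v, b i j := Finset.sum_nonneg fun j _ => hb i j
    have h5 : (∑ j ∈ Finset.univ.erase v, b i j) ^ 2 ≤ (S - b i v) ^ 2 :=
      pow_le_pow_left₀ h4 (by linarith [hrow i]) 2
    rw [hsymm v i]
    nlinarith [hb i v, hv i, hsymm v i]
  have hself : ∑ j, b v j ^ 2 ≤ S * ∑ j, b v j := by
    rw [Finset.mul_sum]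
    refine Finset.sum_le_sum fun j _ => ?_
    rw [sq]
    exact mul_le_mul_of_nonneg_right (hle v j) (hb v j)
  have h1 := Finset.add_sum_erase Finset.univ (fun i => ∑ j, b i j ^ 2) (Finset.mem_univ v)
  have h2 := Finset.add_sum_erase Finset.univ (fun i => S ^ 2 - S * b v i) (Finset.mem_univ v)
  have h3 := Finset.sum_le_sum fun i (_ : i ∈ Finset.univ.erase v) => hother i
  simp only [hdiag, Finset.sum_sub_distrib, ← Finset.mul_sum, Finset.sum_const, Finset.card_univ,
    nsmul_eq_mul] at h1 h2 h3
  linarith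

/-- Conjecture 6 (the matrix inequality) in the case when all the row
indices `x i` are distinct and all the column indices `y i` are distinct. -/
theorem stmt5 (n k : ℕ) (hn : 0 < n) (hk : 0 < k) (M : Matrix (Fin n) (Fin k) ℝ)
    (hMnn : ∀ i j, 0 ≤ M i j) (t : ℕ) (ht : 0 < t) (htodd : Odd t)
    (x : Fin t → Fin n) (y : Fin t → Fin k)
    (hx : Function.Injective x) (hy : Function.Injective y)
    (hzero : ∀ i, M (x i) (y i) = 0) :
    ∑ i, ∑ j, M (x i) (y j) * M (x j) (y i) ≤ ((t : ℝ) - 1) * rowMax hn M * colMax hk M := by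
  have hR : ∀ i, ∑ j, M (x i) (y j) ≤ rowMax hn M := fun i =>
    (Finset.sum_image (f := M (x i)) (fun a _ b _ h => hy h)).symm.trans_le <|
      (Finset.sum_le_sum_of_subset_of_nonneg (Finset.subset_univ _) fun j _ _ => hMnn _ j).trans
        (Finset.le_sup' (fun i => ∑ j, M i j) (Finset.mem_univ (x i)))
  have hC : ∀ i, ∑ j, M (x j) (y i) ≤ colMax hk M := fun i =>
    (Finset.sum_image (f := fun a => M a (y i)) (fun a _ b _ h => hx h)).symm.trans_le <|
      (Finset.sum_le_sum_of_subset_of_nonneg (Finset.subset_univ _) fun j _ _ => hMnn j _).trans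
        (Finset.le_sup' (fun j => ∑ i, M i j) (Finset.mem_univ (y i)))
  have hR0 : 0 ≤ rowMax hn M := (Finset.sum_nonneg fun j _ => hMnn _ _).trans (hR ⟨0, ht⟩)
  have hC0 : 0 ≤ colMax hk M := (Finset.sum_nonneg fun j _ => hMnn _ _).trans (hC ⟨0, ht⟩)
  have key := sum_sq_le_of_symm_of_odd (by simpa using htodd)
    (fun i j : Fin t => √(M (x i) (y j)) * √(M (x j) (y i)))
    (√(rowMax hn M) * √(colMax hk M)) (fun i j => by positivity) (fun i j => mul_comm _ _)
    (fun i => by simp [hzero])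
    (fun i => (Real.sum_sqrt_mul_sqrt_le _ (fun j => hMnn _ _) (fun j => hMnn _ _)).trans <| by
      gcongr
      · exact hR i
      · exact hC i)
  simpa only [mul_pow, Real.sq_sqrt, hMnn, hR0, hC0, Fintype.card_fin, mul_assoc] using key
end

section
/- The following two statements are equivalent. (I) For all positive integers n, k and every matrix M : Matrix (Fin n) (Fin k) ℝ whose entries all belong to {0, 1}: if there exists a bijection σ : Fin n × Fin k ≃ Fin n × Fin k such that M p.1 (σ p).2 · M (σ p).1 p.2 ≠ 0 for every p, then there exists an involution θ : Fin n × Fin k → Fin n × Fin k (θ ∘ θ = id) such that M p.1 (θ p).2 · M (θ p).1 p.2 ≠ 0 for every p. (II) For all positive integers n, k and every matrix M : Matrix (Fin n) (Fin k) ℕ in which every row sums to k and every column sums to n, there exists an involution θ : Fin n × Fin k → Fin n × Fin k (θ ∘ θ = id) such that M p.1 (θ p).2 · M (θ p).1 p.2 ≠ 0 for every p. -/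
open Finset in
/-- A square matrix of natural numbers whose row and column sums all equal `s > 0` has a
permutation supported on its nonzero entries. -/
theorem exists_perm_forall_ne_zero_of_sum_eq {ι : Type*} [Fintype ι] [DecidableEq ι]
    (B : Matrix ι ι ℕ) {s : ℕ} (hs : 0 < s) (hrow : ∀ i, ∑ j, B i j = s)
    (hcol : ∀ j, ∑ i, B i j = s) : ∃ σ : Equiv.Perm ι, ∀ i, B i (σ i) ≠ 0 := by
  have hcard (A : Finset ι) : #A ≤ #(A.biUnion fun i => {j | B i j ≠ 0}) := by
    set N := A.biUnion fun i => {j | B i j ≠ 0} with hN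
    refine Nat.le_of_mul_le_mul_right ?_ hs
    calc #A * s = ∑ i ∈ A, ∑ j ∈ N, B i j := by
          rw [← smul_eq_mul, ← sum_const]
          refine sum_congr rfl fun i hi => ?_
          rw [← hrow i]
          refine (sum_subset (subset_univ _) fun j _ hj => ?_).symm
          by_contra h
          exact hj (mem_biUnion.2 ⟨i, hi, by simpa using h⟩)
      _ = ∑ j ∈ N, ∑ i ∈ A, B i j := sum_comm
      _ ≤ ∑ j ∈ N, s := sum_le_sum fun j _ =>
          (sum_le_univ_sum_of_nonneg fun _ => Nat.zero_le _).trans_eq (hcol j)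
      _ = #N * s := by simp
  obtain ⟨f, hf, hfB⟩ := (all_card_le_biUnion_card_iff_exists_injective _).1 hcard
  exact ⟨Equiv.ofBijective f (Finite.injective_iff_bijective.1 hf),
    fun i => by simpa using hfB i⟩

/-- The number of pairs `p` in row `x` whose image under `σ` lies in column `y`. -/
def permCount {α β : Type*} [Fintype α] [Fintype β] [DecidableEq α] [DecidableEq β]
    (σ : α × β ≃ α × β) : Matrix α β ℕ :=
  fun x y => ∑ p, if p.1 = x ∧ (σ p).2 = y then 1 else 0

section permCount

variable {α β : Type*} [Fintype α] [Fintype β] [DecidableEq α] [DecidableEq β]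
  (σ : α × β ≃ α × β)

theorem sum_permCount_row (x : α) : ∑ y, permCount σ x y = Fintype.card β := by
  simp only [permCount]
  rw [Finset.sum_comm]
  simp [ite_and, Fintype.sum_prod_type_right, -Finset.sum_boole]

theorem sum_permCount_col (y : β) : ∑ x, permCount σ x y = Fintype.card α := by
  simp only [permCount]
  rw [Finset.sum_comm]
  simp only [ite_and, Finset.sum_ite_eq, Finset.mem_univ, if_true]
  rw [σ.sum_comp fun q : α × β => if q.2 = y then 1 else 0]
  simp [Fintype.sum_prod_type, -Finset.sum_boole]

theorem exists_of_permCount_ne_zero {x : α} {y : β} (h : permCount σ x y ≠ 0) :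
    ∃ p : α × β, p.1 = x ∧ (σ p).2 = y := by
  obtain ⟨p, -, hp⟩ := Finset.exists_ne_zero_of_sum_ne_zero h
  exact ⟨p, of_not_not fun hn => hp (if_neg hn)⟩

end permCount


/-- Conjecture 1 (Higgins) is equivalent to Conjecture 2: for binary
matrices, a perfect matching in the bipartite graph with bipartite adjacency matrix
`M ⊗ Mᵀ` yields a perfect matching in the ordinary graph, iff every matrix with row
sums `k` and column sums `n` yields a multigraph `M ⊗ Mᵀ` with a perfect matching. -/
theorem stmt6 :
    (∀ (n k : ℕ), 0 < n → 0 < k → ∀ M : Matrix (Fin n) (Fin k) ℝ,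
      (∀ i j, M i j = 0 ∨ M i j = 1) →
      (∃ σ : Fin n × Fin k ≃ Fin n × Fin k,
        ∀ p : Fin n × Fin k, M p.1 (σ p).2 * M (σ p).1 p.2 ≠ 0) →
      (∃ θ : Fin n × Fin k → Fin n × Fin k, θ ∘ θ = id ∧
        ∀ p : Fin n × Fin k, M p.1 (θ p).2 * M (θ p).1 p.2 ≠ 0))
    ↔
    (∀ (n k : ℕ), 0 < n → 0 < k → ∀ M : Matrix (Fin n) (Fin k) ℕ,
      (∀ i, ∑ j, M i j = k) → (∀ j, ∑ i, M i j = n) →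
      ∃ θ : Fin n × Fin k → Fin n × Fin k, θ ∘ θ = id ∧
        ∀ p : Fin n × Fin k, M p.1 (θ p).2 * M (θ p).1 p.2 ≠ 0) := by
  constructor
  · intro hI n k hn hk M hrow hcol
    obtain ⟨σ, hσ⟩ := exists_perm_forall_ne_zero_of_sum_eq
      (fun p q : Fin n × Fin k => M p.1 q.2 * M q.1 p.2) (Nat.mul_pos hk hn)
      (fun p => by
        rw [Fintype.sum_prod_type_right]
        simp only [← Finset.mul_sum, hcol, ← Finset.sum_mul, hrow])
      (fun q => by
        rw [Fintype.sum_prod_type_right]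
        simp only [← Finset.sum_mul, hcol, ← Finset.mul_sum, hrow, mul_comm])
    obtain ⟨θ, hθ, h⟩ := hI n k hn hk (fun i j => if M i j = 0 then 0 else 1)
      (fun i j => by split_ifs <;> simp) ⟨σ, fun p => by simpa [and_comm] using hσ p⟩
    exact ⟨θ, hθ, fun p => by simpa [and_comm] using h p⟩
  · rintro hII n k hn hk M - ⟨σ, hσ⟩
    obtain ⟨θ, hθ, h⟩ := hII n k hn hk (permCount σ)
      (fun i => by simpa using sum_permCount_row σ i)
      (fun j => by simpa using sum_permCount_col σ j)
    have hM {x : Fin n} {y : Fin k} (hxy : permCount σ x y ≠ 0) : M x y ≠ 0 := by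
      obtain ⟨p, rfl, rfl⟩ := exists_of_permCount_ne_zero σ hxy
      exact left_ne_zero_of_mul (hσ p)
    exact ⟨θ, hθ, fun p =>
      mul_ne_zero (hM (left_ne_zero_of_mul (h p))) (hM (right_ne_zero_of_mul (h p)))⟩
end

section
/- Let L and R be finite types with L nonempty, let A : L → R → Prop be a relation, and let p, q be positive integers. Then the following are equivalent: (1) for every nonempty finite set X ⊆ L, p · |X| ≤ q · |N(X)|, where N(X) = {y : R | ∃ x ∈ X, A x y}; (2) there exists an injective function f : L × Fin p → R × Fin q such that A l (f (l, i)).1 holds for every l : L and i : Fin p. -/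
/-- The neighborhood of `S` in the tensor product with a complete bipartite graph is `q` copies of
the neighborhood of the projection of `S`. -/
theorem card_filter_rel_fst {L R P : Type*} [Fintype R] [DecidableEq L]
    (A : L → R → Prop) [DecidableRel A] (q : ℕ) (S : Finset (L × P)) :
    (Finset.univ.filter fun b : R × Fin q => ∃ a ∈ S, A a.1 b.1).card =
      q * Set.ncard {y : R | ∃ x ∈ S.image Prod.fst, A x y} := by
  have h : (Finset.univ.filter fun b : R × Fin q => ∃ a ∈ S, A a.1 b.1) =
      (Finset.univ.filter fun y : R => ∃ x ∈ S.image Prod.fst, A x y) ×ˢ Finset.univ := by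
    ext ⟨y, j⟩
    simp
  rw [h, Finset.card_product, Finset.card_fin, mul_comm, ← Set.ncard_coe_finset,
    Finset.coe_filter_univ]

/-- Lemma 4: for a bipartite graph given by the relation `A`,
`h(G) ≥ p/q` iff `G ⊗ K_{p,q}` has a matching covering its left part. -/
theorem stmt7 (L R : Type) [Fintype L] [Fintype R] [Nonempty L]
    (A : L → R → Prop) (p q : ℕ) (hp : 0 < p) (hq : 0 < q) :
    (∀ X : Finset L, X.Nonempty →
        p * X.card ≤ q * Set.ncard {y : R | ∃ x ∈ X, A x y})
    ↔ (∃ f : L × Fin p → R × Fin q, Function.Injective f ∧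
        ∀ (l : L) (i : Fin p), A l (f (l, i)).1) := by
  classical
  have hall := Fintype.all_card_le_filter_rel_iff_exists_injective
    (fun (a : L × Fin p) (b : R × Fin q) => A a.1 b.1)
  simp only [Prod.forall] at hall
  rw [← hall]
  constructor
  · intro h S
    rcases S.eq_empty_or_nonempty with rfl | hS
    · simp
    · have hsub : S ⊆ S.image Prod.fst ×ˢ Finset.univ := fun a ha =>
        Finset.mem_product.2 ⟨Finset.mem_image_of_mem _ ha, Finset.mem_univ _⟩
      calc S.card ≤ (S.image Prod.fst ×ˢ (Finset.univ : Finset (Fin p))).card :=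
            Finset.card_le_card hsub
        _ = p * (S.image Prod.fst).card := by
            rw [Finset.card_product, Finset.card_fin, mul_comm]
        _ ≤ _ := (h _ (hS.image _)).trans_eq (card_filter_rel_fst A q S).symm
  · intro h X _
    have : Nonempty (Fin p) := ⟨⟨0, hp⟩⟩
    have hX := (h (X ×ˢ Finset.univ)).trans_eq (card_filter_rel_fst A q _)
    rwa [Finset.card_product, Finset.card_fin, mul_comm,
      Finset.product_image_fst Finset.univ_nonempty] at hX
end

section
/- Let L1, R1, L2, R2 be finite nonempty types and let A : L1 → R1 → Prop and B : L2 → R2 → Prop be relations. For a relation C : L → R → Prop with L finite and nonempty, define h(C) ∈ ℚ as the minimum over all nonempty finite sets X ⊆ L of |N_C(X)| / |X|, where N_C(X) = {y | ∃ x ∈ X, C x y}. Let A ⊗ B : (L1 × L2) → (R1 × R2) → Prop be the relation with (A ⊗ B) (l1, l2) (r1, r2) ↔ A l1 r1 ∧ B l2 r2. Then h(A ⊗ B) = h(A) · h(B). -/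
/-- `hRatio C` is `h(G)` for the bipartite graph `G` given by the relation `C`:
the minimum over all nonempty sets `X` of left vertices of `|N(X)| / |X|`. -/
noncomputable def hRatio {L R : Type} [Fintype L] [Nonempty L] (C : L → R → Prop) : ℚ :=
  (Finset.univ.powerset.filter fun X : Finset L => X.Nonempty).inf'
    ⟨{Classical.arbitrary L}, by simp⟩
    fun X => (Set.ncard {y : R | ∃ x ∈ X, C x y} : ℚ) / (X.card : ℚ)

theorem hRatio_nonneg {L R : Type} [Fintype L] [Nonempty L] (C : L → R → Prop) :
    0 ≤ hRatio C :=
  Finset.le_inf' _ _ fun _ _ => by positivity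

theorem hRatio_le {L R : Type} [Fintype L] [Nonempty L] (C : L → R → Prop)
    {X : Finset L} (hX : X.Nonempty) :
    hRatio C ≤ (Set.ncard {y : R | ∃ x ∈ X, C x y} : ℚ) / (X.card : ℚ) :=
  Finset.inf'_le _ (by simpa using hX)

theorem exists_hRatio_eq {L R : Type} [Fintype L] [Nonempty L] (C : L → R → Prop) :
    ∃ X : Finset L, X.Nonempty ∧
      hRatio C = (Set.ncard {y : R | ∃ x ∈ X, C x y} : ℚ) / (X.card : ℚ) := by
  obtain ⟨X, hX, h⟩ := Finset.exists_mem_eq_inf'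
    (s := Finset.univ.powerset.filter fun X : Finset L => X.Nonempty)
    ⟨{Classical.arbitrary L}, by simp⟩
    fun X => (Set.ncard {y : R | ∃ x ∈ X, C x y} : ℚ) / (X.card : ℚ)
  exact ⟨X, (Finset.mem_filter.mp hX).2, h⟩

theorem hRatio_mul_ncard_le {L R : Type} [Fintype L] [Nonempty L] (C : L → R → Prop)
    (S : Set L) :
    hRatio C * (S.ncard : ℚ) ≤ (Set.ncard {y : R | ∃ x ∈ S, C x y} : ℚ) := by
  classical
  rcases S.eq_empty_or_nonempty with rfl | hS
  · simp
  · have h := hRatio_le C (X := S.toFinset) (by simpa using hS)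
    have hpos : (0 : ℚ) < (S.toFinset.card : ℚ) := by
      exact_mod_cast Finset.card_pos.mpr (by simpa using hS)
    rw [le_div_iff₀ hpos] at h
    simpa [Set.ncard_eq_toFinset_card'] using h

theorem ncard_eq_sum_ncard_fiber {α β : Type*} [Fintype α] [Fintype β] (S : Set (α × β)) :
    S.ncard = ∑ a, Set.ncard {b | (a, b) ∈ S} := by
  classical
  simp only [Set.ncard_eq_toFinset_card', Set.toFinset_card, Fintype.card_subtype,
    Finset.card_filter, Set.mem_ofPred_eq, Fintype.sum_prod_type]

theorem ncard_eq_sum_ncard_fiber_right {α β : Type*} [Fintype α] [Fintype β]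
    (S : Set (α × β)) :
    S.ncard = ∑ b, Set.ncard {a | (a, b) ∈ S} := by
  classical
  simp only [Set.ncard_eq_toFinset_card', Set.toFinset_card, Fintype.card_subtype,
    Finset.card_filter, Set.mem_ofPred_eq, Fintype.sum_prod_type_right]

/-- The neighbourhood in a tensor product is taken one coordinate at a time. -/
theorem hRatio_mul_hRatio_mul_ncard_le {L₁ R₁ L₂ R₂ : Type} [Fintype L₁] [Fintype R₁]
    [Fintype L₂] [Fintype R₂] [Nonempty L₁] [Nonempty L₂]
    (A : L₁ → R₁ → Prop) (B : L₂ → R₂ → Prop) (S : Set (L₁ × L₂)) :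
    hRatio A * hRatio B * (S.ncard : ℚ) ≤
      (Set.ncard {r : R₁ × R₂ | ∃ l ∈ S, A l.1 r.1 ∧ B l.2 r.2} : ℚ) := by
  let T : Set (R₁ × L₂) := {p | ∃ l₁, (l₁, p.2) ∈ S ∧ A l₁ p.1}
  have hA : hRatio A * (S.ncard : ℚ) ≤ (T.ncard : ℚ) := by
    rw [ncard_eq_sum_ncard_fiber_right S, ncard_eq_sum_ncard_fiber_right T]
    push_cast
    rw [Finset.mul_sum]
    exact Finset.sum_le_sum fun l₂ _ => hRatio_mul_ncard_le A {l₁ | (l₁, l₂) ∈ S}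
  have hB : hRatio B * (T.ncard : ℚ) ≤
      (Set.ncard {r : R₁ × R₂ | ∃ l ∈ S, A l.1 r.1 ∧ B l.2 r.2} : ℚ) := by
    rw [ncard_eq_sum_ncard_fiber T, ncard_eq_sum_ncard_fiber]
    push_cast
    rw [Finset.mul_sum]
    refine Finset.sum_le_sum fun r₁ _ =>
      (hRatio_mul_ncard_le B {l₂ | (r₁, l₂) ∈ T}).trans (le_of_eq ?_)
    congr 2
    ext r₂
    simp only [T, Set.mem_ofPred_eq, Prod.exists]
    constructor
    · rintro ⟨l₂, ⟨l₁, hS, h₁⟩, h₂⟩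
      exact ⟨l₁, l₂, hS, h₁, h₂⟩
    · rintro ⟨l₁, l₂, hS, h₁, h₂⟩
      exact ⟨l₂, ⟨l₁, hS, h₁⟩, h₂⟩
  calc hRatio A * hRatio B * (S.ncard : ℚ) = hRatio B * (hRatio A * (S.ncard : ℚ)) := by ring
    _ ≤ hRatio B * (T.ncard : ℚ) := mul_le_mul_of_nonneg_left hA (hRatio_nonneg B)
    _ ≤ _ := hB

/-- Lemma 5: `h` is multiplicative with respect to the tensor product of
bipartite graphs. -/
theorem stmt8 (L1 R1 L2 R2 : Type) [Fintype L1] [Fintype R1] [Fintype L2] [Fintype R2]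
    [Nonempty L1] [Nonempty R1] [Nonempty L2] [Nonempty R2]
    (A : L1 → R1 → Prop) (B : L2 → R2 → Prop) :
    hRatio (fun (l : L1 × L2) (r : R1 × R2) => A l.1 r.1 ∧ B l.2 r.2) =
      hRatio A * hRatio B := by
  apply le_antisymm
  · obtain ⟨X, hX, hA⟩ := exists_hRatio_eq A
    obtain ⟨Y, hY, hB⟩ := exists_hRatio_eq B
    refine (hRatio_le _ (hX.product hY)).trans (le_of_eq ?_)
    have hN : {r : R1 × R2 | ∃ l ∈ X ×ˢ Y, A l.1 r.1 ∧ B l.2 r.2} =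
        {r | ∃ x ∈ X, A x r} ×ˢ {r | ∃ y ∈ Y, B y r} := by
      ext ⟨r₁, r₂⟩
      simp only [Finset.mem_product, Set.mem_ofPred_eq, Set.mem_prod, Prod.exists]
      grind
    rw [hA, hB, hN, Set.ncard_prod, Finset.card_product, div_mul_div_comm]
    push_cast
    rfl
  · obtain ⟨X, hX, h⟩ :=
      exists_hRatio_eq fun (l : L1 × L2) (r : R1 × R2) => A l.1 r.1 ∧ B l.2 r.2
    rw [h, le_div_iff₀ (by exact_mod_cast hX.card_pos)]
    simpa using hRatio_mul_hRatio_mul_ncard_le A B (X : Set (L1 × L2))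
end

section
/- Let L, R, E be finite types, let u : E → L and v : E → R, and let m be a positive integer. Then there exists a coloring c : E → Fin m such that for every x : L and all colors i, j : Fin m, the number of e with u e = x and c e = i differs from the number of e with u e = x and c e = j by at most 1, and likewise for every y : R and all colors i, j : Fin m, the number of e with v e = y and c e = i differs from the number of e with v e = y and c e = j by at most 1. -/
/-- A regular bipartite multigraph has a section of its edges forming a perfect matching. -/
theorem exists_perfect_matching_of_regular {E N : Type*} [Fintype E] [Fintype N]
    [DecidableEq N] (k : ℕ)
    (u v : E → N) (hu : ∀ x, (Finset.univ.filter fun e => u e = x).card = k + 1)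
    (hv : ∀ x, (Finset.univ.filter fun e => v e = x).card = k + 1) :
    ∃ s : N → E, (∀ x, u (s x) = x) ∧ Function.Bijective (v ∘ s) := by
  have hall : ∀ S : Finset N, S.card ≤
      (S.biUnion fun x => (Finset.univ.filter fun e => u e = x).image v).card := by
    intro S
    set T := S.biUnion fun x => (Finset.univ.filter fun e => u e = x).image v with hT
    have hS : (Finset.univ.filter fun e => u e ∈ S).card = S.card * (k + 1) := by
      rw [Finset.card_eq_sum_card_fiberwise (f := u) (t := S) (fun e he => by simpa using he)]
      rw [Finset.sum_const_nat]
      intro x hx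
      rw [← hu x, Finset.filter_filter]
      congr 1
      ext e
      simp only [Finset.mem_filter, Finset.mem_univ, true_and, and_iff_right_iff_imp]
      rintro rfl
      exact hx
    have hT' : (Finset.univ.filter fun e => v e ∈ T).card = T.card * (k + 1) := by
      rw [Finset.card_eq_sum_card_fiberwise (f := v) (t := T) (fun e he => by simpa using he)]
      rw [Finset.sum_const_nat]
      intro x hx
      rw [← hv x, Finset.filter_filter]
      congr 1
      ext e
      simp only [Finset.mem_filter, Finset.mem_univ, true_and, and_iff_right_iff_imp]
      rintro rfl
      exact hx
    have hle : (Finset.univ.filter fun e => u e ∈ S).card ≤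
        (Finset.univ.filter fun e => v e ∈ T).card := by
      apply Finset.card_le_card
      intro e he
      simp only [Finset.mem_filter, Finset.mem_univ, true_and] at he ⊢
      simp only [hT, Finset.mem_biUnion, Finset.mem_image, Finset.mem_filter, Finset.mem_univ,
        true_and]
      exact ⟨u e, he, e, rfl, rfl⟩
    rw [hS, hT'] at hle
    exact Nat.le_of_mul_le_mul_right hle (Nat.succ_pos k)
  obtain ⟨f, hf, hfm⟩ := (Finset.all_card_le_biUnion_card_iff_exists_injective _).mp hall
  simp only [Finset.mem_image, Finset.mem_filter, Finset.mem_univ, true_and] at hfm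
  choose s hs hvs using hfm
  refine ⟨s, hs, Finite.injective_iff_bijective.mp ?_⟩
  rwa [show v ∘ s = f from funext hvs]

theorem card_fiber_subtype_of_unique {E V : Type*} [Fintype E] [DecidableEq E]
    [DecidableEq V] (p : E → Prop) [DecidablePred p] (w : E → V)
    (x : V) (k : ℕ) (e₀ : E) (h : ∀ e, w e = x → (¬ p e ↔ e = e₀)) (h₀ : w e₀ = x)
    (hw : (Finset.univ.filter fun e => w e = x).card = k + 1) :
    (Finset.univ.filter fun e : {e // p e} => w e = x).card = k := by
  have hmap : (Finset.univ.filter fun e : {e // p e} => w e = x).map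
      (Function.Embedding.subtype p) = (Finset.univ.filter fun e => w e = x).erase e₀ := by
    ext e
    simp only [Finset.mem_map, Finset.mem_filter, Finset.mem_univ, true_and,
      Function.Embedding.subtype_apply, Subtype.exists, Finset.mem_erase]
    constructor
    · rintro ⟨a, ha, hax, rfl⟩
      exact ⟨fun hc => (h a hax).mpr hc ha, hax⟩
    · rintro ⟨hne, hx⟩
      exact ⟨e, by_contra fun hc => hne ((h e hx).mp hc), hx, rfl⟩
  rw [← Finset.card_map (Function.Embedding.subtype p), hmap,
    Finset.card_erase_of_mem (by simpa using h₀), hw, Nat.add_sub_cancel]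

/-- A `k`-regular bipartite multigraph has a proper edge coloring with `k` colors. -/
theorem exists_proper_edge_coloring_of_regular {N : Type*} [Fintype N] [DecidableEq N] (k : ℕ) :
    ∀ {E : Type*} [Fintype E] (u v : E → N),
      (∀ x, (Finset.univ.filter fun e => u e = x).card = k) →
      (∀ x, (Finset.univ.filter fun e => v e = x).card = k) →
      ∃ c : E → Fin k, (∀ e e', u e = u e' → c e = c e' → e = e') ∧
        (∀ e e', v e = v e' → c e = c e' → e = e') := by
  induction k with
  | zero =>
    intro E _ u v hu _
    have hE : IsEmpty E := ⟨fun e => by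
      have := Finset.card_eq_zero.mp (hu (u e))
      have he : e ∈ Finset.univ.filter fun e' => u e' = u e := by simp
      simp [this] at he⟩
    exact ⟨fun e => hE.elim e, fun e => hE.elim e, fun e => hE.elim e⟩
  | succ k ih =>
    intro E _ u v hu hv
    classical
    obtain ⟨s, hs, hbij⟩ := exists_perfect_matching_of_regular k u v hu hv
    obtain ⟨c, hcu, hcv⟩ := ih (E := {e // s (u e) ≠ e}) (fun e => u e) (fun e => v e)
      (fun x => card_fiber_subtype_of_unique (fun e => s (u e) ≠ e) u x k (s x)
        (fun e he => by rw [not_not, he, eq_comm]) (hs x) (hu x))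
      (fun y => by
        obtain ⟨x, rfl⟩ := hbij.2 y
        refine card_fiber_subtype_of_unique (fun e => s (u e) ≠ e) v _ k (s x)
          (fun e he => ?_) rfl (hv _)
        rw [not_not]
        constructor
        · intro h
          rw [← h] at he ⊢
          exact congrArg s (hbij.1 he)
        · rintro rfl
          rw [hs])
    refine ⟨fun e => if h : s (u e) = e then Fin.last k else (c ⟨e, h⟩).castSucc, ?_, ?_⟩
    · intro e e' huv hc
      dsimp only at hc
      split_ifs at hc with h h' h'
      · rw [← h, ← h', huv]
      · exact absurd hc.symm (Fin.castSucc_ne_last _)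
      · exact absurd hc (Fin.castSucc_ne_last _)
      · exact congrArg Subtype.val (hcu ⟨e, h⟩ ⟨e', h'⟩ huv (Fin.castSucc_injective k hc))
    · intro e e' huv hc
      dsimp only at hc
      split_ifs at hc with h h' h'
      · rw [← h, ← h'] at huv
        rw [← h, ← h', hbij.1 huv]
      · exact absurd hc.symm (Fin.castSucc_ne_last _)
      · exact absurd hc (Fin.castSucc_ne_last _)
      · exact congrArg Subtype.val (hcv ⟨e, h⟩ ⟨e', h'⟩ huv (Fin.castSucc_injective k hc))

/-- König's edge coloring theorem for bipartite multigraphs. -/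
theorem exists_proper_edge_coloring {E L R : Type*} [Fintype E] [Fintype L] [Fintype R]
    [DecidableEq L] [DecidableEq R] (m : ℕ)
    (u : E → L) (v : E → R) (hu : ∀ x, (Finset.univ.filter fun e => u e = x).card ≤ m)
    (hv : ∀ y, (Finset.univ.filter fun e => v e = y).card ≤ m) :
    ∃ c : E → Fin m, (∀ e e', u e = u e' → c e = c e' → e = e') ∧
      (∀ e e', v e = v e' → c e = c e' → e = e') := by
  let d : L ⊕ R → ℕ := Sum.elim (fun x => (Finset.univ.filter fun e => u e = x).card)
    (fun y => (Finset.univ.filter fun e => v e = y).card)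
  let P := E ⊕ E ⊕ (Σ z : L ⊕ R, Fin (m - d z))
  let U : P → L ⊕ R := Sum.elim (fun e => .inl (u e)) (Sum.elim (fun e => .inr (v e)) Sigma.fst)
  let V : P → L ⊕ R := Sum.elim (fun e => .inr (v e)) (Sum.elim (fun e => .inl (u e)) Sigma.fst)
  have hd : ∀ z, d z ≤ m := by
    rintro (x | y)
    · exact hu x
    · exact hv y
  have hU : ∀ z, (Finset.univ.filter fun e => U e = z).card = m := by
    intro z
    have hz := hd z
    rw [Finset.card_filter, Fintype.sum_sum_type, Fintype.sum_sum_type, Fintype.sum_sigma]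
    rcases z with x | y <;> simp [U] <;> simp [d] at hz ⊢ <;> omega
  have hV : ∀ z, (Finset.univ.filter fun e => V e = z).card = m := by
    intro z
    have hz := hd z
    rw [Finset.card_filter, Fintype.sum_sum_type, Fintype.sum_sum_type, Fintype.sum_sigma]
    rcases z with x | y <;> simp [V] <;> simp [d] at hz ⊢ <;> omega
  obtain ⟨c, hcu, hcv⟩ := exists_proper_edge_coloring_of_regular m U V hU hV
  exact ⟨fun e => c (.inl e),
    fun e e' h hc => Sum.inl_injective (hcu (.inl e) (.inl e') (congrArg Sum.inl h) hc),
    fun e e' h hc => Sum.inl_injective (hcv (.inl e) (.inl e') (congrArg Sum.inr h) hc)⟩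

/-- The edges at each vertex can be numbered consecutively, starting from zero. -/
theorem exists_fiber_ranking {E V : Type*} [Fintype E] [DecidableEq V] (w : E → V) :
    ∃ r : E → ℕ, (∀ e, r e < Fintype.card E) ∧
      (∀ e e', w e = w e' → r e = r e' → e = e') ∧
      ∀ x n, (∃ e, w e = x ∧ r e = n) ↔ n < (Finset.univ.filter fun e => w e = x).card := by
  have key : ∀ x, ∃ g : {e // w e = x} → ℕ, Function.Injective g ∧
      ∀ n, (∃ e, g e = n) ↔ n < (Finset.univ.filter fun e => w e = x).card := by
    intro x
    rw [← Fintype.card_subtype]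
    refine ⟨fun e => Fintype.equivFin _ e,
      Fin.val_injective.comp (Equiv.injective _), fun n => ⟨?_, ?_⟩⟩
    · rintro ⟨e, rfl⟩
      exact Fin.isLt _
    · intro hn
      exact ⟨(Fintype.equivFin _).symm ⟨n, hn⟩, by simp⟩
  choose g hg hgr using key
  refine ⟨fun e => g (w e) ⟨e, rfl⟩, fun e => ?_, ?_, fun x n => ?_⟩
  · exact ((hgr _ _).mp ⟨_, rfl⟩).trans_le (Finset.card_le_univ _)
  · have aux : ∀ x e e' (h : w e = x) (h' : w e' = x),
        g (w e) ⟨e, rfl⟩ = g (w e') ⟨e', rfl⟩ → e = e' := by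
      rintro _ e e' rfl h' heq
      have transport : ∀ y (hy : w e' = y), g (w e') ⟨e', rfl⟩ = g y ⟨e', hy⟩ := by
        rintro _ rfl
        rfl
      rw [transport _ h'] at heq
      exact congrArg Subtype.val (hg _ heq)
    exact fun e e' h => aux _ e e' h rfl
  · rw [← hgr x n]
    constructor
    · rintro ⟨e, rfl, he⟩
      exact ⟨_, he⟩
    · rintro ⟨⟨e, rfl⟩, he⟩
      exact ⟨e, rfl, he⟩

/-- A coloring that is injective on every block of `m` consecutive edges at a vertex uses each
color almost equally often there. -/
theorem card_color_le_card_color_add_one {E V : Type*} [Fintype E] [DecidableEq V]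
    (w : E → V) (r : E → ℕ)
    {m : ℕ} (c : E → Fin m)
    (hr : ∀ x n, (∃ e, w e = x ∧ r e = n) ↔ n < (Finset.univ.filter fun e => w e = x).card)
    (hc : ∀ e e', w e = w e' → r e / m = r e' / m → c e = c e' → e = e') (x : V) (i j : Fin m) :
    Nat.card {e : E | w e = x ∧ c e = i} ≤ Nat.card {e : E | w e = x ∧ c e = j} + 1 := by
  have hm : 0 < m := i.pos
  set d := (Finset.univ.filter fun e => w e = x).card
  have hcard : ∀ i, Nat.card {e : E | w e = x ∧ c e = i} =
      (Finset.univ.filter fun e => w e = x ∧ c e = i).card := by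
    intro i
    rw [Nat.card_eq_fintype_card, ← Fintype.card_subtype]
    rfl
  have upper : (Finset.univ.filter fun e => w e = x ∧ c e = i).card ≤ d / m + 1 := by
    rw [← Finset.card_range (d / m + 1)]
    apply Finset.card_le_card_of_injOn (fun e => r e / m)
    · intro e he
      simp only [Finset.coe_filter, Finset.mem_univ, true_and, Set.mem_ofPred_eq] at he
      simp only [Finset.coe_range, Set.mem_Iio, Nat.lt_succ_iff]
      exact Nat.div_le_div_right ((hr x _).mp ⟨e, he.1, rfl⟩).le
    · intro e he e' he' h
      simp only [Finset.coe_filter, Finset.mem_univ, true_and, Set.mem_ofPred_eq] at he he'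
      exact hc e e' (he.1.trans he'.1.symm) h (he.2.trans he'.2.symm)
  have lower : d / m ≤ (Finset.univ.filter fun e => w e = x ∧ c e = j).card := by
    rw [← Finset.card_range (d / m)]
    apply Finset.card_le_card_of_surjOn (fun e => r e / m)
    intro q hq
    simp only [Finset.coe_range, Set.mem_Iio] at hq
    have hblock : ∀ t : Fin m, ∃ e, w e = x ∧ r e = m * q + t := by
      intro t
      rw [hr]
      calc m * q + t < m * (q + 1) := by rw [mul_add_one]; exact Nat.add_lt_add_left t.isLt _
        _ ≤ m * (d / m) := Nat.mul_le_mul_left m hq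
        _ ≤ d := Nat.mul_div_le d m
    choose e hex her using hblock
    have hdiv : ∀ t, r (e t) / m = q := by
      intro t
      rw [her, Nat.mul_add_div hm, Nat.div_eq_of_lt t.isLt, add_zero]
    have hce : Function.Injective (c ∘ e) := by
      intro t t' h
      have h' := hc (e t) (e t') ((hex t).trans (hex t').symm)
        ((hdiv t).trans (hdiv t').symm) h
      have h'' := her t
      rw [h', her t'] at h''
      exact Fin.ext (Nat.add_left_cancel h'').symm
    obtain ⟨t, ht⟩ := Finite.injective_iff_surjective.mp hce j
    exact ⟨e t, by simpa using ⟨hex t, ht⟩, hdiv t⟩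
  rw [hcard, hcard]
  exact upper.trans (Nat.add_le_add_right lower 1)

theorem card_block_le {E V : Type*} [Fintype E] [DecidableEq V]
    (w : E → V) (r : E → ℕ) {m n : ℕ} (hm : 0 < m)
    (hinj : ∀ e e', w e = w e' → r e = r e' → e = e') (hn : ∀ e, r e / m < n)
    (x : V × Fin n) :
    (Finset.univ.filter fun e => (w e, (⟨r e / m, hn e⟩ : Fin n)) = x).card ≤ m := by
  conv_rhs => rw [← Finset.card_range m]
  apply Finset.card_le_card_of_injOn (fun e => r e % m)
  · intro e _
    simpa using Nat.mod_lt _ hm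
  · intro e he e' he' h
    simp only [Finset.coe_filter, Finset.mem_univ, true_and, Set.mem_ofPred_eq] at he he'
    have heq := he.trans he'.symm
    simp only [Prod.mk.injEq, Fin.mk.injEq] at heq
    refine hinj e e' heq.1 ?_
    have hmod : r e % m = r e' % m := h
    rw [← Nat.div_add_mod (r e) m, ← Nat.div_add_mod (r e') m, heq.2, hmod]

/-- Lemma 6: the edges of any bipartite multigraph can be colored in `m`
colors so that, at every vertex, any two colored degrees differ by at most 1. -/
theorem stmt9 (L R E : Type) [Fintype L] [Fintype R] [Fintype E]
    (u : E → L) (v : E → R) (m : ℕ) (hm : 0 < m) :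
    ∃ c : E → Fin m,
      (∀ (x : L) (i j : Fin m),
        Nat.card {e : E | u e = x ∧ c e = i} ≤ Nat.card {e : E | u e = x ∧ c e = j} + 1) ∧
      (∀ (y : R) (i j : Fin m),
        Nat.card {e : E | v e = y ∧ c e = i} ≤ Nat.card {e : E | v e = y ∧ c e = j} + 1) := by
  classical
  obtain ⟨r, hr, hri, hrs⟩ := exists_fiber_ranking u
  obtain ⟨t, ht, hti, hts⟩ := exists_fiber_ranking v
  have hr' : ∀ e, r e / m < Fintype.card E := fun e => (Nat.div_le_self _ _).trans_lt (hr e)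
  have ht' : ∀ e, t e / m < Fintype.card E := fun e => (Nat.div_le_self _ _).trans_lt (ht e)
  obtain ⟨c, hcu, hcv⟩ := exists_proper_edge_coloring m
    (fun e => (u e, (⟨r e / m, hr' e⟩ : Fin (Fintype.card E))))
    (fun e => (v e, (⟨t e / m, ht' e⟩ : Fin (Fintype.card E))))
    (card_block_le u r hm hri hr') (card_block_le v t hm hti ht')
  exact ⟨c,
    card_color_le_card_color_add_one u r c hrs
      fun e e' h h' => hcu e e' (Prod.ext h (Fin.ext h')),
    card_color_le_card_color_add_one v t c hts
      fun e e' h h' => hcv e e' (Prod.ext h (Fin.ext h'))⟩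
end

section
/- Let n, k be positive integers, m a natural number, and ε an integer with (k : ℤ) = m·n + ε and |ε| < n. Let E be a finite type of cardinality n·k, and let u : E → Fin n and v : E → Fin k be such that every fiber of u has exactly k elements and every fiber of v has exactly n elements. Then there exists w : E → Fin n such that: (a) for every (f, r) : Fin n × Fin k there is exactly one e : E with w e = f and v e = r; and (b) for every x : Fin n and f : Fin n, the number of e : E with u e = x and w e = f equals (as an integer) either m or m + sign(ε), where sign(ε) ∈ {-1, 0, 1} is the sign of ε. -/
open Finset in
/-- A regular bipartite multigraph of positive degree has a perfect matching. -/
theorem exists_perfect_matching_of_regular_s10 {E A B : Type} [Fintype A] [Fintype B]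
    [DecidableEq A] [DecidableEq B] (a : E → A) (b : E → B) (n : ℕ) (S : Finset E)
    (ha : ∀ x, #{e ∈ S | a e = x} = n + 1) (hb : ∀ y, #{e ∈ S | b e = y} = n + 1) :
    ∃ M : A → E, (∀ x, M x ∈ S) ∧ (∀ x, a (M x) = x) ∧ Function.Bijective (b ∘ M) := by
  classical
  have hcard : Fintype.card A = Fintype.card B := by
    have h1 := card_eq_sum_card_fiberwise (f := a) (s := S) (t := univ) (by simp)
    have h2 := card_eq_sum_card_fiberwise (f := b) (s := S) (t := univ) (by simp)
    simp only [ha, hb, sum_const, card_univ, smul_eq_mul] at h1 h2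
    exact Nat.eq_of_mul_eq_mul_right n.succ_pos (h1.symm.trans h2)
  obtain ⟨m, hm, hmt⟩ := (Finset.all_card_le_biUnion_card_iff_exists_injective
    (fun x => ({e ∈ S | a e = x}).image b)).1 (by
      intro s
      set t := s.biUnion (fun x => ({e ∈ S | a e = x}).image b) with ht
      have h1 : #{e ∈ S | a e ∈ s} = #s * (n + 1) := by
        rw [card_eq_sum_card_fiberwise (f := a) (t := s) (by intro e; simp), ← smul_eq_mul,
          ← sum_const]
        refine sum_congr rfl fun x hx => ?_
        rw [← ha x, filter_filter]
        congr 1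
        ext e
        simp only [mem_filter]
        constructor
        · tauto
        · rintro ⟨h, rfl⟩; exact ⟨h, hx, rfl⟩
      have h2 : #{e ∈ S | b e ∈ t} = #t * (n + 1) := by
        rw [card_eq_sum_card_fiberwise (f := b) (t := t) (by intro e; simp), ← smul_eq_mul,
          ← sum_const]
        refine sum_congr rfl fun x hx => ?_
        rw [← hb x, filter_filter]
        congr 1
        ext e
        simp only [mem_filter]
        constructor
        · tauto
        · rintro ⟨h, rfl⟩; exact ⟨h, hx, rfl⟩
      have h3 : #{e ∈ S | a e ∈ s} ≤ #{e ∈ S | b e ∈ t} := by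
        refine card_le_card fun e he => ?_
        simp only [mem_filter] at he ⊢
        refine ⟨he.1, ?_⟩
        rw [ht, mem_biUnion]
        exact ⟨a e, he.2, mem_image.2 ⟨e, by simp [he.1], rfl⟩⟩
      rw [h1, h2] at h3
      exact Nat.le_of_mul_le_mul_right h3 n.succ_pos)
  have hM : ∀ x, ∃ e, e ∈ S ∧ a e = x ∧ b e = m x := by
    intro x
    obtain ⟨e, he, hbe⟩ := mem_image.1 (hmt x)
    exact ⟨e, (mem_filter.1 he).1, (mem_filter.1 he).2, hbe⟩
  choose M hMS hMa hMb using hM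
  refine ⟨M, hMS, hMa, ?_⟩
  rw [show b ∘ M = m from funext hMb]
  exact (Fintype.bijective_iff_injective_and_card m).2 ⟨hm, hcard⟩

open Finset in
/-- Removing a transversal of the fibers of `a` from `S` lowers each fiber's size by one. -/
theorem card_fiber_sdiff_of_unique {E A : Type} [DecidableEq A] [DecidableEq E]
    (a : E → A) (n : ℕ) (S T : Finset E) (hTS : T ⊆ S)
    (hT : ∀ x, ∃! e, e ∈ T ∧ a e = x)
    (ha : ∀ x, #{e ∈ S | a e = x} = n + 1) (x : A) : #{e ∈ S \ T | a e = x} = n := by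
  obtain ⟨e, ⟨he, hex⟩, huniq⟩ := hT x
  have : {e ∈ S \ T | a e = x} = ({e ∈ S | a e = x}).erase e := by
    ext e'
    simp only [mem_filter, mem_sdiff, mem_erase]
    constructor
    · rintro ⟨⟨h1, h2⟩, h3⟩
      exact ⟨fun h => h2 (h ▸ he), h1, h3⟩
    · rintro ⟨h1, h2, h3⟩
      exact ⟨⟨h2, fun h => h1 (huniq e' ⟨h, h3⟩)⟩, h3⟩
  rw [this, card_erase_of_mem (by simp [hTS he, hex]), ha, Nat.add_sub_cancel]

/-- Extending a colouring of `S \ T` by a new colour on a transversal `T`. -/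
theorem existsUnique_extend_color {E A : Type} [DecidableEq E]
    (a : E → A) (n : ℕ) (S T : Finset E) (hTS : T ⊆ S)
    (hT : ∀ x, ∃! e, e ∈ T ∧ a e = x) (w : E → ℕ) (hwn : ∀ e ∈ S \ T, w e < n)
    (hw : ∀ f < n, ∀ x, ∃! e, e ∈ S \ T ∧ w e = f ∧ a e = x) (f : ℕ) (hf : f < n + 1) (x : A) :
    ∃! e, e ∈ S ∧ (if e ∈ T then n else w e) = f ∧ a e = x := by
  rcases Nat.lt_succ_iff_lt_or_eq.1 hf with h | rfl
  · obtain ⟨e, ⟨he, hwe, hae⟩, huniq⟩ := hw f h x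
    rw [Finset.mem_sdiff] at he
    refine ⟨e, ⟨he.1, by simp [he.2, hwe], hae⟩, ?_⟩
    rintro e' ⟨h1, h2, h3⟩
    by_cases h4 : e' ∈ T
    · simp only [h4, if_true] at h2; omega
    · simp only [h4, if_false] at h2
      exact huniq e' ⟨Finset.mem_sdiff.2 ⟨h1, h4⟩, h2, h3⟩
  · obtain ⟨e, ⟨he, hae⟩, huniq⟩ := hT x
    refine ⟨e, ⟨hTS he, by simp [he], hae⟩, ?_⟩
    rintro e' ⟨h1, h2, h3⟩
    by_cases h4 : e' ∈ T
    · exact huniq e' ⟨h4, h3⟩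
    · simp only [h4, if_false] at h2
      have := hwn e' (Finset.mem_sdiff.2 ⟨h1, h4⟩)
      omega

open Finset in
/-- König's edge-colouring theorem for `n`-regular bipartite multigraphs. -/
theorem exists_edge_coloring_of_regular {E A B : Type} [Fintype A] [Fintype B]
    [DecidableEq A] [DecidableEq B] (a : E → A) (b : E → B) (n : ℕ) (S : Finset E)
    (ha : ∀ x, #{e ∈ S | a e = x} = n) (hb : ∀ y, #{e ∈ S | b e = y} = n) :
    ∃ w : E → ℕ, (∀ e ∈ S, w e < n) ∧
      (∀ f < n, ∀ x, ∃! e, e ∈ S ∧ w e = f ∧ a e = x) ∧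
      (∀ f < n, ∀ y, ∃! e, e ∈ S ∧ w e = f ∧ b e = y) := by
  classical
  induction n generalizing S with
  | zero =>
    refine ⟨fun _ => 0, fun e he => ?_, by simp, by simp⟩
    have hempty := filter_eq_empty_iff.1 (card_eq_zero.1 (ha (a e)))
    exact absurd rfl (hempty he)
  | succ n ih =>
    obtain ⟨M, hMS, hMa, hMb⟩ := exists_perfect_matching_of_regular_s10 a b n S ha hb
    have hTS : univ.image M ⊆ S := by
      intro e he
      obtain ⟨x, -, rfl⟩ := mem_image.1 he
      exact hMS x
    have hTa : ∀ x, ∃! e, e ∈ univ.image M ∧ a e = x := by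
      intro x
      refine ⟨M x, ⟨by simp, hMa x⟩, ?_⟩
      rintro e ⟨he, rfl⟩
      obtain ⟨x, -, rfl⟩ := mem_image.1 he
      rw [hMa]
    have hTb : ∀ y, ∃! e, e ∈ univ.image M ∧ b e = y := by
      intro y
      obtain ⟨x, hx⟩ := hMb.2 y
      refine ⟨M x, ⟨by simp, hx⟩, ?_⟩
      rintro e ⟨he, hey⟩
      obtain ⟨x', -, rfl⟩ := mem_image.1 he
      rw [hMb.1 (hey.trans hx.symm : (b ∘ M) x' = (b ∘ M) x)]
    obtain ⟨w, hwn, hwa, hwb⟩ := ih (S \ univ.image M)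
      (card_fiber_sdiff_of_unique a n S _ hTS hTa ha)
      (card_fiber_sdiff_of_unique b n S _ hTS hTb hb)
    refine ⟨fun e => if e ∈ univ.image M then n else w e, fun e he => ?_,
      existsUnique_extend_color a n S _ hTS hTa w hwn hwa,
      existsUnique_extend_color b n S _ hTS hTb w hwn hwb⟩
    by_cases h : e ∈ univ.image M
    · simp only [h, if_true]; omega
    · have := hwn e (mem_sdiff.2 ⟨he, h⟩)
      simp only [h, if_false]; omega

/-- If all fibers of `u` have `k` elements, each can be numbered by `0, …, k - 1`. -/
theorem exists_fiber_numbering {E X : Type} [Finite E] (u : E → X) (k : ℕ)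
    (hu : ∀ x, Nat.card {e : E | u e = x} = k) :
    ∃ i : E → ℕ, (∀ e, i e < k) ∧ (∀ e e', u e = u e' → i e = i e' → e = e') ∧
      ∀ x, ∀ j < k, ∃ e, u e = x ∧ i e = j := by
  let eq : ∀ x, {e : E | u e = x} ≃ Fin k := fun x => Finite.equivFinOfCardEq (hu x)
  have key : ∀ x (e : {e : E | u e = x}), eq (u e.1) ⟨e.1, rfl⟩ = eq x e := by
    rintro x ⟨e, rfl⟩; rfl
  refine ⟨fun e => eq (u e) ⟨e, rfl⟩, fun e => (eq (u e) ⟨e, rfl⟩).2, ?_, ?_⟩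
  · intro e e' h h'
    have h2 := key (u e') ⟨e, h⟩
    have h3 := (eq (u e')).injective (h2.symm.trans (Fin.ext h'))
    exact congrArg Subtype.val h3
  · intro x j hj
    exact ⟨((eq x).symm ⟨j, hj⟩).1, ((eq x).symm ⟨j, hj⟩).2, by
      simp only [key x, Equiv.apply_symm_apply]⟩

open Finset in
/-- De Werra's equitable edge colouring: if left degrees are `k` and right degrees are `n`, some
`n`-colouring of the edges is proper at every right vertex, and at every left vertex uses each
colour either `k / n` or `⌈k / n⌉` times. -/
theorem exists_equitable_coloring {E X Y : Type} [Fintype E] [Fintype X] [Fintype Y]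
    [DecidableEq X] [DecidableEq Y] (n k : ℕ) (hn : 0 < n) (hX : Fintype.card X = n)
    (u : E → X) (v : E → Y)
    (hu : ∀ x, Nat.card {e : E | u e = x} = k) (hv : ∀ y, Nat.card {e : E | v e = y} = n) :
    ∃ w : E → Fin n, (∀ f y, ∃! e, w e = f ∧ v e = y) ∧
      ∀ x f, k / n ≤ Nat.card {e : E | u e = x ∧ w e = f} ∧
        Nat.card {e : E | u e = x ∧ w e = f} ≤ k / n + 1 ∧
        (k % n = 0 → Nat.card {e : E | u e = x ∧ w e = f} ≤ k / n) := by
  classical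
  obtain ⟨i, hik, hinj, hisurj⟩ := exists_fiber_numbering u k hu
  have hdm := Nat.div_add_mod k n
  have hmod := Nat.mod_lt k hn
  set q := k / n with hq
  set r := k % n with hr
  let U : E ⊕ (X × Fin (n - r)) → X := Sum.elim u Prod.fst
  let I : E ⊕ (X × Fin (n - r)) → ℕ := Sum.elim i (fun p => k + p.2)
  have hIlt : ∀ e, I e < n * (q + 1) := by
    rw [mul_add]
    rintro (e | ⟨x, j⟩)
    · have := hik e; simp only [I, Sum.elim_inl]; omega
    · have := j.2; simp only [I, Sum.elim_inr]; omega
  have hUI : ∀ e e', U e = U e' → I e = I e' → e = e' := by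
    rintro (e | ⟨x, j⟩) (e' | ⟨x', j'⟩) h h'
    · exact congrArg _ (hinj e e' h h')
    · have := hik e; simp only [I, Sum.elim_inl, Sum.elim_inr] at h'; omega
    · have := hik e'; simp only [I, Sum.elim_inl, Sum.elim_inr] at h'; omega
    · simp only [U, I, Sum.elim_inr] at h h'
      rw [h, Fin.ext (by omega : (j : ℕ) = j')]
  have hUIsurj : ∀ x, ∀ j < n * (q + 1), ∃ e, U e = x ∧ I e = j := by
    intro x j hj
    rw [mul_add] at hj
    by_cases h : j < k
    · obtain ⟨e, h1, h2⟩ := hisurj x j h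
      exact ⟨Sum.inl e, h1, h2⟩
    · exact ⟨Sum.inr (x, ⟨j - k, by omega⟩), rfl, by simp only [I, Sum.elim_inr]; omega⟩
  let a : E ⊕ (X × Fin (n - r)) → X × Fin (q + 1) :=
    fun e => (U e, ⟨I e / n, Nat.div_lt_of_lt_mul (hIlt e)⟩)
  let b : E ⊕ (X × Fin (n - r)) → Y ⊕ Fin (n - r) := Sum.map v Prod.snd
  have ha : ∀ p, #{e ∈ univ | a e = p} = n := by
    rintro ⟨x, g⟩
    have hcard : #(Ico (g * n) (g * n + n)) = n := by simp
    refine Eq.trans (card_bij (fun e _ => I e) ?_ ?_ ?_) hcard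
    · intro e he
      simp only [a, mem_filter, mem_univ, true_and, Prod.mk.injEq, Fin.ext_iff] at he
      rw [mem_Ico, ← he.2]
      exact ⟨Nat.div_mul_le_self _ _, Nat.lt_div_mul_add hn⟩
    · intro e he e' he' h
      simp only [a, mem_filter, mem_univ, true_and, Prod.mk.injEq] at he he'
      exact hUI e e' (he.1.trans he'.1.symm) h
    · intro j hj
      rw [mem_Ico] at hj
      obtain ⟨e, h1, h2⟩ := hUIsurj x j (by
        have := Nat.mul_le_mul_right n (Nat.succ_le_of_lt g.2)
        rw [Nat.succ_mul] at this
        rw [mul_comm]; omega)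
      refine ⟨e, ?_, h2⟩
      simp only [a, mem_filter, mem_univ, true_and, Prod.mk.injEq, Fin.ext_iff]
      refine ⟨h1, ?_⟩
      rw [h2]
      exact Nat.div_eq_of_lt_le hj.1 (by rw [Nat.succ_mul]; exact hj.2)
  have hb : ∀ y, #{e ∈ univ | b e = y} = n := by
    rintro (y | j)
    · have h := hv y
      rw [Nat.subtype_card {e | v e = y} (by simp)] at h
      refine (congrArg card ?_).trans ((card_map Function.Embedding.inl).trans h)
      ext (e | e) <;> simp [b]
    · refine Eq.trans (Eq.symm (card_bij (fun x _ => Sum.inr (x, j)) ?_ ?_ ?_))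
        (card_univ.trans hX)
      · intro x _; simp [b]
      · intro x _ x' _ h; simpa using h
      · rintro (e | ⟨x, j'⟩) h
        · simp [b] at h
        · simp only [b, mem_filter, mem_univ, true_and, Sum.map_inr, Sum.inr.injEq] at h
          exact ⟨x, mem_univ _, by rw [h]⟩
  obtain ⟨w, hwn, hwa, hwb⟩ := exists_edge_coloring_of_regular a b n univ ha hb
  refine ⟨fun e => ⟨w (Sum.inl e), hwn _ (mem_univ _)⟩, fun f y => ?_, fun x f => ?_⟩
  · obtain ⟨e, ⟨-, h1, h2⟩, huniq⟩ := hwb f f.2 (Sum.inl y)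
    rcases e with e | e
    · refine ⟨e, ⟨Fin.ext h1, Sum.inl.inj h2⟩, ?_⟩
      rintro e' ⟨h3, h4⟩
      exact Sum.inl.inj (huniq (Sum.inl e')
        ⟨mem_univ _, congrArg Fin.val h3, congrArg Sum.inl h4⟩)
    · simp [b] at h2
  · set C : Finset E := {e | u e = x ∧ w (Sum.inl e) = f} with hC
    have hmem : ∀ e, e ∈ C ↔ u e = x ∧ w (Sum.inl e) = f := by
      intro e; simp [hC]
    rw [Nat.subtype_card C (by simp [hmem, Fin.ext_iff])]
    have hCinj : Set.InjOn (fun e => i e / n) C := by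
      intro e he e' he' h
      obtain ⟨h1, h2⟩ := (hmem e).1 he
      obtain ⟨h3, h4⟩ := (hmem e').1 he'
      have h5 : a (Sum.inl e') = a (Sum.inl e) :=
        Prod.ext (h3.trans h1.symm) (Fin.ext h.symm)
      exact Sum.inl.inj ((hwa f f.2 (a (Sum.inl e))).unique
        ⟨mem_univ _, h2, rfl⟩ ⟨mem_univ _, h4, h5⟩)
    rw [← card_image_of_injOn hCinj]
    refine ⟨?_, ?_, fun hr0 => ?_⟩
    · conv_lhs => rw [← card_range q]
      refine card_le_card fun g hg => ?_
      rw [mem_range] at hg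
      obtain ⟨e, ⟨-, h1, h2⟩, -⟩ := hwa f f.2 (x, ⟨g, by omega⟩)
      simp only [a, Prod.mk.injEq, Fin.ext_iff] at h2
      rcases e with e | ⟨x', j⟩
      · exact mem_image.2 ⟨e, (hmem e).2 ⟨h2.1, h1⟩, h2.2⟩
      · have h3 : q ≤ (k + j) / n := Nat.div_le_div_right (Nat.le_add_right k j)
        have h4 : (k + j) / n = g := h2.2
        omega
    · conv_rhs => rw [← card_range (q + 1)]
      refine card_le_card fun g hg => ?_
      obtain ⟨e, -, rfl⟩ := mem_image.1 hg
      exact mem_range.2 (Nat.div_lt_of_lt_mul (hIlt (Sum.inl e)))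
    · conv_rhs => rw [← card_range q]
      refine card_le_card fun g hg => ?_
      obtain ⟨e, -, rfl⟩ := mem_image.1 hg
      have := hik e
      exact mem_range.2 (Nat.div_lt_of_lt_mul (by omega))


/-- Lemma 7: given a biregular bipartite labeled multigraph with parts of
sizes `n` and `k`, `k = m*n + ε`, `|ε| < n`, there is a coloring `w : E → Fin n` such that
`[w, v]` is the all-ones matrix and all entries of `[u, w]` equal `m` or `m + sign ε`. -/
theorem stmt10 (n k : ℕ) (hn : 0 < n) (hk : 0 < k) (m : ℕ) (ε : ℤ)
    (hkval : (k : ℤ) = m * n + ε) (hε : |ε| < n)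
    (E : Type) [Fintype E] (hE : Fintype.card E = n * k)
    (u : E → Fin n) (v : E → Fin k)
    (hu : ∀ x : Fin n, Nat.card {e : E | u e = x} = k)
    (hv : ∀ y : Fin k, Nat.card {e : E | v e = y} = n) :
    ∃ w : E → Fin n,
      (∀ (f : Fin n) (r : Fin k), ∃! e : E, w e = f ∧ v e = r) ∧
      (∀ (x f : Fin n),
        (Nat.card {e : E | u e = x ∧ w e = f} : ℤ) = m ∨
        (Nat.card {e : E | u e = x ∧ w e = f} : ℤ) = m + ε.sign) := by
  obtain ⟨w, hw, hcount⟩ := exists_equitable_coloring n k hn (Fintype.card_fin n) u v hu hv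
  refine ⟨w, hw, fun x f => ?_⟩
  obtain ⟨h1, h2, h3⟩ := hcount x f
  generalize Nat.card {e : E | u e = x ∧ w e = f} = c at h1 h2 h3 ⊢
  have hε' := abs_lt.1 hε
  have hn' : (0 : ℤ) < n := by exact_mod_cast hn
  rcases lt_trichotomy ε 0 with h | rfl | h
  · have hq : (k : ℤ) / n = m - 1 := by
      rw [Int.ediv_eq_iff_of_pos hn']
      constructor <;> nlinarith
    rw [Int.sign_eq_neg_one_of_neg h]
    omega
  · have hkm : k = m * n := by exact_mod_cast (by simpa using hkval : (k : ℤ) = m * n)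
    have hq : k / n = m := by rw [hkm, Nat.mul_div_cancel _ hn]
    have hr : k % n = 0 := by rw [hkm, Nat.mul_mod_left]
    have := h3 hr
    left; omega
  · have hq : (k : ℤ) / n = m := by
      rw [Int.ediv_eq_iff_of_pos hn']
      constructor <;> nlinarith
    rw [Int.sign_eq_one_of_pos h]
    omega
end

section
/- Let n > 2 and k be positive integers, m a natural number, and ε ∈ {-2, 2} with (k : ℤ) = m·n + ε. Let E be a finite type of cardinality n·k, and let u : E → Fin n and v : E → Fin k be such that every fiber of u has exactly k elements and every fiber of v has exactly n elements. Then there exists w : E → Fin n such that: (a) for every (f, r) : Fin n × Fin k there is exactly one e : E with w e = f and v e = r; (b) for every x : Fin n and f : Fin n, the number of e : E with u e = x and w e = f equals (as an integer) either m or m + sign(ε); and (c) the simple graph on the vertex type (Fin n) ⊕ (Fin n) in which Sum.inl x is adjacent to Sum.inr f iff the number of e : E with u e = x and w e = f equals m + sign(ε) (and there are no other adjacencies) is connected. -/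
open Finset in
/-- In a family of arcs `s r ⟶ t r`, a vertex with positive excess is joined by a trail `S`
to a vertex with negative excess. -/
theorem exists_trail_to_neg_excess {R L : Type*} [DecidableEq R] [DecidableEq L] (s t : R → L)
    (T : Finset R) (x : L)
    (hx : 0 < ∑ r ∈ T, ((if s r = x then 1 else 0) - (if t r = x then 1 else 0) : ℤ)) :
    ∃ (y : L) (S : Finset R), S ⊆ T ∧
      ∑ r ∈ T, ((if s r = y then 1 else 0) - (if t r = y then 1 else 0) : ℤ) < 0 ∧
      ∀ z, ∑ r ∈ S, ((if s r = z then 1 else 0) - (if t r = z then 1 else 0) : ℤ) =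
        (if z = x then 1 else 0) - (if z = y then 1 else 0) := by
  induction T using Finset.strongInduction generalizing x with
  | H T ih =>
    obtain ⟨r₀, hr₀, hpos⟩ := exists_lt_of_sum_lt (sum_const_zero.trans_lt hx)
    have hs : s r₀ = x := by
      by_contra h
      rw [if_neg h] at hpos
      split_ifs at hpos <;> omega
    subst hs
    have hT : ∀ z, _ = ∑ r ∈ T, ((if s r = z then 1 else 0) - (if t r = z then 1 else 0) : ℤ) :=
      fun z => add_sum_erase T
        (fun r => ((if s r = z then 1 else 0) - (if t r = z then 1 else 0) : ℤ)) hr₀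
    simp only [← hT] at hx ⊢
    by_cases h : 0 < ∑ r ∈ T.erase r₀,
        ((if s r = t r₀ then 1 else 0) - (if t r = t r₀ then 1 else 0) : ℤ)
    · obtain ⟨y, S, hST, hy, hS⟩ := ih _ (erase_ssubset hr₀) _ h
      have hyt : t r₀ ≠ y := by rintro rfl; omega
      refine ⟨y, insert r₀ S, insert_subset hr₀ (hST.trans (erase_subset _ _)), ?_, fun z => ?_⟩
      · by_cases hy' : s r₀ = y
        · subst hy'; omega
        · simpa [hy', hyt] using hy
      · rw [sum_insert fun h => notMem_erase r₀ T (hST h), hS]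
        simp only [eq_comm (a := z)]
        ring
    · refine ⟨t r₀, {r₀}, by simpa, ?_, fun z => by
        rw [sum_singleton]; simp only [eq_comm (a := z)]⟩
      have hne : s r₀ ≠ t r₀ := by
        intro h'
        rw [← h'] at h hx
        simp only [if_true] at hx
        omega
      simp only [hne, if_false, if_true]
      omega

/-- The number of positions `r` at which the vertex `x` receives color `f`, when the slots
`U · r` at each position are colored according to the permutation `σ r`. -/
def colorCount {F R L : Type*} [Fintype R] [DecidableEq L] (U : F → R → L)
    (σ : R → Equiv.Perm F) (x : L) (f : F) : ℤ :=
  ∑ r, if U (σ r f) r = x then 1 else 0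

section colorCount

variable {F R L : Type*} [Fintype R] [DecidableEq L] (U : F → R → L)

theorem sum_colorCount_left [Fintype L] (σ : R → Equiv.Perm F) (f : F) :
    ∑ x, colorCount U σ x f = Fintype.card R := by
  unfold colorCount
  rw [Finset.sum_comm]
  simp

theorem sum_colorCount_right [Fintype F] (σ : R → Equiv.Perm F) (x : L) :
    ∑ f, colorCount U σ x f = ∑ r, ∑ f, if U f r = x then 1 else 0 := by
  unfold colorCount
  rw [Finset.sum_comm]
  exact Finset.sum_congr rfl fun r _ =>
    Equiv.sum_comp (σ r) fun f => if U f r = x then (1 : ℤ) else 0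

theorem exists_colorCount_switch [DecidableEq F] (σ : R → Equiv.Perm F) {x : L} {f f' : F}
    (h : colorCount U σ x f' < colorCount U σ x f) :
    ∃ (y : L) (σ' : R → Equiv.Perm F), colorCount U σ y f < colorCount U σ y f' ∧
      ∀ z g, colorCount U σ' z g = colorCount U σ z g +
        ((if z = y then 1 else 0) - (if z = x then 1 else 0)) *
        ((if g = f then 1 else 0) - (if g = f' then 1 else 0)) := by
  classical
  have hff : f ≠ f' := by rintro rfl; exact lt_irrefl _ h
  obtain ⟨y, S, -, hy, hS⟩ := exists_trail_to_neg_excess (fun r => U (σ r f) r)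
    (fun r => U (σ r f') r) Finset.univ x (by
      rw [Finset.sum_sub_distrib]; exact sub_pos.mpr h)
  rw [Finset.sum_sub_distrib] at hy
  refine ⟨y, fun r => if r ∈ S then σ r * Equiv.swap f f' else σ r, sub_neg.mp hy, fun z g => ?_⟩
  rw [← sub_eq_iff_eq_add']
  unfold colorCount
  rw [← Finset.sum_sub_distrib]
  have key : ∀ r, ((if U ((if r ∈ S then σ r * Equiv.swap f f' else σ r) g) r = z then 1 else 0)
      - (if U (σ r g) r = z then 1 else 0) : ℤ) = if r ∈ S then
      ((if U (σ r f) r = z then 1 else 0) - (if U (σ r f') r = z then 1 else 0)) *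
      ((if g = f' then 1 else 0) - (if g = f then 1 else 0)) else 0 := by
    intro r
    by_cases hr : r ∈ S
    · simp only [hr, if_true, Equiv.Perm.mul_apply]
      by_cases h1 : g = f
      · subst h1; simp [hff]
      · by_cases h2 : g = f'
        · subst h2; simp [h1]
        · simp [h1, h2, Equiv.swap_apply_of_ne_of_ne]
    · simp [hr]
  rw [Finset.sum_congr rfl fun r _ => key r, ← Finset.sum_filter, ← Finset.sum_mul,
    Finset.filter_mem_eq_inter, Finset.univ_inter, hS]
  ring

theorem exists_colorCount_le_add_one [Fintype F] [Fintype L] :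
    ∃ σ : R → Equiv.Perm F, ∀ x f f', colorCount U σ x f ≤ colorCount U σ x f' + 1 := by
  classical
  obtain ⟨σ, hσ⟩ := Finite.exists_min
    fun σ : R → Equiv.Perm F => ∑ x, ∑ f, colorCount U σ x f ^ 2
  refine ⟨σ, fun x f f' => ?_⟩
  by_contra! hlt
  have hff : f ≠ f' := by rintro rfl; linarith
  obtain ⟨y, σ', hy, hσ'⟩ := exists_colorCount_switch U σ (x := x) (f := f) (f' := f') (by linarith)
  have hxy : y ≠ x := by rintro rfl; linarith
  have key : ∑ z, ∑ g, colorCount U σ' z g ^ 2 = ∑ z, ∑ g, colorCount U σ z g ^ 2 +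
      2 * (colorCount U σ y f - colorCount U σ y f' - colorCount U σ x f + colorCount U σ x f')
      + 4 := by
    have e : ∀ z g, colorCount U σ' z g ^ 2 = colorCount U σ z g ^ 2 +
        (if z = y then ((if g = f then 2 * colorCount U σ z g + 1 else 0) +
          (if g = f' then - 2 * colorCount U σ z g + 1 else 0)) else 0) +
        (if z = x then ((if g = f then - 2 * colorCount U σ z g + 1 else 0) +
          (if g = f' then 2 * colorCount U σ z g + 1 else 0)) else 0) := by
      intro z g
      rw [hσ']
      split_ifs <;> first | (exfalso; simp_all; done) | ring
    simp only [e, Finset.sum_add_distrib, Finset.sum_ite_irrel, Finset.sum_ite_eq',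
      Finset.sum_const_zero, Finset.mem_univ, if_true]
    ring
  have := hσ σ'
  simp only [key] at this
  linarith

end colorCount

theorem natCard_setOf {α : Type*} [Fintype α] (p : α → Prop) [DecidablePred p] :
    Nat.card {x | p x} = (Finset.univ.filter p).card :=
  Nat.subtype_card _ (by simp)

open Finset in
/-- In a 2-regular bipartite relation, no pair of vertex sets has a single boundary edge. -/
theorem false_of_single_boundary_edge {L F : Type*} [Fintype L] [Fintype F] {a : L → F → Prop}
    (hrow : ∀ x, Nat.card {f | a x f} = 2) (hcol : ∀ f, Nat.card {x | a x f} = 2)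
    {P : Set L} {Q : Set F} {x₀ : L} {f₀ : F} (hx₀ : x₀ ∈ P) (hf₀ : f₀ ∉ Q) (h₀ : a x₀ f₀)
    (hP : ∀ x ∈ P, ∀ f, a x f → (x = x₀ → f ≠ f₀) → f ∈ Q)
    (hQ : ∀ f ∈ Q, ∀ x, a x f → x ∈ P) : False := by
  classical
  have hrow' : ∀ x, #{f | a x f} = 2 := fun x => by
    rw [← hrow x, natCard_setOf]
  have hcol' : ∀ f, #{x | a x f} = 2 := fun f => by
    rw [← hcol f, natCard_setOf]
  have h1 : #{p : L × F | p.1 ∈ P ∧ a p.1 p.2} = 2 * #{x | x ∈ P} := by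
    rw [card_eq_sum_card_fiberwise (f := Prod.fst) (t := {x | x ∈ P})
      (fun p hp => by simp_all), mul_comm]
    refine sum_const_nat fun x hx => ?_
    rw [← hrow' x]
    refine card_nbij' Prod.snd (fun f => (x, f)) ?_ ?_ ?_ ?_ <;>
      simp_all [Set.MapsTo, Set.LeftInvOn]
    all_goals grind
  have h2 : #{p : L × F | p.2 ∈ Q ∧ a p.1 p.2} = 2 * #{f | f ∈ Q} := by
    rw [card_eq_sum_card_fiberwise (f := Prod.snd) (t := {f | f ∈ Q})
      (fun p hp => by simp_all), mul_comm]
    refine sum_const_nat fun f hf => ?_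
    rw [← hcol' f]
    refine card_nbij' Prod.fst (fun x => (x, f)) ?_ ?_ ?_ ?_ <;>
      simp_all [Set.MapsTo, Set.LeftInvOn]
    all_goals grind
  have h3 : univ.filter (fun p : L × F => p.1 ∈ P ∧ a p.1 p.2) =
      insert (x₀, f₀) (univ.filter fun p : L × F => p.2 ∈ Q ∧ a p.1 p.2) := by
    ext ⟨x, f⟩
    simp only [mem_filter, mem_univ, true_and, mem_insert, Prod.mk.injEq]
    grind
  rw [h3, card_insert_of_notMem (by simp [hf₀]), h2] at h1
  omega

/-- The simple bipartite graph on `L ⊕ F` of a relation between `L` and `F`. -/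
abbrev bipartiteGraph {L F : Type*} (a : L → F → Prop) : SimpleGraph (L ⊕ F) :=
  SimpleGraph.fromRel fun p q => ∃ x f, p = Sum.inl x ∧ q = Sum.inr f ∧ a x f

theorem bipartiteGraph_adj {L F : Type*} {a : L → F → Prop} {x : L} {f : F} (h : a x f) :
    (bipartiteGraph a).Adj (Sum.inl x) (Sum.inr f) := by
  simpa [SimpleGraph.fromRel_adj] using h

theorem reachable_iff_of_rel {L F : Type*} {a : L → F → Prop} {x : L} {f : F} (h : a x f)
    (p : L ⊕ F) : (bipartiteGraph a).Reachable p (Sum.inl x) ↔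
      (bipartiteGraph a).Reachable p (Sum.inr f) :=
  ⟨fun hp => hp.trans (bipartiteGraph_adj h).reachable,
    fun hp => hp.trans (bipartiteGraph_adj h).symm.reachable⟩

/-- Switching an edge `x f` of a 2-regular bipartite relation with an edge `y f'` outside its
component merges the two components. -/
theorem reachable_of_switch {L F : Type*} [Fintype L] [Fintype F] {a a' : L → F → Prop}
    (hrow : ∀ x, Nat.card {f | a x f} = 2) (hcol : ∀ f, Nat.card {x | a x f} = 2)
    {x y : L} {f f' : F} (hxf : a x f) (hyf : a y f')
    (hy : ¬ (bipartiteGraph a).Reachable (Sum.inl x) (Sum.inl y)) (hyf' : a' y f)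
    (ha' : ∀ z g, a z g → (z = x → g ≠ f) → (z = y → g ≠ f') → a' z g) :
    (∀ q, (bipartiteGraph a).Reachable (Sum.inl x) q →
      (bipartiteGraph a').Reachable (Sum.inl x) q) ∧
    (bipartiteGraph a').Reachable (Sum.inl x) (Sum.inl y) := by
  have step : ∀ z g, a z g → (z = x → g ≠ f) →
      (bipartiteGraph a).Reachable (Sum.inl x) (Sum.inl z) →
      ((bipartiteGraph a').Reachable (Sum.inl x) (Sum.inl z) ↔
      (bipartiteGraph a').Reachable (Sum.inl x) (Sum.inr g)) := fun z g h h1 h2 =>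
    reachable_iff_of_rel (ha' z g h h1 (by rintro rfl; exact absurd h2 hy)) _
  have hf : (bipartiteGraph a').Reachable (Sum.inl x) (Sum.inr f) := by
    by_contra hf
    refine false_of_single_boundary_edge hrow hcol
      (P := {z | (bipartiteGraph a).Reachable (Sum.inl x) (Sum.inl z) ∧
        (bipartiteGraph a').Reachable (Sum.inl x) (Sum.inl z)})
      (Q := {g | (bipartiteGraph a).Reachable (Sum.inl x) (Sum.inr g) ∧
        (bipartiteGraph a').Reachable (Sum.inl x) (Sum.inr g)})
      (x₀ := x) (f₀ := f) ⟨.rfl, .rfl⟩ (fun h => hf h.2) hxf ?_ ?_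
    · rintro z ⟨hz, hz'⟩ g hzg hne
      exact ⟨(reachable_iff_of_rel hzg _).1 hz, (step z g hzg hne hz).1 hz'⟩
    · rintro g ⟨hg, hg'⟩ z hzg
      have hz := (reachable_iff_of_rel hzg _).2 hg
      exact ⟨hz, (step z g hzg (by rintro - rfl; exact hf hg') hz).2 hg'⟩
  have closed : ∀ z g, a z g → (bipartiteGraph a).Reachable (Sum.inl x) (Sum.inl z) →
      ((bipartiteGraph a').Reachable (Sum.inl x) (Sum.inl z) ↔
      (bipartiteGraph a').Reachable (Sum.inl x) (Sum.inr g)) := by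
    intro z g hzg hz
    by_cases h : z = x ∧ g = f
    · obtain ⟨rfl, rfl⟩ := h
      exact iff_of_true .rfl hf
    · exact step z g hzg (fun h1 h2 => h ⟨h1, h2⟩) hz
  refine ⟨fun q hq => ?_, (reachable_iff_of_rel hyf' _).2 hf⟩
  rw [SimpleGraph.reachable_iff_reflTransGen] at hq
  induction hq with
  | refl => exact .rfl
  | @tail p q hp hpq ih =>
    rw [← SimpleGraph.reachable_iff_reflTransGen] at hp
    have hq := hp.trans hpq.reachable
    obtain ⟨-, ⟨z, g, rfl, rfl, hzg⟩ | ⟨z, g, rfl, rfl, hzg⟩⟩ := (SimpleGraph.fromRel_adj _ _ _).1 hpq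
    · exact (closed z g hzg hp).1 ih
    · exact (closed z g hzg hq).2 ih

/-- A matrix line with entries `m` and `m + s`, `s = ±1`, has exactly two entries `m + s` if its
sum exceeds that of the constant line by `2 * s`. -/
theorem card_exceptional_eq_two {ι : Type*} [Fintype ι] {c : ι → ℤ} {m s : ℤ} (hs : s ≠ 0)
    (hc : ∀ i, c i = m ∨ c i = m + s) (hsum : ∑ i, c i = m * Fintype.card ι + 2 * s) :
    Nat.card {i | c i = m + s} = 2 := by
  classical
  have e : ∀ i, c i = m + if c i = m + s then s else 0 := by
    intro i
    rcases hc i with h | h <;> simp [h, hs]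
  rw [Finset.sum_congr rfl fun i _ => e i, Finset.sum_add_distrib, ← Finset.sum_filter,
    Finset.sum_const, Finset.sum_const, Finset.card_univ, nsmul_eq_mul, nsmul_eq_mul] at hsum
  have h2 : ((Finset.univ.filter fun i => c i = m + s).card : ℤ) * s = 2 * s := by linarith
  rw [natCard_setOf]
  exact_mod_cast mul_right_cancel₀ hs h2

/-- If the entries of a line differ by at most one and the line sum exceeds `m * card` by
`2 * s` with `s = ±1`, then all entries are `m` or `m + s`. -/
theorem eq_or_eq_add_of_le_add_one {ι : Type*} [Fintype ι] {c : ι → ℤ} {m s : ℤ}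
    (hs : s = 1 ∨ s = -1) (hι : 2 < Fintype.card ι) (hc : ∀ i j, c i ≤ c j + 1)
    (hsum : ∑ i, c i = m * Fintype.card ι + 2 * s) (i : ι) : c i = m ∨ c i = m + s := by
  have hup : ∀ b, (∀ j, c j ≤ b) → ∑ j, c j ≤ Fintype.card ι * b := fun b hb => by
    simpa using Finset.sum_le_card_nsmul Finset.univ c b fun j _ => hb j
  have hlo : ∀ b, (∀ j, b ≤ c j) → Fintype.card ι * b ≤ ∑ j, c j := fun b hb => by
    simpa using Finset.card_nsmul_le_sum Finset.univ c b fun j _ => hb j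
  have hι' : (2 : ℤ) < Fintype.card ι := by exact_mod_cast hι
  rcases hs with rfl | rfl
  · have h1 : m ≤ c i := by
      by_contra! h
      have := hup m fun j => by linarith [hc j i]
      nlinarith
    have h2 : c i ≤ m + 1 := by
      by_contra! h
      have := hlo (m + 1) fun j => by linarith [hc i j]
      nlinarith
    omega
  · have h1 : m - 1 ≤ c i := by
      by_contra! h
      have := hup (m - 1) fun j => by linarith [hc j i]
      nlinarith
    have h2 : c i ≤ m := by
      by_contra! h
      have := hlo m fun j => by linarith [hc i j]
      nlinarith
    omega

/-- The effect of a switch on a matrix with entries `m` and `m + s`. -/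
theorem switch_entries {L F : Type*} [DecidableEq L] [DecidableEq F] {c c' : L → F → ℤ} {m s : ℤ}
    {x y : L} {f f' : F} (hyx : y ≠ x) (hff : f ≠ f') (hc : ∀ z g, c z g = m ∨ c z g = m + s)
    (hxf : c x f = m + s) (hxf' : c x f' = m) (hyf : c y f = m) (hyf' : c y f' = m + s)
    (hc' : ∀ z g, c' z g = c z g + s * (((if z = y then 1 else 0) - (if z = x then 1 else 0)) *
      ((if g = f then 1 else 0) - (if g = f' then 1 else 0)))) :
    (∀ z g, c' z g = m ∨ c' z g = m + s) ∧ c' y f = m + s ∧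
    ∀ z g, c z g = m + s → (z = x → g ≠ f) → (z = y → g ≠ f') → c' z g = m + s := by
  have hx : c' x f = m ∧ c' x f' = m + s := by simp [hc', hyx.symm, hff, hff.symm, hxf, hxf']
  have hy : c' y f = m + s ∧ c' y f' = m := by simp [hc', hyx, hff, hff.symm, hyf, hyf']
  have hother : ∀ z g, ¬ ((z = x ∨ z = y) ∧ (g = f ∨ g = f')) → c' z g = c z g := by
    intro z g h
    rw [hc']
    by_cases hz : z = x ∨ z = y
    · have hg : g ≠ f ∧ g ≠ f' := by tauto
      simp [hg.1, hg.2]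
    · push Not at hz
      simp [hz.1, hz.2]
  refine ⟨fun z g => ?_, hy.1, fun z g h h1 h2 => ?_⟩
  · by_cases h : (z = x ∨ z = y) ∧ (g = f ∨ g = f')
    · obtain ⟨rfl | rfl, rfl | rfl⟩ := h <;> tauto
    · rw [hother z g h]
      exact hc z g
  · by_cases h' : (z = x ∨ z = y) ∧ (g = f ∨ g = f')
    · obtain ⟨rfl | rfl, rfl | rfl⟩ := h' <;> tauto
    · rw [hother z g h', h]

theorem exists_colorCount_connected {F R L : Type*} [Fintype F] [Fintype R] [Fintype L]
    [DecidableEq L] [Nonempty L] (U : F → R → L) {m s : ℤ} (hs : s = 1 ∨ s = -1)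
    (hF : 2 < Fintype.card F)
    (hL : (Fintype.card R : ℤ) = m * Fintype.card L + 2 * s)
    (hU : ∀ x, ∑ r, ∑ f, (if U f r = x then 1 else 0) = m * Fintype.card F + 2 * s) :
    ∃ σ : R → Equiv.Perm F,
      (∀ x f, colorCount U σ x f = m ∨ colorCount U σ x f = m + s) ∧
      (bipartiteGraph fun x f => colorCount U σ x f = m + s).Connected := by
  classical
  have hs0 : s ≠ 0 := by omega
  obtain ⟨x₀⟩ := ‹Nonempty L›
  obtain ⟨σ₀, hσ₀⟩ := exists_colorCount_le_add_one U
  let B := {σ : R → Equiv.Perm F //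
    ∀ x f, colorCount U σ x f = m ∨ colorCount U σ x f = m + s}
  let G : B → SimpleGraph (L ⊕ F) := fun σ => bipartiteGraph fun x f => colorCount U σ.1 x f = m + s
  have : Nonempty B := ⟨σ₀, fun x => eq_or_eq_add_of_le_add_one hs hF (hσ₀ x)
    ((sum_colorCount_right U σ₀ x).trans (hU x))⟩
  obtain ⟨σ, hmax⟩ := Finite.exists_max
    fun σ : B => {q | (G σ).Reachable (Sum.inl x₀) q}.ncard
  have hrow : ∀ x, Nat.card {f | colorCount U σ.1 x f = m + s} = 2 := fun x =>
    card_exceptional_eq_two hs0 (σ.2 x) ((sum_colorCount_right U σ.1 x).trans (hU x))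
  have hcol : ∀ f, Nat.card {x | colorCount U σ.1 x f = m + s} = 2 := fun f =>
    card_exceptional_eq_two hs0 (fun x => σ.2 x f) ((sum_colorCount_left U σ.1 f).trans hL)
  have hne : ∀ x, ∃ f, colorCount U σ.1 x f = m + s := fun x => by
    have : Nonempty {f | colorCount U σ.1 x f = m + s} :=
      (Nat.card_pos_iff.1 (by rw [hrow x]; norm_num)).1
    exact ⟨this.some, this.some.2⟩
  have hreach : ∀ {x f}, colorCount U σ.1 x f = m + s → ∀ p,
      (G σ).Reachable p (Sum.inl x) ↔ (G σ).Reachable p (Sum.inr f) := fun h =>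
    reachable_iff_of_rel (a := fun x f => colorCount U σ.1 x f = m + s) h
  refine ⟨σ.1, σ.2, ?_⟩
  rw [SimpleGraph.connected_iff_exists_forall_reachable]
  refine ⟨Sum.inl x₀, ?_⟩
  by_contra! hcon
  obtain ⟨f', hf'⟩ : ∃ f', ¬ (G σ).Reachable (Sum.inl x₀) (Sum.inr f') := by
    obtain ⟨z | f', hq⟩ := hcon
    · obtain ⟨f', h⟩ := hne z
      exact ⟨f', fun h' => hq ((hreach h _).2 h')⟩
    · exact ⟨f', hq⟩
  obtain ⟨f, hf⟩ := hne x₀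
  have hx₀f' : colorCount U σ.1 x₀ f' = m := (σ.2 x₀ f').resolve_right fun h =>
    hf' (hreach h _ |>.1 .rfl)
  have hff : f ≠ f' := by rintro rfl; omega
  obtain ⟨y, σ', hyf, hyf', hσ'⟩ : ∃ (y : L) (σ' : R → Equiv.Perm F),
      colorCount U σ.1 y f = m ∧ colorCount U σ.1 y f' = m + s ∧
      ∀ z g, colorCount U σ' z g = colorCount U σ.1 z g +
        s * (((if z = y then 1 else 0) - (if z = x₀ then 1 else 0)) *
        ((if g = f then 1 else 0) - (if g = f' then 1 else 0))) := by
    rcases hs with rfl | rfl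
    · obtain ⟨y, σ', hy, hσ'⟩ := exists_colorCount_switch U σ.1 (x := x₀) (f := f) (f' := f')
        (by omega)
      have h1 := σ.2 y f
      have h2 := σ.2 y f'
      exact ⟨y, σ', by omega, by omega, fun z g => by rw [hσ']; ring⟩
    · obtain ⟨y, σ', hy, hσ'⟩ := exists_colorCount_switch U σ.1 (x := x₀) (f := f') (f' := f)
        (by omega)
      have h1 := σ.2 y f
      have h2 := σ.2 y f'
      exact ⟨y, σ', by omega, by omega, fun z g => by rw [hσ']; ring⟩
  have hyx : y ≠ x₀ := by rintro rfl; omega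
  have hy : ¬ (G σ).Reachable (Sum.inl x₀) (Sum.inl y) := fun h =>
    hf' ((hreach hyf' _).1 h)
  obtain ⟨hB, hnewyf, hkeep⟩ := switch_entries hyx hff σ.2 hf hx₀f' hyf hyf' hσ'
  obtain ⟨hsub, hnew⟩ := reachable_of_switch (a' := fun x f => colorCount U σ' x f = m + s)
    hrow hcol hf hyf' hy hnewyf hkeep
  refine absurd (hmax ⟨σ', hB⟩) (not_le.mpr (Set.ncard_lt_ncard ?_ (Set.toFinite _)))
  exact ⟨hsub, fun h => hy (h hnew)⟩

/-- Lemma 9: for `n > 2` and `k = m*n + ε` with `ε ∈ {-2, 2}`, the coloring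
`w` of Lemma 7 can be chosen so that the bipartite graph of exceptional edges of `[u, w]`
is connected. -/
theorem stmt11 (n k : ℕ) (hn : 2 < n) (hk : 0 < k) (m : ℕ) (ε : ℤ)
    (hε : ε ∈ ({-2, 2} : Set ℤ)) (hkval : (k : ℤ) = m * n + ε)
    (E : Type) [Fintype E] (hE : Fintype.card E = n * k)
    (u : E → Fin n) (v : E → Fin k)
    (hu : ∀ x : Fin n, Nat.card {e : E | u e = x} = k)
    (hv : ∀ y : Fin k, Nat.card {e : E | v e = y} = n) :
    ∃ w : E → Fin n,
      (∀ (f : Fin n) (r : Fin k), ∃! e : E, w e = f ∧ v e = r) ∧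
      (∀ (x f : Fin n),
        (Nat.card {e : E | u e = x ∧ w e = f} : ℤ) = m ∨
        (Nat.card {e : E | u e = x ∧ w e = f} : ℤ) = m + ε.sign) ∧
      (SimpleGraph.fromRel fun a b : Fin n ⊕ Fin n =>
        ∃ x f : Fin n, a = Sum.inl x ∧ b = Sum.inr f ∧
          (Nat.card {e : E | u e = x ∧ w e = f} : ℤ) = m + ε.sign).Connected := by
  classical
  have : NeZero n := ⟨by omega⟩
  have φ : ∀ r, Fin n ≃ {e : E | v e = r} := fun r =>
    (finCongr (hv r)).symm.trans (Finite.equivFin _).symm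
  have hφ : ∀ r i, v (φ r i) = r := fun r i => (φ r i).2
  obtain ⟨s, hs, hεs, hsign⟩ : ∃ s : ℤ, (s = 1 ∨ s = -1) ∧ ε = 2 * s ∧ ε.sign = s := by
    rcases hε with rfl | rfl
    · exact ⟨-1, by simp, by simp, rfl⟩
    · exact ⟨1, by simp, by simp, rfl⟩
  have hU : ∀ x, ∑ r, ∑ i, (if u (φ r i) = x then 1 else 0) = (k : ℤ) := by
    intro x
    have hux := hu x
    rw [natCard_setOf, Finset.card_filter] at hux
    refine Eq.trans ?_ (congrArg Nat.cast hux)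
    rw [Nat.cast_sum, ← Finset.sum_fiberwise Finset.univ v]
    refine Finset.sum_congr rfl fun r _ => ?_
    rw [Equiv.sum_comp (φ r) fun e : {e : E | v e = r} => if u e = x then (1 : ℤ) else 0,
      ← Finset.sum_subtype (p := fun e => e ∈ {e : E | v e = r}) (Finset.univ.filter fun e => v e = r)
        (by simp) fun e => if u e = x then (1 : ℤ) else 0]
    simp
  obtain ⟨σ, hσ, hconn⟩ := exists_colorCount_connected (fun i r => u (φ r i)) (m := m) hs
    (by simpa using hn) (by simpa [hεs] using hkval)
    (fun x => by rw [hU x, hkval, hεs, Fintype.card_fin])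
  have hw : ∀ e r f, ((σ (v e)).symm ((φ (v e)).symm ⟨e, rfl⟩) = f ∧ v e = r) ↔
      e = φ r (σ r f) := by
    intro e r f
    constructor
    · rintro ⟨rfl, rfl⟩
      simp
    · intro h
      obtain rfl : v e = r := by rw [h, hφ]
      refine ⟨?_, rfl⟩
      rw [Equiv.symm_apply_eq, Equiv.symm_apply_eq]
      exact Subtype.ext h
  have hcount : ∀ x f, (Nat.card {e : E | u e = x ∧
      (σ (v e)).symm ((φ (v e)).symm ⟨e, rfl⟩) = f} : ℤ) =
      colorCount (fun i r => u (φ r i)) σ x f := by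
    intro x f
    rw [natCard_setOf, colorCount,
      Finset.sum_boole]
    norm_cast
    refine Finset.card_nbij' v (fun r => φ r (σ r f)) ?_ ?_ ?_ ?_
    · intro e he
      simp only [Finset.coe_filter, Finset.mem_univ, true_and, Set.mem_ofPred_eq] at he ⊢
      rw [← (hw e _ f).1 ⟨he.2, rfl⟩, he.1]
    · intro r hr
      simp only [Finset.coe_filter, Finset.mem_univ, true_and, Set.mem_ofPred_eq] at hr ⊢
      exact ⟨hr, ((hw _ r f).2 rfl).1⟩
    · intro e he
      simp only [Finset.coe_filter, Finset.mem_univ, true_and, Set.mem_ofPred_eq] at he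
      exact ((hw e _ f).1 ⟨he.2, rfl⟩).symm
    · intro r _
      exact hφ r _
  refine ⟨fun e => (σ (v e)).symm ((φ (v e)).symm ⟨e, rfl⟩), fun f r => ?_, fun x f => ?_, ?_⟩
  · simp only [hw]
    exact existsUnique_eq
  · rw [hcount, hsign]
    exact hσ x f
  · simp only [hcount, hsign]
    exact hconn
end

section
/- Let m ≥ 1 be an integer and set k = 6m+3. Then for every biregular pair (u, v) on parameters (6, k), i.e. functions u : Fin 6 × Fin k → Fin 6 and v : Fin 6 × Fin k → Fin k such that every fiber of u has exactly k elements and every fiber of v has exactly 6 elements, there exists an involution ι : Fin 6 × Fin k → Fin 6 × Fin k (ι ∘ ι = id) such that for every (x, y) : Fin 6 × Fin k there is exactly one e : Fin 6 × Fin k with u (ι e) = x and v e = y. -/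
namespace Balls

/-- A `6 × 6` Boolean matrix becomes symmetric after a suitable permutation of its columns. -/
def Symmetrizable (D : Fin 6 → Fin 6 → Bool) : Prop :=
  ∃ σ : Equiv.Perm (Fin 6), ∀ i j, D i (σ j) = D j (σ i)

/-- Complement the four entries of `D` in rows `p`, `q` and columns `j`, `k`. -/
def flip (D : Fin 6 → Fin 6 → Bool) (j k p q : Fin 6) (x c : Fin 6) : Bool :=
  if (x = p ∨ x = q) ∧ (c = j ∨ c = k) then !D x c else D x c

/-- `D` is symmetrizable, or it becomes so after any switch of columns `j`, `k` that moves the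
entry of some fixed row `q`. -/
def Fixable (D : Fin 6 → Fin 6 → Bool) : Prop :=
  Symmetrizable D ∨ ∃ j k q, D q j = true ∧ D q k = false ∧
    ∀ p, D p k = true → D p j = false → Symmetrizable (flip D j k p q)

/-- Backtracking search for a column permutation that makes `D` symmetric. -/
def symSearch (D : Fin 6 → Fin 6 → Bool) : Bool :=
  (List.finRange 6).any fun s₀ =>
  (List.finRange 6).any fun s₁ => (s₁ != s₀) && (D 0 s₁ == D 1 s₀) &&
  (List.finRange 6).any fun s₂ => (s₂ != s₀ && s₂ != s₁) &&
    (D 0 s₂ == D 2 s₀ && D 1 s₂ == D 2 s₁) &&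
  (List.finRange 6).any fun s₃ => (s₃ != s₀ && s₃ != s₁ && s₃ != s₂) &&
    (D 0 s₃ == D 3 s₀ && D 1 s₃ == D 3 s₁ && D 2 s₃ == D 3 s₂) &&
  (List.finRange 6).any fun s₄ => (s₄ != s₀ && s₄ != s₁ && s₄ != s₂ && s₄ != s₃) &&
    (D 0 s₄ == D 4 s₀ && D 1 s₄ == D 4 s₁ && D 2 s₄ == D 4 s₂ && D 3 s₄ == D 4 s₃) &&
  (List.finRange 6).any fun s₅ =>
    (s₅ != s₀ && s₅ != s₁ && s₅ != s₂ && s₅ != s₃ && s₅ != s₄) &&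
    (D 0 s₅ == D 5 s₀ && D 1 s₅ == D 5 s₁ && D 2 s₅ == D 5 s₂ && D 3 s₅ == D 5 s₃ &&
      D 4 s₅ == D 5 s₄)

/-- Decision procedure for `Fixable`. -/
def fixSearch (D : Fin 6 → Fin 6 → Bool) : Bool :=
  symSearch D ||
  (List.finRange 6).any fun j => (List.finRange 6).any fun k => (List.finRange 6).any fun q =>
    (D q j && !D q k) &&
      (List.finRange 6).all fun p => !(D p k && !D p j) || symSearch (flip D j k p q)

theorem Symmetrizable.of_symSearch {D : Fin 6 → Fin 6 → Bool} (h : symSearch D = true) :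
    Symmetrizable D := by
  simp only [symSearch, List.any_eq_true, List.mem_finRange, true_and, Bool.and_eq_true,
    bne_iff_ne, beq_iff_eq] at h
  obtain ⟨s₀, s₁, ⟨h₁, e₁⟩, s₂, ⟨h₂, e₂⟩, s₃, ⟨h₃, e₃⟩, s₄, ⟨h₄, e₄⟩, s₅, h₅, e₅⟩ := h
  have hinj : Function.Injective ![s₀, s₁, s₂, s₃, s₄, s₅] := by
    intro i j hij
    fin_cases i <;> fin_cases j <;> simp at hij ⊢ <;> grind
  refine ⟨Equiv.ofBijective _ (Finite.injective_iff_bijective.1 hinj), fun i j => ?_⟩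
  fin_cases i <;> fin_cases j <;> simp <;> grind

theorem Fixable.of_fixSearch {D : Fin 6 → Fin 6 → Bool} (h : fixSearch D = true) :
    Fixable D := by
  simp only [fixSearch, Bool.or_eq_true, List.any_eq_true, List.all_eq_true, List.mem_finRange,
    true_and, Bool.and_eq_true, true_imp_iff] at h
  rcases h with h | ⟨j, k, q, ⟨h₁, h₂⟩, h⟩
  · exact Or.inl (.of_symSearch h)
  · refine Or.inr ⟨j, k, q, h₁, by simpa using h₂, fun p hk hj => ?_⟩
    have := h p
    simp only [hk, hj] at this
    exact .of_symSearch (by simpa using this)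

theorem Symmetrizable.of_rows {D : Fin 6 → Fin 6 → Bool} (ρ : Equiv.Perm (Fin 6))
    (h : Symmetrizable (D ∘ ρ)) : Symmetrizable D := by
  obtain ⟨σ, hσ⟩ := h
  refine ⟨ρ.symm.trans σ, fun i j => ?_⟩
  simpa using hσ (ρ.symm i) (ρ.symm j)

theorem Fixable.of_rows {D : Fin 6 → Fin 6 → Bool} (ρ : Equiv.Perm (Fin 6))
    (h : Fixable (D ∘ ρ)) : Fixable D := by
  rcases h with h | ⟨j, k, q, h₁, h₂, h⟩
  · exact Or.inl (h.of_rows ρ)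
  · refine Or.inr ⟨j, k, ρ q, h₁, h₂, fun p hk hj => ?_⟩
    refine Symmetrizable.of_rows ρ ?_
    convert h (ρ.symm p) (by simpa using hk) (by simpa using hj) using 1
    ext x c
    simp [flip, Equiv.eq_symm_apply]

/-- Base 8 encoding of a Boolean vector. -/
def encode (f : Fin 6 → Bool) : ℕ := ∑ c, if f c then 8 ^ (c : ℕ) else 0

/-- The encodings of the vectors with three entries `true`, the last of them `false`. -/
def lowCodes : List ℕ := [73, 521, 577, 584, 4105, 4161, 4168, 4609, 4616, 4672]

/-- The encodings of the vectors with three entries `true`, one of them the last. -/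
def highCodes : List ℕ :=
  [32777, 32833, 32840, 33281, 33288, 33344, 36865, 36872, 36928, 37376]

theorem encode_spec : ∀ f : Fin 6 → Bool, (∑ c, if f c then 1 else 0) = 3 →
    (encode f ∈ lowCodes ∨ encode f ∈ highCodes) ∧
      ∀ c : Fin 6, (encode f).testBit (3 * c) = f c := by
  decide +kernel

theorem le_of_mem_lowCodes : ∀ a ∈ lowCodes, a ≤ 4672 := by decide

theorem le_of_mem_highCodes : ∀ a ∈ highCodes, 32777 ≤ a ∧ a ≤ 37376 := by decide

/-- Whether `fixSearch` succeeds on all matrices with ordered rows and with three entries `true`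
in every row and every column. -/
def checkCodes : Bool :=
  lowCodes.all fun a => lowCodes.all fun b => !a.ble b || lowCodes.all fun c => !b.ble c ||
  highCodes.all fun d => highCodes.all fun e => !d.ble e || highCodes.all fun f => !e.ble f ||
    !(a + b + c + d + e + f).beq 112347 ||
      fixSearch (fun x i => (![a, b, c, d, e, f] x).testBit (3 * i))

theorem checkCodes_eq_true : checkCodes = true := by
  decide +kernel

theorem fixSearch_codes {r : Fin 6 → ℕ} (hr : Monotone r)
    (hmem : ∀ x, r x ∈ lowCodes ∨ r x ∈ highCodes) (hsum : ∑ x, r x = 112347) :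
    fixSearch (fun x i => (r x).testBit (3 * i)) = true := by
  have hbound : ∀ x, r x ≤ 4672 ∧ r x ∈ lowCodes ∨
      (32777 ≤ r x ∧ r x ≤ 37376) ∧ r x ∈ highCodes := fun x =>
    (hmem x).imp (fun h => ⟨le_of_mem_lowCodes _ h, h⟩) (fun h => ⟨le_of_mem_highCodes _ h, h⟩)
  rw [Fin.sum_univ_six] at hsum
  have h₀₁ : r 0 ≤ r 1 := hr (by decide)
  have h₁₂ : r 1 ≤ r 2 := hr (by decide)
  have h₂₃ : r 2 ≤ r 3 := hr (by decide)
  have h₃₄ : r 3 ≤ r 4 := hr (by decide)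
  have h₄₅ : r 4 ≤ r 5 := hr (by decide)
  have b₀ := hbound 0
  have b₁ := hbound 1
  have b₂ := hbound 2
  have b₃ := hbound 3
  have b₄ := hbound 4
  have b₅ := hbound 5
  have low (x) (hx : r x ≤ r 2) : r x ∈ lowCodes := by
    rcases hbound x with h | h
    · exact h.2
    · omega
  have high (x) (hx : r 3 ≤ r x) : r x ∈ highCodes := by
    rcases hbound x with h | h
    · omega
    · exact h.2
  have key := checkCodes_eq_true
  simp only [checkCodes, List.all_eq_true, Bool.or_eq_true, Bool.not_eq_eq_eq_not, Bool.not_true] at key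
  have := key _ (low 0 (by omega)) _ (low 1 (by omega))
  replace this := (this.resolve_left (by simpa using h₀₁)) _ (low 2 le_rfl)
  replace this := (this.resolve_left (by simpa using h₁₂)) _ (high 3 le_rfl) _ (high 4 (by omega))
  replace this := (this.resolve_left (by simpa using h₃₄)) _ (high 5 (by omega))
  replace this := this.resolve_left (by simp [h₄₅, hsum])
  convert this using 2
  ext x c
  fin_cases x <;> rfl

theorem fixable_of_regular (D : Fin 6 → Fin 6 → Bool)
    (hrow : ∀ x, (∑ c, if D x c then 1 else 0) = 3)
    (hcol : ∀ c, (∑ x, if D x c then 1 else 0) = 3) : Fixable D := by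
  set r : Fin 6 → ℕ := fun x => encode (D x) with hr
  have hsum : ∑ x, r (Tuple.sort r x) = 112347 := by
    rw [Equiv.sum_comp (Tuple.sort r) r]
    simp only [hr, encode]
    rw [Finset.sum_comm]
    have (c : Fin 6) : (∑ x, if D x c then 8 ^ (c : ℕ) else 0) = 8 ^ (c : ℕ) * 3 := by
      rw [← hcol c, Finset.mul_sum]
      exact Finset.sum_congr rfl fun x _ => by split_ifs <;> simp
    simp_rw [this]
    decide
  refine Fixable.of_rows (Tuple.sort r) (Fixable.of_fixSearch ?_)
  convert fixSearch_codes (Tuple.monotone_sort r) (fun x => (encode_spec _ (hrow _)).1) hsum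
    using 2
  ext x c
  exact ((encode_spec _ (hrow _)).2 c).symm

/-- In a finite multidigraph with arcs `T` a vertex of larger out-degree than in-degree is joined
by a trail to a vertex of smaller out-degree than in-degree. -/
theorem exists_trail {X Y : Type*} [DecidableEq X] [DecidableEq Y] (s t : Y → X) (n : ℕ) :
    ∀ (T : Finset Y) (q : X), T.card = n →
      (∑ y ∈ T, if t y = q then (1 : ℤ) else 0) < (∑ y ∈ T, if s y = q then (1 : ℤ) else 0) →
      ∃ (S : Finset Y) (p : X), S ⊆ T ∧
        (∑ y ∈ T, if s y = p then (1 : ℤ) else 0) < (∑ y ∈ T, if t y = p then (1 : ℤ) else 0) ∧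
        ∀ a, (∑ y ∈ S, ((if s y = a then (1 : ℤ) else 0) - if t y = a then 1 else 0)) =
          (if a = q then 1 else 0) - if a = p then 1 else 0 := by
  induction n with
  | zero =>
    intro T q hT h
    simp [Finset.card_eq_zero.1 hT] at h
  | succ n ih =>
    intro T q hT h
    obtain ⟨y, hyT, hy⟩ : ∃ y ∈ T, s y = q := by
      by_contra! hne
      rw [Finset.sum_eq_zero (f := fun y => if s y = q then (1 : ℤ) else 0)
        (fun y hy => if_neg (hne y hy))] at h
      exact absurd h (not_lt.2 (Finset.sum_nonneg fun y _ => by split_ifs <;> simp))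
    have hs : ∀ a, (∑ z ∈ T, if s z = a then (1 : ℤ) else 0) =
        (∑ z ∈ T.erase y, if s z = a then (1 : ℤ) else 0) + if s y = a then 1 else 0 :=
      fun a => (Finset.sum_erase_add T _ hyT).symm
    have ht : ∀ a, (∑ z ∈ T, if t z = a then (1 : ℤ) else 0) =
        (∑ z ∈ T.erase y, if t z = a then (1 : ℤ) else 0) + if t y = a then 1 else 0 :=
      fun a => (Finset.sum_erase_add T _ hyT).symm
    by_cases hdef : (∑ z ∈ T, if s z = t y then (1 : ℤ) else 0) <
        ∑ z ∈ T, if t z = t y then (1 : ℤ) else 0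
    · refine ⟨{y}, t y, by simpa using hyT, hdef, fun a => ?_⟩
      rw [Finset.sum_singleton, hy]
      simp only [eq_comm (b := a)]
    · obtain ⟨S, p, hS, hp, hsum⟩ := ih (T.erase y) (t y)
        (by rw [Finset.card_erase_of_mem hyT, hT]; rfl) (by
          have h₁ := hs (t y)
          have h₂ := ht (t y)
          rw [if_pos rfl] at h₂
          by_cases hq : s y = t y
          · rw [if_pos hq] at h₁
            rw [← hy, hq] at h
            linarith
          · rw [if_neg hq] at h₁
            linarith)
      have hyS : y ∉ S := fun hm => by simpa using hS hm
      refine ⟨insert y S, p, ?_, ?_, fun a => ?_⟩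
      · exact Finset.insert_subset hyT (hS.trans (Finset.erase_subset _ _))
      · have h₁ := hs p
        have h₂ := ht p
        by_cases hpq : s y = p
        · rw [hy] at hpq
          rw [← hpq] at h₁ h₂ hp ⊢
          rw [if_pos hy] at h₁
          split_ifs at h₂ <;> omega
        · rw [if_neg hpq] at h₁
          split_ifs at h₂ <;> omega
      · rw [Finset.sum_insert hyS, hsum a, hy]
        simp only [eq_comm (b := a)]
        ring

/-- The number of boxes in which position `π y b` holds colour `a`. -/
def count {Y : Type*} [Fintype Y] (w : Y → Fin 6 → Fin 6) (π : Y → Equiv.Perm (Fin 6))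
    (a b : Fin 6) : ℤ := ∑ y, if w y (π y b) = a then 1 else 0

theorem exists_switch {Y : Type*} [Fintype Y] (w : Y → Fin 6 → Fin 6)
    (π : Y → Equiv.Perm (Fin 6)) {j k q : Fin 6} (h : count w π q k < count w π q j) :
    ∃ (π' : Y → Equiv.Perm (Fin 6)) (p : Fin 6), count w π p j < count w π p k ∧
      ∀ a b, count w π' a b = count w π a b +
        ((if a = p then 1 else 0) - if a = q then 1 else 0) *
          ((if b = j then 1 else 0) - if b = k then 1 else 0) := by
  classical
  have hjk : j ≠ k := by rintro rfl; exact lt_irrefl _ h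
  obtain ⟨S, p, -, hp, hS⟩ := exists_trail (fun y => w y (π y j)) (fun y => w y (π y k)) _
    Finset.univ q rfl h
  refine ⟨fun y => if y ∈ S then (Equiv.swap j k).trans (π y) else π y, p, hp, fun a b => ?_⟩
  have hdiff : count w (fun y => if y ∈ S then (Equiv.swap j k).trans (π y) else π y) a b =
      count w π a b + ∑ y ∈ S, ((if w y (π y (Equiv.swap j k b)) = a then (1 : ℤ) else 0) -
        if w y (π y b) = a then 1 else 0) := by
    rw [← Finset.univ_inter S, ← Finset.sum_ite_mem, count, count, ← Finset.sum_add_distrib]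
    refine Finset.sum_congr rfl fun y _ => ?_
    by_cases hy : y ∈ S <;> simp [hy]
  rw [hdiff]
  congr 1
  have hSa := hS a
  by_cases hbj : b = j
  · subst hbj
    rw [Equiv.swap_apply_left, if_pos rfl, if_neg hjk]
    rw [Finset.sum_sub_distrib] at hSa ⊢
    linarith
  · by_cases hbk : b = k
    · subst hbk
      rw [Equiv.swap_apply_right, if_pos rfl, if_neg hbj]
      rw [hSa]
      ring
    · rw [Equiv.swap_apply_of_ne_of_ne hbj hbk, if_neg hbj, if_neg hbk]
      simp

/-- A switch that evens out two entries of a row decreases the sum of squares. -/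
theorem sum_sq_switch_lt (N : Fin 6 → Fin 6 → ℤ) {j k p q : Fin 6}
    (hq : N q k + 2 ≤ N q j) (hp : N p j < N p k) :
    ∑ a, ∑ b, (N a b + ((if a = p then 1 else 0) - if a = q then 1 else 0) *
      ((if b = j then 1 else 0) - if b = k then 1 else 0)) ^ 2 < ∑ a, ∑ b, N a b ^ 2 := by
  have hjk : j ≠ k := by rintro rfl; omega
  have hpq : p ≠ q := by rintro rfl; omega
  have e : ∀ a b : Fin 6, (N a b + ((if a = p then 1 else 0) - if a = q then 1 else 0) *
      ((if b = j then 1 else 0) - if b = k then 1 else 0)) ^ 2 =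
      N a b ^ 2 + ((if a = p then (if b = j then 2 * N a b + 1 else 0) else 0) +
        (if a = p then (if b = k then -2 * N a b + 1 else 0) else 0) +
        (if a = q then (if b = j then -2 * N a b + 1 else 0) else 0) +
        (if a = q then (if b = k then 2 * N a b + 1 else 0) else 0)) := by
    intro a b
    split_ifs <;> first | omega | ring
  simp_rw [e, Finset.sum_add_distrib]
  simp [Finset.sum_ite_eq']
  linarith

theorem exists_equitable {Y : Type*} [Fintype Y] (w : Y → Fin 6 → Fin 6) :
    ∃ π : Y → Equiv.Perm (Fin 6), ∀ a j k, count w π a j ≤ count w π a k + 1 := by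
  obtain ⟨π, hπ⟩ := Finite.exists_min
    (fun π : Y → Equiv.Perm (Fin 6) => ∑ a, ∑ b, count w π a b ^ 2)
  refine ⟨π, fun a j k => ?_⟩
  by_contra! h
  obtain ⟨π', p, hp, hπ'⟩ := exists_switch w π (j := j) (k := k) (q := a) (by omega)
  have := sum_sq_switch_lt (count w π) (j := j) (k := k) (q := a) (by omega) hp
  simp_rw [← hπ'] at this
  exact absurd this (not_lt.2 (hπ π'))

theorem sum_count_left {Y : Type*} [Fintype Y] (w : Y → Fin 6 → Fin 6)
    (π : Y → Equiv.Perm (Fin 6)) (b : Fin 6) : ∑ a, count w π a b = Fintype.card Y := by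
  simp only [count]
  rw [Finset.sum_comm]
  simp

theorem sum_count_right {Y : Type*} [Fintype Y] (w : Y → Fin 6 → Fin 6)
    (π : Y → Equiv.Perm (Fin 6)) (a : Fin 6) :
    ∑ b, count w π a b = ∑ y, ∑ c, if w y c = a then 1 else 0 := by
  simp only [count]
  rw [Finset.sum_comm]
  exact Finset.sum_congr rfl fun y _ =>
    Equiv.sum_comp (π y) (fun c => if w y c = a then (1 : ℤ) else 0)

theorem exists_symmetric_count_of {Y : Type*} [Fintype Y] (w : Y → Fin 6 → Fin 6)
    (π : Y → Equiv.Perm (Fin 6)) (m : ℤ) (D : Fin 6 → Fin 6 → Bool)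
    (hD : ∀ a b, count w π a b = m + if D a b then 1 else 0) (h : Symmetrizable D) :
    ∃ π' : Y → Equiv.Perm (Fin 6), ∀ a b, count w π' a b = count w π' b a := by
  obtain ⟨σ, hσ⟩ := h
  have (a b : Fin 6) : count w (fun y => σ.trans (π y)) a b = count w π a (σ b) := rfl
  exact ⟨fun y => σ.trans (π y), fun a b => by rw [this, this, hD, hD, hσ]⟩

theorem exists_symmetric_count {Y : Type*} [Fintype Y] (w : Y → Fin 6 → Fin 6) (m : ℤ)
    (hY : (Fintype.card Y : ℤ) = 6 * m + 3)
    (hw : ∀ a, ∑ y, ∑ c, (if w y c = a then 1 else 0) = 6 * m + 3) :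
    ∃ π : Y → Equiv.Perm (Fin 6), ∀ a b, count w π a b = count w π b a := by
  obtain ⟨π, hπ⟩ := exists_equitable w
  have hrow (a) : ∑ b, count w π a b = 6 * m + 3 := by rw [sum_count_right, hw]
  have hcol (b) : ∑ a, count w π a b = 6 * m + 3 := by rw [sum_count_left, hY]
  have hval : ∀ a b, count w π a b = m ∨ count w π a b = m + 1 := by
    intro a b
    have h := hrow a
    rw [Fin.sum_univ_six] at h
    have h₁ (c) := hπ a b c
    have h₂ (c) := hπ a c b
    have := h₁ 0; have := h₁ 1; have := h₁ 2; have := h₁ 3; have := h₁ 4; have := h₁ 5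
    have := h₂ 0; have := h₂ 1; have := h₂ 2; have := h₂ 3; have := h₂ 4; have := h₂ 5
    fin_cases b <;> simp only [Fin.mk_zero, Fin.mk_one, Fin.reduceFinMk] at * <;> omega
  let D : Fin 6 → Fin 6 → Bool := fun a b => decide (count w π a b = m + 1)
  have hD : ∀ a b, count w π a b = m + if D a b then 1 else 0 := by
    intro a b
    rcases hval a b with h | h <;> simp [D, h]
  have hDrow : ∀ x, (∑ c, if D x c then 1 else 0) = 3 := by
    intro x
    have h := hrow x
    simp_rw [hD, Finset.sum_add_distrib] at h
    simp only [Finset.sum_const, Finset.card_univ, Fintype.card_fin, nsmul_eq_mul] at h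
    zify
    push_cast at h
    linarith
  have hDcol : ∀ c, (∑ x, if D x c then 1 else 0) = 3 := by
    intro c
    have h := hcol c
    simp_rw [hD, Finset.sum_add_distrib] at h
    simp only [Finset.sum_const, Finset.card_univ, Fintype.card_fin, nsmul_eq_mul] at h
    zify
    push_cast at h
    linarith
  rcases fixable_of_regular D hDrow hDcol with h | ⟨j, k, q, hj, hk, h⟩
  · exact exists_symmetric_count_of w π m D hD h
  · obtain ⟨π', p, hp, hπ'⟩ := exists_switch w π (j := j) (k := k) (q := q)
      (by rw [hD, hD, hj, hk]; simp)
    obtain ⟨hpk, hpj⟩ : D p k = true ∧ D p j = false := by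
      rw [hD, hD] at hp
      cases h₁ : D p k <;> cases h₂ : D p j <;> simp [h₁, h₂] at hp ⊢
    have hjk : j ≠ k := by rintro rfl; simp [hj] at hk
    have hpq : p ≠ q := by rintro rfl; simp [hj] at hpj
    refine exists_symmetric_count_of w π' m _ (fun a b => ?_) (h p hpk hpj)
    rw [hπ', hD, flip]
    by_cases hap : a = p
    · by_cases hbj : b = j
      · simp [hap, hbj, hjk, hpq, hpj]
      · by_cases hbk : b = k
        · simp [hap, hbk, hjk.symm, hpq, hpk]
        · simp [hbj, hbk]
    · by_cases haq : a = q
      · by_cases hbj : b = j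
        · simp [haq, hbj, hjk, hpq.symm, hj]
        · by_cases hbk : b = k
          · simp [haq, hbk, hjk.symm, hpq.symm, hk]
          · simp [hbj, hbk]
      · simp [hap, haq]

/-- If the fibres of `(u, c)` over `(a, b)` and `(b, a)` are always equinumerous, then some
involution exchanges `u` and `c`. -/
theorem exists_involution {E X : Type*} [Finite E] [LinearOrder X] (u c : E → X)
    (h : ∀ a b, Nat.card {e // u e = a ∧ c e = b} = Nat.card {e // u e = b ∧ c e = a}) :
    ∃ ι : E → E, ι ∘ ι = id ∧ ∀ e, u (ι e) = c e := by
  let F (a b : X) := {e // u e = a ∧ c e = b}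
  have G (a b : X) : F a b ≃ F b a := Classical.choice (Finite.card_eq.1 (h a b))
  obtain ⟨H, hH⟩ : ∃ H : ∀ a b, F a b → F b a, ∀ a b z, H b a (H a b z) = z := by
    refine ⟨fun a b z => if a < b then G a b z else if hba : b < a then (G b a).symm z else
      if hab : a = b then ⟨z.1, by rw [z.2.1, hab], by rw [z.2.2, hab]⟩ else G a b z,
      fun a b z => ?_⟩
    rcases lt_trichotomy a b with hab | rfl | hab
    · simp [hab, hab.not_gt]
    · simp
    · simp [hab, hab.not_gt]
  let ι : E → E := fun e => (H (u e) (c e) ⟨e, rfl, rfl⟩).1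
  have hι : ∀ a b (z : F a b), ι z.1 = (H a b z).1 := by
    rintro _ _ ⟨e, rfl, rfl⟩
    rfl
  refine ⟨ι, ?_, fun e => (H (u e) (c e) ⟨e, rfl, rfl⟩).2.1⟩
  ext e
  change ι (H (u e) (c e) ⟨e, rfl, rfl⟩).1 = e
  rw [hι, hH]

end Balls

/-- Conjecture 3 (the balls conjecture) holds for `n = 6`, `k = 6m + 3`. -/
theorem stmt13 (m : ℕ) (hm : 1 ≤ m)
    (u : Fin 6 × Fin (6 * m + 3) → Fin 6)
    (v : Fin 6 × Fin (6 * m + 3) → Fin (6 * m + 3))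
    (hu : ∀ x : Fin 6, Nat.card {e : Fin 6 × Fin (6 * m + 3) | u e = x} = 6 * m + 3)
    (hv : ∀ y : Fin (6 * m + 3), Nat.card {e : Fin 6 × Fin (6 * m + 3) | v e = y} = 6) :
    ∃ ι : Fin 6 × Fin (6 * m + 3) → Fin 6 × Fin (6 * m + 3), ι ∘ ι = id ∧
      ∀ (x : Fin 6) (y : Fin (6 * m + 3)),
        ∃! e : Fin 6 × Fin (6 * m + 3), u (ι e) = x ∧ v e = y := by
  have F (y : Fin (6 * m + 3)) : Fin 6 ≃ {e // v e = y} :=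
    Classical.choice (Finite.card_eq.1 (by rw [Nat.card_fin]; exact (hv y).symm))
  let w (y : Fin (6 * m + 3)) (c : Fin 6) : Fin 6 := u (F y c).1
  have hcardsum (P : Fin 6 × Fin (6 * m + 3) → Prop) [DecidablePred P]
      (Φ : Fin (6 * m + 3) × Fin 6 ≃ Fin 6 × Fin (6 * m + 3)) :
      (Nat.card {e // P e} : ℤ) = ∑ y, ∑ c, if P (Φ (y, c)) then 1 else 0 := by
    rw [← Fintype.sum_prod_type' (fun y c => if P (Φ (y, c)) then (1 : ℤ) else 0),
      Equiv.sum_comp Φ (fun e => if P e then (1 : ℤ) else 0), Nat.card_eq_fintype_card,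
      Fintype.card_subtype]
    simp
  let Φ (π : Fin (6 * m + 3) → Equiv.Perm (Fin 6)) :
      Fin (6 * m + 3) × Fin 6 ≃ Fin 6 × Fin (6 * m + 3) :=
    (Equiv.sigmaEquivProd _ _).symm.trans
      ((Equiv.sigmaCongrRight fun y => (π y).trans (F y)).trans (Equiv.sigmaFiberEquiv v))
  have hw (a : Fin 6) :
      ∑ y, ∑ c, (if w y c = a then (1 : ℤ) else 0) = 6 * (m : ℤ) + 3 :=
    (hcardsum (fun e => u e = a) (Φ fun _ => 1)).symm.trans (by exact_mod_cast hu a)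
  obtain ⟨π, hπ⟩ := Balls.exists_symmetric_count w m (by simp) hw
  have hΦv (y c) : v (Φ π (y, c)) = y := (F y (π y c)).2
  have hΦu (y c) : u (Φ π (y, c)) = w y (π y c) := rfl
  have hcard (a b : Fin 6) :
      (Nat.card {e // u e = a ∧ ((Φ π).symm e).2 = b} : ℤ) = Balls.count w π a b := by
    rw [hcardsum _ (Φ π), Balls.count]
    refine Finset.sum_congr rfl fun y _ => ?_
    simp [and_comm, ite_and, hΦu]
  obtain ⟨ι, hι, huι⟩ := Balls.exists_involution u (fun e => ((Φ π).symm e).2) fun a b => by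
    rw [← Nat.cast_inj (R := ℤ), hcard, hcard, hπ]
  refine ⟨ι, hι, fun x y => ⟨Φ π (y, x), ⟨by simp [huι], hΦv y x⟩, ?_⟩⟩
  rintro e ⟨hx, hy⟩
  obtain ⟨⟨y', x'⟩, rfl⟩ := (Φ π).surjective e
  rw [huι, Equiv.symm_apply_apply] at hx
  rw [hΦv] at hy
  rw [← hx, ← hy]
end
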